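/- There are, up to isomorphism, exactly 18 distinct extremal fullerene graphs with 60 vertices, i.e. exactly 18 fullerene graphs on 60 vertices whose Clar number equals 8; one of them is the buckminsterfullerene C_60 (the unique fullerene graph on 60 vertices with no two adjacent pentagons). -/

import Mathlib

namespace FG

/-- A combinatorial plane (spherically embedded) graph: a finite simple graph together with
its collection of faces, each face recorded as the finset of edges of its boundary cycle.
Every face boundary is a cycle, every edge lies on exactly two faces, and Euler's formula
holds (edges are counted via the face incidences). -/
structure PlaneGraph (V : Type) [Fintype V] [DecidableEq V] : Type where
  graph : SimpleGraph V
  faces : Finset (Finset (Sym2 V))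
  face_edges : ∀ f ∈ faces, ∀ e ∈ f, e ∈ graph.edgeSet
  face_cycle : ∀ f ∈ faces, ∃ (v : V) (c : graph.Walk v v), c.IsCycle ∧ c.edges.toFinset = f
  edge_faces : ∀ e ∈ graph.edgeSet, (faces.filter (fun f => e ∈ f)).card = 2
  euler : 2 * (Fintype.card V + faces.card) = (∑ f ∈ faces, f.card) + 4

variable {V : Type} [Fintype V] [DecidableEq V]

/-- The vertices incident with at least one edge of an edge set. -/
def edgeVerts (E : Finset (Sym2 V)) : Finset V :=
  Finset.univ.filter fun v => ∃ e ∈ E, v ∈ e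

/-- The degree of a vertex in the subgraph spanned by an edge set. -/
def deg (E : Finset (Sym2 V)) (v : V) : ℕ := (E.filter fun e => v ∈ e).card

/-- The vertices covered by a collection of faces. -/
def facesVerts (H : Finset (Finset (Sym2 V))) : Finset V := edgeVerts (H.sup id)

/-- An edge set is a matching: non-loop edges, pairwise vertex-disjoint. -/
def IsMatching (M : Finset (Sym2 V)) : Prop :=
  (∀ e ∈ M, ¬e.IsDiag) ∧ ∀ e ∈ M, ∀ e' ∈ M, e ≠ e' → ∀ v : V, v ∈ e → v ∉ e'

/-- A fullerene graph: a cubic 3-connected plane graph with (exactly 12) pentagonal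
faces and hexagonal faces. -/
structure IsFullerene (P : PlaneGraph V) : Prop where
  cubic : ∀ v : V, (P.graph.neighborSet v).ncard = 3
  threeConnected : ∀ s : Set V, s.ncard ≤ 2 → (SimpleGraph.induce sᶜ P.graph).Connected
  faceSize : ∀ f ∈ P.faces, f.card = 5 ∨ f.card = 6
  pentTwelve : (P.faces.filter fun f => f.card = 5).card = 12

/-- A fragment of a plane graph: a nonempty set of faces (a cycle together with its
interior) whose boundary — the set of edges lying on exactly one chosen face — is a
single cycle. -/
structure Fragment (P : PlaneGraph V) : Type where
  inFaces : Finset (Finset (Sym2 V))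
  nonempty : inFaces.Nonempty
  subFaces : inFaces ⊆ P.faces
  boundary_cycle : ∃ (v : V) (c : P.graph.Walk v v), c.IsCycle ∧
    c.edges.toFinset =
      (inFaces.sup id).filter fun e => (inFaces.filter fun f => e ∈ f).card = 1

/-- The edge set of a fragment. -/
def Fragment.edges {P : PlaneGraph V} (B : Fragment P) : Finset (Sym2 V) := B.inFaces.sup id

/-- The boundary edges of a fragment. -/
def Fragment.boundary {P : PlaneGraph V} (B : Fragment P) : Finset (Sym2 V) :=
  B.edges.filter fun e => (B.inFaces.filter fun f => e ∈ f).card = 1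

/-- A pentagonal fragment: all inner faces are pentagons. -/
def IsPentagonalFragment {P : PlaneGraph V} (B : Fragment P) : Prop :=
  ∀ f ∈ B.inFaces, f.card = 5

/-- The faces of `P` adjoining the subgraph with edge set `E`: not a face of the
subgraph, but sharing at least one edge with it. -/
def adjoiningFaces (P : PlaneGraph V) (E : Finset (Sym2 V)) : Finset (Finset (Sym2 V)) :=
  P.faces.filter fun f => ¬f ⊆ E ∧ (f ∩ E).Nonempty

/-- The territory `T[G]` of the subgraph with edge set `E`: the subgraph together with
all adjoining faces. -/
def territoryEdges (P : PlaneGraph V) (E : Finset (Sym2 V)) : Finset (Sym2 V) :=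
  E ∪ (adjoiningFaces P E).sup id

/-- `w(G)`: the number of 2-degree vertices of the subgraph spanned by `E`. -/
def wcount (E : Finset (Sym2 V)) : ℕ := ((edgeVerts E).filter fun v => deg E v = 2).card

/-- A subgraph is maximal in `P` when its hexagon extension is contained in `P`,
i.e. every adjoining face is a hexagon. -/
def IsMaximalIn (P : PlaneGraph V) (E : Finset (Sym2 V)) : Prop :=
  ∀ f ∈ adjoiningFaces P E, f.card = 6

/-- `H ∈ 𝒮(G)` for the subgraph `G` with edge set `E`: `H` is a set of mutually disjoint
hexagons of the hexagon extension `H[G]` (hexagonal faces sharing at least one edge with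
`G`) such that `G − H` has a matching covering all remaining 3-degree vertices of `G`. -/
def SextetAdm (P : PlaneGraph V) (E : Finset (Sym2 V)) (H : Finset (Finset (Sym2 V))) : Prop :=
  (∀ f ∈ H, f ∈ P.faces ∧ f.card = 6 ∧ (f ∩ E).Nonempty) ∧
  (∀ f ∈ H, ∀ g ∈ H, f ≠ g → Disjoint (edgeVerts f) (edgeVerts g)) ∧
  ∃ M : Finset (Sym2 V), M ⊆ E ∧ IsMatching M ∧
    (∀ e ∈ M, ∀ v : V, v ∈ e → v ∉ facesVerts H) ∧
    ∀ v ∈ edgeVerts E, deg E v = 3 → v ∉ facesVerts H → ∃ e ∈ M, v ∈ e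

/-- `U_H(G) = V(G) ∖ V(H)`. -/
def Uset (E : Finset (Sym2 V)) (H : Finset (Finset (Sym2 V))) : Finset V :=
  edgeVerts E \ facesVerts H

/-- A Clar set of `H[G]`: a member of `𝒮(G)` minimizing `|U_H(G)|`. -/
def IsClarSet (P : PlaneGraph V) (E : Finset (Sym2 V)) (H : Finset (Finset (Sym2 V))) : Prop :=
  SextetAdm P E H ∧ ∀ H', SextetAdm P E H' → (Uset E H).card ≤ (Uset E H').card

/-- A normal Clar set: a Clar set such that `G − H` has a perfect matching. -/
def IsNormalClarSet (P : PlaneGraph V) (E : Finset (Sym2 V))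
    (H : Finset (Finset (Sym2 V))) : Prop :=
  IsClarSet P E H ∧ ∃ M : Finset (Sym2 V), M ⊆ E ∧ IsMatching M ∧
    (∀ e ∈ M, ∀ v : V, v ∈ e → v ∉ facesVerts H) ∧
    ∀ v ∈ Uset E H, ∃ e ∈ M, v ∈ e

/-- The pentagonal faces of the subgraph with edge set `E`. -/
def pentFaces (P : PlaneGraph V) (E : Finset (Sym2 V)) : Finset (Finset (Sym2 V)) :=
  P.faces.filter fun f => f.card = 5 ∧ f ⊆ E

/-- A subgraph with `k` pentagons is extremal if `|U_H(G)| = k` for a Clar set `H`. -/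
def IsExtremalSub (P : PlaneGraph V) (E : Finset (Sym2 V)) : Prop :=
  ∃ H, IsClarSet P E H ∧ (Uset E H).card = (pentFaces P E).card

/-- A pentagonal ring `R_k`: `k` pentagonal faces `R 0, …, R (k-1)` such that
`R i` and `R j` intersect iff `|i − j| = 1 (mod k)`. -/
def IsPentRing (P : PlaneGraph V) (k : ℕ) (R : ZMod k → Finset (Sym2 V)) : Prop :=
  Function.Injective R ∧ (∀ i, R i ∈ P.faces ∧ (R i).card = 5) ∧
  ∀ i j : ZMod k, i ≠ j →
    ((edgeVerts (R i) ∩ edgeVerts (R j)).Nonempty ↔ (j = i + 1 ∨ i = j + 1))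

/-- The number of pentagons of the pentagonal fragment `B` adjoining (sharing an edge
with) the pentagon `p`. -/
def pentAdjCount {P : PlaneGraph V} (B : Fragment P) (p : Finset (Sym2 V)) : ℕ :=
  (B.inFaces.filter fun q => q ≠ p ∧ (q ∩ p).Nonempty).card

/-- The fragment consisting of a single pentagon `P`. -/
def IsPentagonFrag {P : PlaneGraph V} (B : Fragment P) : Prop :=
  IsPentagonalFragment B ∧ B.inFaces.card = 1

/-- `B_2`: the extremal pentagonal fragment with 4 pentagons whose Clar extension is
normal. -/
def IsB2Frag {P : PlaneGraph V} (B : Fragment P) : Prop :=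
  IsPentagonalFragment B ∧ B.inFaces.card = 4 ∧ IsExtremalSub P B.edges ∧
    ∃ H, IsNormalClarSet P B.edges H

/-- `B_3`: the extremal pentagonal fragment with 6 pentagons whose Clar extension is
normal. -/
def IsB3Frag {P : PlaneGraph V} (B : Fragment P) : Prop :=
  IsPentagonalFragment B ∧ B.inFaces.card = 6 ∧ IsExtremalSub P B.edges ∧
    ∃ H, IsNormalClarSet P B.edges H

/-- A pasting edge of the subgraph with edge set `E`: an edge of `E` lying on the
boundary of the Clar extension `C[G]` (not an edge of a Clar hexagon) whose two
end-vertices belong to `V(H)` for a Clar set `H`. -/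
def IsPastingEdge (P : PlaneGraph V) (E : Finset (Sym2 V)) (e : Sym2 V) : Prop :=
  e ∈ E ∧ ∃ H, IsClarSet P E H ∧ (∀ v : V, v ∈ e → v ∈ facesVerts H) ∧ e ∉ H.sup id

/-- `B` arises from pasting `A` and `C` along a common pasting edge:
`B = A ∪ C` and `A ∩ C` is a single pasting edge of both. -/
def IsPasting {P : PlaneGraph V} (B A C : Fragment P) : Prop :=
  B.inFaces = A.inFaces ∪ C.inFaces ∧
  ∃ e : Sym2 V, A.edges ∩ C.edges = {e} ∧ IsPastingEdge P A.edges e ∧ IsPastingEdge P C.edges e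

def IsBasicFrag {P : PlaneGraph V} (B : Fragment P) : Prop :=
  IsPentagonFrag B ∨ IsB2Frag B ∨ IsB3Frag B

/-- The pentagonal fragments generated from `P`, `B_2`, `B_3` by the pasting operation. -/
inductive Pasted (P : PlaneGraph V) : Fragment P → Prop
  | base (B : Fragment P) : IsBasicFrag B → Pasted P B
  | paste (B A C : Fragment P) : Pasted P A → IsBasicFrag C → IsPasting B A C → Pasted P B

/-- `P ∗ P`. -/
def IsPPFrag {P : PlaneGraph V} (B : Fragment P) : Prop :=
  ∃ A C : Fragment P, IsPentagonFrag A ∧ IsPentagonFrag C ∧ IsPasting B A C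

/-- `P ∗ B_2`. -/
def IsPB2Frag {P : PlaneGraph V} (B : Fragment P) : Prop :=
  ∃ A C : Fragment P, IsPentagonFrag A ∧ IsB2Frag C ∧ IsPasting B A C

/-- `P ∗ B_2 ∗ P`. -/
def IsPB2PFrag {P : PlaneGraph V} (B : Fragment P) : Prop :=
  ∃ B' A C D : Fragment P, IsPentagonFrag A ∧ IsB2Frag C ∧ IsPentagonFrag D ∧
    IsPasting B' A C ∧ IsPasting B B' D

/-- The six members of `𝓑_{≥60}`. -/
def SixShapes {P : PlaneGraph V} (B : Fragment P) : Prop :=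
  IsPentagonFrag B ∨ IsB2Frag B ∨ IsB3Frag B ∨ IsPPFrag B ∨ IsPB2Frag B ∨ IsPB2PFrag B

/-- `B_1`: two vertex-disjoint pentagons joined by an edge. -/
def IsB1 (P : PlaneGraph V) (E : Finset (Sym2 V)) : Prop :=
  ∃ (f g : Finset (Sym2 V)) (a b : V), f ∈ P.faces ∧ g ∈ P.faces ∧ f.card = 5 ∧ g.card = 5 ∧
    Disjoint (edgeVerts f) (edgeVerts g) ∧ P.graph.Adj a b ∧
    a ∈ edgeVerts f ∧ b ∈ edgeVerts g ∧ E = f ∪ g ∪ {s(a, b)}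

/-- `B_1^k`: `k` copies of `B_1` pasted together along pasting edges of their pentagons. -/
inductive B1Pow (P : PlaneGraph V) : ℕ → Finset (Sym2 V) → Prop
  | one (E : Finset (Sym2 V)) : IsB1 P E → B1Pow P 1 E
  | succ (k : ℕ) (E X : Finset (Sym2 V)) (e : Sym2 V) (f g : Finset (Sym2 V)) :
      B1Pow P k E → IsB1 P X → E ∩ X = {e} → f ∈ P.faces → g ∈ P.faces →
      f.card = 5 → g.card = 5 → f ⊆ E → g ⊆ X → e ∈ f → e ∈ g →
      IsPastingEdge P f e → IsPastingEdge P g e → B1Pow P (k + 1) (E ∪ X)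

/-- `F` contains `B_1^k` for some `2 ≤ k ≤ 4` as a subgraph. -/
def ContainsB1Pow (P : PlaneGraph V) : Prop :=
  ∃ (k : ℕ) (E : Finset (Sym2 V)), 2 ≤ k ∧ k ≤ 4 ∧ B1Pow P k E

/-- A perfect matching of the plane graph `P`. -/
def IsPerfectMatching (P : PlaneGraph V) (M : Finset (Sym2 V)) : Prop :=
  (∀ e ∈ M, e ∈ P.graph.edgeSet) ∧ IsMatching M ∧ ∀ v : V, ∃ e ∈ M, v ∈ e

/-- A sextet pattern of `P`: mutually disjoint hexagonal faces, all alternating with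
respect to a common perfect matching. -/
def IsSextetPattern (P : PlaneGraph V) (H : Finset (Finset (Sym2 V))) : Prop :=
  (∀ f ∈ H, f ∈ P.faces ∧ f.card = 6) ∧
  (∀ f ∈ H, ∀ g ∈ H, f ≠ g → Disjoint (edgeVerts f) (edgeVerts g)) ∧
  ∃ M : Finset (Sym2 V), IsPerfectMatching P M ∧ ∀ f ∈ H, (f ∩ M).card = 3

/-- A Clar formula: a maximum sextet pattern. -/
def IsClarFormula (P : PlaneGraph V) (H : Finset (Finset (Sym2 V))) : Prop :=
  IsSextetPattern P H ∧ ∀ H', IsSextetPattern P H' → H'.card ≤ H.card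

/-- An extremal fullerene graph: the Clar number equals `(n − 12)/6`. -/
def IsExtremalFullerene (P : PlaneGraph V) : Prop :=
  ∃ H, IsClarFormula P H ∧ 6 * H.card = Fintype.card V - 12

/-- The edges of the union of all maximal pentagonal fragments of `P`. -/
noncomputable def maxPentEdges (P : PlaneGraph V) : Finset (Sym2 V) :=
  @Finset.filter _
    (fun e => ∃ B : Fragment P, IsPentagonalFragment B ∧ IsMaximalIn P B.edges ∧ e ∈ B.edges)
    (Classical.decPred _) (P.faces.sup id)

/-- The disjoint union of two copies of `K_2`. -/
def twoK2 : SimpleGraph (Fin 4) := SimpleGraph.fromEdgeSet {s(0, 1), s(2, 3)}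

/-- The tree `T_0` on six vertices: two adjacent 3-degree vertices, each also adjacent
to two leaves. -/
def treeT0 : SimpleGraph (Fin 6) :=
  SimpleGraph.fromEdgeSet {s(0, 1), s(0, 2), s(0, 3), s(1, 4), s(1, 5)}


/-- A fullerene graph has no two adjacent pentagons: no two pentagonal faces share an
edge. -/
def NoAdjacentPentagons (P : PlaneGraph V) : Prop :=
  ∀ f ∈ P.faces, ∀ g ∈ P.faces, f ≠ g → f.card = 5 → g.card = 5 → f ∩ g = ∅

end FG

namespace FG
/-! ### Engine -/
inductive Stk : Type
  | nil : Stk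
  | cons (a b : ℕ) (s : Stk) : Stk

/-- force evaluation of a number -/
noncomputable def frc {α : Type} (n : ℕ) (k : ℕ → α) : α :=
  Nat.rec (motive := fun _ => α) (k Nat.zero) (fun m _ => k (Nat.succ m)) n
/-- table lookup, 8 bits per field -/
def gt (T i : ℕ) : ℕ := Nat.land (Nat.shiftRight T (Nat.shiftLeft i (nat_lit 3))) (nat_lit 255)
def px (a : ℕ) : ℕ := Nat.xor a (nat_lit 1)
def sh (i v : ℕ) : ℕ := Nat.shiftLeft v (Nat.shiftLeft i (nat_lit 3))
/-- a digest kept in the low 64 bits of a table -/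
def dg (a b : ℕ) : ℕ :=
  Nat.mod (Nat.mul (Nat.lor (Nat.shiftLeft a (nat_lit 8)) b) (nat_lit 8765436271827364509))
    (nat_lit 18446744073709551616)
noncomputable def iteB {α : Type} (b : Bool) (x y : α) : α := Bool.rec (motive := fun _ => α) y x b
noncomputable def pushG (g c : ℕ) (s : Stk) : Stk :=
  Nat.rec (motive := fun _ => Stk) s (fun g _ => Stk.cons (px g) c s) g
def setR (r a b qa qb : ℕ) : ℕ :=
  Nat.xor (dg a b) (Nat.lor (Nat.lor (Nat.lor (Nat.lor r (sh a (Nat.succ b))) (sh b (Nat.succ a)))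
    (sh qa (Nat.succ qb))) (sh qb (Nat.succ qa)))

noncomputable def glueK (q : ℕ) (k : ℕ → Bool) (fuel : ℕ) : ℕ → Stk → Bool :=
  Nat.rec (motive := fun _ => ℕ → Stk → Bool) (fun r _ => k r)
   (fun _ rec r s =>
     Stk.rec (motive := fun _ => Bool) (k r)
      (fun a b Q _ =>
        frc a fun a => frc b fun b =>
        Nat.rec (motive := fun _ => Bool)
          (Nat.rec (motive := fun _ => Bool)
            (iteB (Nat.beq a b) true
              (frc (gt q a) fun qa =>
               iteB (Nat.beq qa b) true
                 (frc (gt q b) fun qb =>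
                  frc (setR r a b qa qb) fun r' =>
                   rec r'
                    (frc (px a) fun pa => frc (px b) fun pb => frc (px qa) fun pqa =>
                     frc (px qb) fun pqb =>
                     pushG (gt r' pa) pb (pushG (gt r' pb) pa
                      (pushG (gt r' pqa) pqb (pushG (gt r' pqb) pqa Q)))))))
            (fun c _ => iteB (Nat.beq c a) (rec r Q) true) (gt r b))
          (fun c _ => iteB (Nat.beq c b) (rec r Q) true) (gt r a))
      s) fuel

noncomputable def allB (P : ℕ → Bool) (n : ℕ) : Bool :=
  Nat.rec (motive := fun _ => Bool) true (fun m ih => iteB (P m) ih false) n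

def cntK (k : ℕ) : List ℕ → ℕ
  | [] => 0
  | a :: l => bif Nat.beq a k then Nat.succ (cntK k l) else cntK k l

/-- face pattern of size `k` at offset `n` -/
def facePat (n k : ℕ) : ℕ :=
  bif Nat.beq k (nat_lit 4) then Nat.add (Nat.mul n (nat_lit 72340172838076673))
    (nat_lit 1413984905396743) else
  bif Nat.beq k (nat_lit 6) then Nat.add (Nat.mul n (nat_lit 310698676526526814092329217))
    (nat_lit 10927685746443612200174091) else
  Nat.add (Nat.mul n (nat_lit 4740885567116192841985)) (nat_lit 129705083253175681545)
def addF (n k q : ℕ) : ℕ :=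
  Nat.lor (Nat.xor (dg n k) q) (Nat.shiftLeft (facePat n k) (Nat.shiftLeft n (nat_lit 3)))

noncomputable def search (sizes : List (ℕ × ℕ)) (leaf : ℕ → ℕ → ℕ → Bool) (fuel : ℕ) :
    ℕ → ℕ → ℕ → List ℕ → ℕ → Bool :=
  Nat.rec (motive := fun _ => ℕ → ℕ → ℕ → List ℕ → ℕ → Bool) (fun _ _ _ _ _ => false)
   (fun _ rec n q r fs x =>
     iteB (Nat.beq x n) (leaf n q r)
      (Nat.rec (motive := fun _ => Bool)
        ((sizes.all fun kc =>
          iteB (Nat.ble (Nat.mul (Nat.mul (nat_lit 2) kc.1) (Nat.succ (cntK kc.1 fs))) kc.2)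
            (frc (addF n kc.1 q) fun q' =>
            glueK q' (fun r' => frc (Nat.add n (Nat.mul (nat_lit 2) kc.1)) fun n' =>
              rec n' q' r' (kc.1 :: fs) x)
              (nat_lit 200) r (Stk.cons x n Stk.nil))
            true) &&
         allB (fun y => frc (Nat.add y (nat_lit 8)) fun y => Nat.rec (motive := fun _ => Bool)
            (glueK q (fun r' => rec n q r' fs x) (nat_lit 200) r (Stk.cons x y Stk.nil))
            (fun c _ => iteB (Nat.beq c x) false true) (gt r y)) (Nat.sub n (nat_lit 8)))
        (fun _ _ => frc (Nat.succ x) fun x' => rec n q r fs x')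
        (gt r x))) fuel
end FG

namespace FG
/-! ### Table lemmas -/
theorem frc_eq {α : Type} (n : ℕ) (k : ℕ → α) : frc n k = k n := by cases n <;> rfl
theorem iteB_eq {α : Type} (b : Bool) (x y : α) : iteB b x y = if b then x else y := by
  cases b <;> rfl
theorem testBit_gt (T i b : ℕ) : (gt T i).testBit b = (decide (b < 8) && T.testBit (8 * i + b)) := by
  have e : gt T i = (T >>> (i <<< 3)) % 2 ^ 8 := by
    rw [← Nat.and_two_pow_sub_one_eq_mod]; rfl
  rw [e, Nat.testBit_mod_two_pow, Nat.testBit_shiftRight, Nat.shiftLeft_eq]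
  congr 2; ring
theorem gt_lt (T i : ℕ) : gt T i < 256 := by
  have e : gt T i = (T >>> (i <<< 3)) % 2 ^ 8 := by
    rw [← Nat.and_two_pow_sub_one_eq_mod]; rfl
  rw [e]; exact Nat.mod_lt _ (by norm_num)
theorem gt_zero (i : ℕ) : gt 0 i = 0 := by
  apply Nat.eq_of_testBit_eq; intro b; rw [testBit_gt]; simp
theorem gt_lor (T S i : ℕ) : gt (Nat.lor T S) i = Nat.lor (gt T i) (gt S i) := by
  apply Nat.eq_of_testBit_eq; intro b
  have h1 : ∀ x y : ℕ, Nat.lor x y = x ||| y := fun _ _ => rfl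
  rw [testBit_gt, h1, h1, Nat.testBit_or, Nat.testBit_or, testBit_gt, testBit_gt]
  cases decide (b < 8) <;> simp
theorem gt_xor (T S i : ℕ) : gt (Nat.xor T S) i = Nat.xor (gt T i) (gt S i) := by
  apply Nat.eq_of_testBit_eq; intro b
  have h1 : ∀ x y : ℕ, Nat.xor x y = x ^^^ y := fun _ _ => rfl
  rw [testBit_gt, h1, h1, Nat.testBit_xor, Nat.testBit_xor, testBit_gt, testBit_gt]
  cases decide (b < 8) <;> simp
theorem gt_dg (a b i : ℕ) (hi : 8 ≤ i) : gt (dg a b) i = 0 := by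
  apply Nat.eq_of_testBit_eq; intro c
  rw [testBit_gt]
  have : dg a b < 2 ^ 64 := Nat.mod_lt _ (by norm_num)
  rw [Nat.testBit_lt_two_pow (lt_of_lt_of_le this (Nat.pow_le_pow_right (by norm_num) (by omega)))]
  simp
theorem gt_shift (B n i : ℕ) :
    gt (Nat.shiftLeft B (Nat.shiftLeft n 3)) i = if i < n then 0 else gt B (i - n) := by
  apply Nat.eq_of_testBit_eq; intro c
  have h1 : ∀ x y : ℕ, Nat.shiftLeft x y = x <<< y := fun _ _ => rfl
  rw [testBit_gt, h1, h1, Nat.testBit_shiftLeft, Nat.shiftLeft_eq]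
  split_ifs with h
  · by_cases hc : c < 8
    · have : ¬ (8 * i + c ≥ n * 2 ^ 3) := by omega
      rw [decide_eq_false this]; simp
    · simp [hc]
  · rw [testBit_gt]
    by_cases hc : c < 8
    · have : (8 * i + c ≥ n * 2 ^ 3) := by omega
      have e : 8 * i + c - n * 2 ^ 3 = 8 * (i - n) + c := by omega
      rw [decide_eq_true this, e]; simp
    · simp [hc]
theorem gt_small (v i : ℕ) (hv : v < 256) : gt v i = if i = 0 then v else 0 := by
  apply Nat.eq_of_testBit_eq; intro c
  rw [testBit_gt]
  split_ifs with h
  · subst h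
    by_cases hc : c < 8
    · simp [hc]
    · have : v < 2 ^ c := lt_of_lt_of_le hv (by
        calc 256 = 2 ^ 8 := by norm_num
          _ ≤ 2 ^ c := Nat.pow_le_pow_right (by norm_num) (by omega))
      simp [hc, Nat.testBit_lt_two_pow this]
  · have : v < 2 ^ (8 * i + c) := lt_of_lt_of_le hv (by
        calc 256 = 2 ^ 8 := by norm_num
          _ ≤ _ := Nat.pow_le_pow_right (by norm_num) (by omega))
    simp [Nat.testBit_lt_two_pow this]
theorem gt_sh (i v j : ℕ) (hv : v < 256) : gt (sh i v) j = if j = i then v else 0 := by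
  unfold sh
  have := gt_shift v i j
  rw [show Nat.shiftLeft i 3 = Nat.shiftLeft i (nat_lit 3) from rfl] at this
  rw [this, gt_small _ _ hv]
  split_ifs <;> first | rfl | omega
theorem px_even (x : ℕ) (h : x % 2 = 0) : px x = x + 1 := by
  have : px x = x ^^^ 1 := rfl
  rw [this]; exact Nat.xor_one_of_even (Nat.even_iff.2 h)
theorem px_odd (x : ℕ) (h : x % 2 = 1) : px x = x - 1 := by
  have : px x = x ^^^ 1 := rfl
  rw [this]; exact Nat.xor_one_of_odd (Nat.odd_iff.2 h)

/-! ### Systems -/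
/-- alternating sequence `y, p y, q p y, …` -/
def altS {Y : Type} (p q : Y → Y) (y : Y) : ℕ → Y
  | 0 => y
  | n + 1 => if n % 2 = 0 then p (altS p q y n) else q (altS p q y n)

structure Sys (Y : Type) (p q r : Y → Y) (sz : Y → ℕ) : Prop where
  pp : ∀ y, p (p y) = y
  qq : ∀ y, q (q y) = y
  rr : ∀ y, r (r y) = y
  rne : ∀ y, r y ≠ y
  rneq : ∀ y, r y ≠ q y
  rq : ∀ y, r (q y) = q (r y)
  hprp : ∀ y, r (p (r (p (r y)))) = p y
  szp : ∀ y, sz (p y) = sz y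
  szq : ∀ y, sz (q y) = sz y
  close : ∀ y, altS p q y (2 * sz y) = y
  inj : ∀ y, ∀ i j, i < j → j < 2 * sz y → altS p q y i ≠ altS p q y j
  trans : ∀ S : Set Y, S.Nonempty → (∀ y ∈ S, p y ∈ S ∧ q y ∈ S ∧ r y ∈ S) → S = Set.univ

section sound
variable {Y : Type} {p q r : Y → Y} {sz : Y → ℕ}

/-- invariants on the face table -/
structure InvQ (p q : Y → Y) (n tq : ℕ) (ψ : ℕ → Y) : Prop where
  n8 : 8 ≤ n
  ev : n % 2 = 0
  inj : ∀ x y, 8 ≤ x → x < n → 8 ≤ y → y < n → ψ x = ψ y → x = y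
  qd : ∀ x, 8 ≤ x → x < n → 8 ≤ gt tq x ∧ gt tq x < n ∧ q (ψ x) = ψ (gt tq x)
  pd : ∀ x, 8 ≤ x → x < n → p (ψ x) = ψ (px x)
  q0 : ∀ x, n ≤ x → gt tq x = 0

/-- invariants on the glue table -/
def InvR (r : Y → Y) (n tr : ℕ) (ψ : ℕ → Y) : Prop :=
  ∀ x, 8 ≤ x → gt tr x ≠ 0 → x < n ∧ 8 ≤ gt tr x - 1 ∧ gt tr x - 1 < n ∧ r (ψ x) = ψ (gt tr x - 1)

def InvS (r : Y → Y) (n : ℕ) (ψ : ℕ → Y) : Stk → Prop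
  | Stk.nil => True
  | Stk.cons a b s => (8 ≤ a ∧ a < n ∧ 8 ≤ b ∧ b < n ∧ r (ψ a) = ψ b) ∧ InvS r n ψ s

theorem InvQ.px_mem {n tq : ℕ} {ψ : ℕ → Y} (h : InvQ p q n tq ψ) {x : ℕ} (h1 : 8 ≤ x) (h2 : x < n) :
    8 ≤ px x ∧ px x < n := by
  have := h.ev
  rcases Nat.mod_two_eq_zero_or_one x with h3 | h3
  · rw [px_even x h3]; omega
  · rw [px_odd x h3]; omega

theorem invR_lor {n tq tr : ℕ} {ψ : ℕ → Y} (hq : InvQ p q n tq ψ) (hn : n ≤ 200)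
    (hr : InvR r n tr ψ) {a b : ℕ}
    (ha : 8 ≤ a) (ha' : a < n) (hb : 8 ≤ b) (hb' : b < n) (hab : r (ψ a) = ψ b) :
    InvR r n (Nat.lor tr (sh a (Nat.succ b))) ψ := by
  intro x hx hne
  have hv : Nat.succ b < 256 := by omega
  rw [gt_lor, gt_sh _ _ _ hv] at hne ⊢
  have h1 : ∀ x y : ℕ, Nat.lor x y = x ||| y := fun _ _ => rfl
  rw [h1] at hne ⊢
  split_ifs at hne ⊢ with h
  · subst h
    by_cases h0 : gt tr x = 0
    · rw [h0]; simp; exact ⟨ha', hb, hb', hab⟩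
    · obtain ⟨_, h3, h4, h5⟩ := hr x hx h0
      have : b = gt tr x - 1 := hq.inj _ _ hb hb' h3 h4 (by rw [← hab, h5])
      have e : gt tr x = Nat.succ b := by omega
      rw [e]; simp; exact ⟨ha', hb, hb', hab⟩
  · simp only [Nat.or_zero] at hne ⊢
    exact hr x hx hne

theorem invR_xor {n tr a b : ℕ} {ψ : ℕ → Y} (hr : InvR r n tr ψ) :
    InvR r n (Nat.xor (dg a b) tr) ψ := by
  intro x hx hne
  rw [gt_xor, gt_dg _ _ _ hx] at hne ⊢
  have h1 : ∀ x y : ℕ, Nat.xor x y = x ^^^ y := fun _ _ => rfl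
  rw [h1, Nat.zero_xor] at hne ⊢
  exact hr x hx hne

theorem glueK_succ_cons (tq : ℕ) (k : ℕ → Bool) (f tr a b : ℕ) (Q : Stk) :
    glueK tq k (f + 1) tr (Stk.cons a b Q) =
      if gt tr a = 0 then
        (if gt tr b = 0 then
          (if a = b then true else if gt tq a = b then true else
            (glueK tq k f (setR tr a b (gt tq a) (gt tq b))
              (pushG (gt (setR tr a b (gt tq a) (gt tq b)) (px a)) (px b)
               (pushG (gt (setR tr a b (gt tq a) (gt tq b)) (px b)) (px a)
                (pushG (gt (setR tr a b (gt tq a) (gt tq b)) (px (gt tq a))) (px (gt tq b))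
                 (pushG (gt (setR tr a b (gt tq a) (gt tq b)) (px (gt tq b))) (px (gt tq a)) Q))))))
          else if gt tr b - 1 = a then glueK tq k f tr Q else true)
      else if gt tr a - 1 = b then glueK tq k f tr Q else true := by
  have e : glueK tq k (f + 1) tr (Stk.cons a b Q) =
     (frc a fun a => frc b fun b =>
        Nat.rec (motive := fun _ => Bool)
          (Nat.rec (motive := fun _ => Bool)
            (iteB (Nat.beq a b) true
              (frc (gt tq a) fun qa =>
               iteB (Nat.beq qa b) true
                 (frc (gt tq b) fun qb =>
                  frc (setR tr a b qa qb) fun r' =>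
                   glueK tq k f r'
                    (frc (px a) fun pa => frc (px b) fun pb => frc (px qa) fun pqa =>
                     frc (px qb) fun pqb =>
                     pushG (gt r' pa) pb (pushG (gt r' pb) pa
                      (pushG (gt r' pqa) pqb (pushG (gt r' pqb) pqa Q)))))))
            (fun c _ => iteB (Nat.beq c a) (glueK tq k f tr Q) true) (gt tr b))
          (fun c _ => iteB (Nat.beq c b) (glueK tq k f tr Q) true) (gt tr a)) := rfl
  rw [e]
  simp only [frc_eq, iteB_eq, Nat.beq_eq]
  rcases h : gt tr a with _ | c
  · rcases h' : gt tr b with _ | c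
    · simp
    · simp
  · simp

theorem invS_push (S : Sys Y p q r sz) {n tq tr : ℕ} {ψ : ℕ → Y} (hq : InvQ p q n tq ψ)
    (hr : InvR r n tr ψ) {a b : ℕ} {Q : Stk}
    (ha : 8 ≤ a) (ha' : a < n) (hb : 8 ≤ b) (hb' : b < n) (hab : r (ψ a) = ψ b)
    (hQ : InvS r n ψ Q) : InvS r n ψ (pushG (gt tr (px a)) (px b) Q) := by
  obtain ⟨pa, pa'⟩ := hq.px_mem ha ha'
  obtain ⟨pb, pb'⟩ := hq.px_mem hb hb'
  have h0 := hr (px a) pa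
  rcases h : gt tr (px a) with _ | g
  · exact hQ
  · rw [h] at h0
    obtain ⟨_, h1, h2, h3⟩ := h0 (by omega)
    simp only [Nat.add_sub_cancel] at h1 h2 h3
    refine ⟨⟨(hq.px_mem h1 h2).1, (hq.px_mem h1 h2).2, pb, pb', ?_⟩, hQ⟩
    rw [← hq.pd g h1 h2, ← h3, ← hq.pd a ha ha', ← hq.pd b hb hb', ← S.hprp (ψ b)]
    rw [← hab, S.rr]

theorem glueK_sound (S : Sys Y p q r sz) {n tq : ℕ} {ψ : ℕ → Y} (hq : InvQ p q n tq ψ)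
    (hn : n ≤ 200) (k : ℕ → Bool) : ∀ (f tr : ℕ) (s : Stk), InvR r n tr ψ → InvS r n ψ s →
      glueK tq k f tr s = true → ∃ tr', InvR r n tr' ψ ∧ k tr' = true := by
  intro f
  induction f with
  | zero => intro tr s h1 _ h3; exact ⟨tr, h1, h3⟩
  | succ f ih =>
    intro tr s h1 h2 h3
    cases s with
    | nil => exact ⟨tr, h1, h3⟩
    | cons a b Q =>
      obtain ⟨⟨ha, ha', hb, hb', hab⟩, hQ⟩ := h2
      have hba : r (ψ b) = ψ a := by rw [← hab, S.rr]
      rw [glueK_succ_cons] at h3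
      split_ifs at h3 with c1 c2 c3 c4 c5 c6
      · subst c3; exact absurd hab (S.rne _)
      · exact absurd (hab.trans (by rw [(hq.qd a ha ha').2.2, c4])) (S.rneq _)
      · obtain ⟨qa, qa', qae⟩ := hq.qd a ha ha'
        obtain ⟨qb, qb', qbe⟩ := hq.qd b hb hb'
        have hqab : r (ψ (gt tq a)) = ψ (gt tq b) := by
          rw [← qae, S.rq, hab, qbe]
        have hqba : r (ψ (gt tq b)) = ψ (gt tq a) := by rw [← hqab, S.rr]
        have hR : InvR r n (setR tr a b (gt tq a) (gt tq b)) ψ := by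
          unfold setR
          exact invR_xor (invR_lor hq hn (invR_lor hq hn (invR_lor hq hn (invR_lor hq hn h1
            ha ha' hb hb' hab) hb hb' ha ha' hba) qa qa' qb qb' hqab) qb qb' qa qa' hqba)
        refine ih _ _ hR ?_ h3
        exact invS_push S hq hR ha ha' hb hb' hab (invS_push S hq hR hb hb' ha ha' hba
          (invS_push S hq hR qa qa' qb qb' hqab (invS_push S hq hR qb qb' qa qa' hqba hQ)))
      · exact ih _ _ h1 hQ h3
      · obtain ⟨_, h4, h5, h6⟩ := h1 b hb c2
        exact absurd (hq.inj _ _ h4 h5 ha ha' (by rw [← h6, hba])) c5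
      · exact ih _ _ h1 hQ h3
      · obtain ⟨_, h4, h5, h6⟩ := h1 a ha c1
        exact absurd (hq.inj _ _ h4 h5 hb hb' (by rw [← h6, hab])) c6
end sound
end FG

namespace FG
section sound2
variable {Y : Type} {p q r : Y → Y} {sz : Y → ℕ}

theorem facePat_chk : ∀ n < 153, ∀ k < 3, facePat n (k + 4) < 2 ^ (16 * (k + 4)) ∧
    ∀ j < 2 * (k + 4), gt (facePat n (k + 4)) j =
      n + (if j % 2 = 1 then (j + 1) % (2 * (k + 4)) else (j + 2 * (k + 4) - 1) % (2 * (k + 4))) := by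
  decide +kernel

theorem gt_facePat (n k j : ℕ) (hn : n ≤ 152) (hk : 4 ≤ k) (hk' : k ≤ 6) :
    gt (facePat n k) j = if j < 2 * k then
      n + (if j % 2 = 1 then (j + 1) % (2 * k) else (j + 2 * k - 1) % (2 * k)) else 0 := by
  obtain ⟨m, rfl⟩ : ∃ m, k = m + 4 := ⟨k - 4, by omega⟩
  obtain ⟨h1, h2⟩ := facePat_chk n (by omega) m (by omega)
  split_ifs with h
  · rw [h2 j h, if_pos ‹_›]
  · rw [h2 j h, if_neg ‹_›]
  · apply Nat.eq_of_testBit_eq; intro c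
    rw [testBit_gt, Nat.testBit_lt_two_pow (lt_of_lt_of_le h1
      (Nat.pow_le_pow_right (by norm_num) (by omega)))]
    simp

theorem gt_addF (n k tq x : ℕ) (hx : 8 ≤ x) (h0 : ∀ x, n ≤ x → gt tq x = 0) :
    gt (addF n k tq) x = if x < n then gt tq x else gt (facePat n k) (x - n) := by
  unfold addF
  rw [gt_lor, gt_xor, gt_dg _ _ _ hx]
  have h2 := gt_shift (facePat n k) n x
  rw [show Nat.shiftLeft n 3 = Nat.shiftLeft n (nat_lit 3) from rfl] at h2
  rw [h2]
  have h1 : ∀ x y : ℕ, Nat.lor x y = x ||| y := fun _ _ => rfl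
  have h1' : ∀ x y : ℕ, Nat.xor x y = x ^^^ y := fun _ _ => rfl
  rw [h1, h1', Nat.zero_xor]
  split_ifs with h
  · simp
  · rw [h0 x (by omega)]; simp

theorem altS_p (S : Sys Y p q r sz) (y : Y) (j : ℕ) :
    p (altS p q y j) = if j % 2 = 0 then altS p q y (j + 1) else altS p q y (j - 1) := by
  split_ifs with h
  · simp [altS, h]
  · obtain ⟨m, rfl⟩ : ∃ m, j = m + 1 := ⟨j - 1, by omega⟩
    have : m % 2 = 0 := by omega
    simp [altS, this, S.pp]

theorem altS_q (S : Sys Y p q r sz) (y : Y) (j : ℕ) (hj : j < 2 * sz y) :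
    q (altS p q y j) = altS p q y
      (if j % 2 = 1 then (j + 1) % (2 * sz y) else (j + 2 * sz y - 1) % (2 * sz y)) := by
  split_ifs with h
  · have e : q (altS p q y j) = altS p q y (j + 1) := by simp [altS, h]
    rw [e]
    by_cases h1 : j + 1 = 2 * sz y
    · rw [h1, S.close, Nat.mod_self]; rfl
    · rw [Nat.mod_eq_of_lt (by omega)]
  · by_cases h0 : j = 0
    · subst h0
      have e2 := S.close y
      obtain ⟨m, hm⟩ : ∃ m, 2 * sz y = m + 1 := ⟨2 * sz y - 1, by omega⟩
      rw [Nat.zero_add, Nat.mod_eq_of_lt (by omega)]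
      rw [hm] at e2 ⊢
      have : ¬ m % 2 = 0 := by omega
      simp only [altS, this, if_false] at e2
      simp only [altS, Nat.add_sub_cancel]
      nth_rw 1 [← e2]; rw [S.qq]
    · obtain ⟨m, rfl⟩ : ∃ m, j = m + 1 := ⟨j - 1, by omega⟩
      have e3 : (m + 1 + 2 * sz y - 1) % (2 * sz y) = m := by
        rw [show m + 1 + 2 * sz y - 1 = m + 2 * sz y by omega, Nat.add_mod_right,
          Nat.mod_eq_of_lt (by omega)]
      rw [e3]
      have : ¬ m % 2 = 0 := by omega
      simp [altS, this, S.qq]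

theorem altS_sz (S : Sys Y p q r sz) (y : Y) (j : ℕ) : sz (altS p q y j) = sz y := by
  induction j with
  | zero => rfl
  | succ j ih => simp only [altS]; split_ifs <;> simp [S.szp, S.szq, ih]

theorem altS_notin (S : Sys Y p q r sz) {n tq : ℕ} {ψ : ℕ → Y} (hq : InvQ p q n tq ψ) (y : Y)
    (hy : ∀ x, 8 ≤ x → x < n → ψ x ≠ y) (j : ℕ) :
    ∀ x, 8 ≤ x → x < n → ψ x ≠ altS p q y j := by
  induction j with
  | zero => exact hy
  | succ j ih =>
    intro x h1 h2 h3
    simp only [altS] at h3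
    split_ifs at h3
    · exact ih (px x) (hq.px_mem h1 h2).1 (hq.px_mem h1 h2).2 (by rw [← hq.pd x h1 h2, h3, S.pp])
    · obtain ⟨a, b, c⟩ := hq.qd x h1 h2
      exact ih _ a b (by rw [← c, h3, S.qq])

/-- the new labelling -/
noncomputable def ext (p q : Y → Y) (n : ℕ) (ψ : ℕ → Y) (y : Y) (x : ℕ) : Y :=
  if x < n then ψ x else altS p q y (x - n)

theorem invQ_add (S : Sys Y p q r sz) {n tq : ℕ} {ψ : ℕ → Y} (hq : InvQ p q n tq ψ)
    (hn : n ≤ 152) (y : Y)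
    (hy : ∀ x, 8 ≤ x → x < n → ψ x ≠ y) (h4 : 4 ≤ sz y) (h6 : sz y ≤ 6) :
    InvQ p q (n + 2 * sz y) (addF n (sz y) tq) (ext p q n ψ y) where
  n8 := by have := hq.n8; omega
  ev := by have := hq.ev; omega
  inj := by
    intro a b ha ha' hb hb' h
    unfold ext at h
    split_ifs at h with h1 h2 h2
    · exact hq.inj _ _ ha h1 hb h2 h
    · exact absurd h (altS_notin S hq y hy _ _ ha h1)
    · exact absurd h.symm (altS_notin S hq y hy _ _ hb h2)
    · rcases lt_trichotomy (a - n) (b - n) with h3 | h3 | h3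
      · exact absurd h (S.inj _ _ _ h3 (by omega))
      · omega
      · exact absurd h.symm (S.inj _ _ _ h3 (by omega))
  qd := by
    intro x h1 h2
    rw [gt_addF _ _ _ _ h1 hq.q0]
    have n8 := hq.n8
    by_cases h3 : x < n
    · obtain ⟨a, b, c⟩ := hq.qd x h1 h3
      simp only [ext, h3, if_true, b]
      exact ⟨a, by omega, c⟩
    · have h5 : x - n < 2 * sz y := by omega
      simp only [h3, if_false]
      rw [gt_facePat _ _ _ hn h4 h6, if_pos h5]
      have h7 : (if (x - n) % 2 = 1 then (x - n + 1) % (2 * sz y)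
        else (x - n + 2 * sz y - 1) % (2 * sz y)) < 2 * sz y := by
        split_ifs <;> exact Nat.mod_lt _ (by omega)
      refine ⟨by omega, by omega, ?_⟩
      unfold ext
      rw [if_neg h3, if_neg (by omega), altS_q S _ _ h5, Nat.add_sub_cancel_left]
  pd := by
    intro x h1 h2
    have ev := hq.ev
    unfold ext
    by_cases h3 : x < n
    · rw [if_pos h3, if_pos (hq.px_mem h1 h3).2, hq.pd x h1 h3]
    · rw [if_neg h3, altS_p S]
      rcases Nat.mod_two_eq_zero_or_one x with h5 | h5
      · rw [px_even _ h5, if_pos (by omega), if_neg (by omega)]; congr 1; omega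
      · rw [px_odd _ h5, if_neg (by omega), if_neg (by omega)]; congr 1; omega
  q0 := by
    intro x h
    rw [gt_addF _ _ _ _ (by have := hq.n8; omega) hq.q0, if_neg (by omega),
      gt_facePat _ _ _ hn h4 h6, if_neg (by omega)]

theorem InvQ.card_le [Fintype Y] {n tq : ℕ} {ψ : ℕ → Y} (hq : InvQ p q n tq ψ) :
    n - 8 ≤ Fintype.card Y := by
  classical
  have := Finset.card_le_card_of_injOn (s := Finset.Ico 8 n) (t := Finset.univ) ψ (by simp)
    (by
      intro a ha b hb h
      simp only [Finset.coe_Ico, Set.mem_Ico] at ha hb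
      exact hq.inj a b ha.1 ha.2 hb.1 hb.2 h)
  simpa using this

def InvC (sz : Y → ℕ) (n : ℕ) (ψ : ℕ → Y) (fs : List ℕ) : Prop :=
  ∀ k, ((Finset.Ico 8 n).filter fun x => sz (ψ x) = k).card = 2 * k * cntK k fs

theorem invC_add (S : Sys Y p q r sz) {n tq : ℕ} {ψ : ℕ → Y} {fs : List ℕ} (y : Y)
    (hq : InvQ p q n tq ψ) (hc : InvC sz n ψ fs) :
    InvC sz (n + 2 * sz y) (ext p q n ψ y) (sz y :: fs) := by
  intro k
  have n8 := hq.n8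
  have e : Finset.Ico 8 (n + 2 * sz y) = Finset.Ico 8 n ∪ Finset.Ico n (n + 2 * sz y) :=
    (Finset.Ico_union_Ico_eq_Ico n8 (by omega)).symm
  rw [e, Finset.filter_union, Finset.card_union_of_disjoint]
  · have e1 : ((Finset.Ico 8 n).filter fun x => sz (ext p q n ψ y x) = k) =
        ((Finset.Ico 8 n).filter fun x => sz (ψ x) = k) := by
      apply Finset.filter_congr
      intro x hx
      have : x < n := (Finset.mem_Ico.1 hx).2
      simp [ext, this]
    have e2 : ((Finset.Ico n (n + 2 * sz y)).filter fun x => sz (ext p q n ψ y x) = k) =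
        ((Finset.Ico n (n + 2 * sz y)).filter fun x => sz y = k) := by
      apply Finset.filter_congr
      intro x hx
      have : ¬ x < n := by have := (Finset.mem_Ico.1 hx).1; omega
      simp [ext, this, altS_sz S]
    rw [e1, e2, hc k]
    by_cases h : sz y = k
    · have : Nat.beq (sz y) k = true := by simp [h]
      simp only [h, Finset.filter_true, Nat.card_Ico, cntK]
      rw [h] at this
      rw [this]; simp only [cond_true, Nat.succ_eq_add_one]
      rw [Nat.add_sub_cancel_left]; ring
    · have : Nat.beq (sz y) k = false := by
        rw [Bool.eq_false_iff]; simpa using h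
      simp only [h, Finset.filter_false, Finset.card_empty, cntK]
      rw [this]; simp
  · apply Finset.disjoint_filter_filter
    exact Finset.Ico_disjoint_Ico_consecutive _ _ _

theorem InvC.bound [Fintype Y] {n tq : ℕ} {ψ : ℕ → Y} {fs : List ℕ}
    (hq : InvQ p q n tq ψ) (hc : InvC sz n ψ fs) (k : ℕ) :
    2 * k * cntK k fs ≤ (Finset.univ.filter fun y => sz y = k).card := by
  classical
  rw [← hc k]
  apply Finset.card_le_card_of_injOn ψ
  · intro x hx
    simp only [Finset.coe_filter, Finset.mem_Ico, Set.mem_ofPred_eq] at hx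
    simp [hx.2]
  · intro a ha b hb h
    simp only [Finset.coe_filter, Finset.mem_Ico, Set.mem_ofPred_eq] at ha hb
    exact hq.inj a b ha.1.1 ha.1.2 hb.1.1 hb.1.2 h

theorem allB_iff (P : ℕ → Bool) (n : ℕ) : allB P n = true ↔ ∀ m < n, P m = true := by
  induction n with
  | zero => simp [allB]
  | succ n ih =>
    have e : allB P (n + 1) = iteB (P n) (allB P n) false := rfl
    rw [e, iteB_eq]
    constructor
    · intro h m hm
      split_ifs at h with h1
      rcases Nat.lt_succ_iff_lt_or_eq.1 hm with h2 | h2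
      · exact ih.1 h m h2
      · rw [h2]; exact h1
    · intro h
      rw [if_pos (h n (by omega))]
      exact ih.2 fun m hm => h m (by omega)

theorem search_succ (sizes : List (ℕ × ℕ)) (leaf : ℕ → ℕ → ℕ → Bool) (f n tq tr : ℕ)
    (fs : List ℕ) (x : ℕ) :
    search sizes leaf (f + 1) n tq tr fs x = if x = n then leaf n tq tr else
      if gt tr x = 0 then
        (sizes.all fun kc =>
          if 2 * kc.1 * (cntK kc.1 fs + 1) ≤ kc.2 then
            glueK (addF n kc.1 tq) (fun r' =>
              search sizes leaf f (n + 2 * kc.1) (addF n kc.1 tq) r' (kc.1 :: fs) x)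
              200 tr (Stk.cons x n Stk.nil) else true) &&
         allB (fun y => if gt tr (y + 8) = 0 then
            (glueK tq (fun r' => search sizes leaf f n tq r' fs x) 200 tr
              (Stk.cons x (y + 8) Stk.nil)) else if gt tr (y + 8) - 1 = x then false else true) (n - 8)
      else search sizes leaf f n tq tr fs (x + 1) := by
  have e : search sizes leaf (f + 1) n tq tr fs x = iteB (Nat.beq x n) (leaf n tq tr)
      (Nat.rec (motive := fun _ => Bool)
        ((sizes.all fun kc =>
          iteB (Nat.ble (Nat.mul (Nat.mul (nat_lit 2) kc.1) (Nat.succ (cntK kc.1 fs))) kc.2)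
            (frc (addF n kc.1 tq) fun q' =>
            glueK q' (fun r' => frc (Nat.add n (Nat.mul (nat_lit 2) kc.1)) fun n' =>
              search sizes leaf f n' q' r' (kc.1 :: fs) x)
              (nat_lit 200) tr (Stk.cons x n Stk.nil))
            true) &&
         allB (fun y => frc (Nat.add y (nat_lit 8)) fun y => Nat.rec (motive := fun _ => Bool)
            (glueK tq (fun r' => search sizes leaf f n tq r' fs x) (nat_lit 200) tr
              (Stk.cons x y Stk.nil))
            (fun c _ => iteB (Nat.beq c x) false true) (gt tr y)) (Nat.sub n (nat_lit 8)))
        (fun _ _ => frc (Nat.succ x) fun x' => search sizes leaf f n tq tr fs x')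
        (gt tr x)) := rfl
  rw [e]
  simp only [frc_eq, iteB_eq, Nat.beq_eq, Nat.ble_eq]
  split_ifs with h1 h2
  · rfl
  · rw [h2]
    refine congrArg₂ and rfl (congrArg₂ allB (funext fun y => ?_) rfl)
    change (Nat.rec _ _ (gt tr (y + 8)) : Bool) = _
    rcases h' : gt tr (y + 8) with _ | c
    · simp
    · simp
  · obtain ⟨c, h3⟩ : ∃ c, gt tr x = c + 1 := ⟨gt tr x - 1, by omega⟩
    rw [h3]

theorem search_sound [Fintype Y] (S : Sys Y p q r sz) (hcard : Fintype.card Y ≤ 144)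
    (sizes : List (ℕ × ℕ)) (leaf : ℕ → ℕ → ℕ → Bool)
    (hs : ∀ y, 4 ≤ sz y ∧ sz y ≤ 6 ∧
      ∃ kc ∈ sizes, kc.1 = sz y ∧ (Finset.univ.filter fun y' => sz y' = sz y).card ≤ kc.2) :
    ∀ (f n tq tr : ℕ) (fs : List ℕ) (x : ℕ) (ψ : ℕ → Y), InvQ p q n tq ψ → InvR r n tr ψ →
      InvC sz n ψ fs → 8 ≤ x → x ≤ n → search sizes leaf f n tq tr fs x = true →
      ∃ (n tq tr : ℕ) (ψ : ℕ → Y), InvQ p q n tq ψ ∧ InvR r n tr ψ ∧ leaf n tq tr = true := by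
  intro f
  induction f with
  | zero => intro n tq tr fs x ψ _ _ _ _ _ h; exact absurd h (by simp [search])
  | succ f ih =>
    intro n tq tr fs x ψ hq hr hc hx hxn h
    have hn := hq.card_le
    rw [search_succ] at h
    split_ifs at h with h1 h2
    · exact ⟨n, tq, tr, ψ, hq, hr, h⟩
    · rw [Bool.and_eq_true] at h
      obtain ⟨hA, hB⟩ := h
      by_cases hy : ∃ y, 8 ≤ y ∧ y < n ∧ ψ y = r (ψ x)
      · obtain ⟨y, y1, y2, y3⟩ := hy
        have h3 := (allB_iff _ _).1 hB (y - 8) (by omega)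
        rw [show y - 8 + 8 = y by omega] at h3
        by_cases h4 : gt tr y = 0
        · rw [if_pos h4] at h3
          obtain ⟨tr', h5, h6⟩ := glueK_sound S hq (by omega) _ _ _ (Stk.cons x y Stk.nil) hr
            ⟨⟨hx, by omega, y1, y2, y3.symm⟩, trivial⟩ h3
          exact ih _ _ _ _ _ ψ hq h5 hc hx hxn h6
        · obtain ⟨_, z1, z2, z3⟩ := hr y y1 h4
          have : gt tr y - 1 = x := hq.inj _ _ z1 z2 hx (by omega) (by rw [← z3, y3, S.rr])
          rw [if_neg h4, if_pos this] at h3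
          exact absurd h3 (by simp)
      · push Not at hy
        obtain ⟨s4, s6, ⟨k, cap⟩, h3, h4, h5⟩ := hs (r (ψ x))
        simp only at h4 h5
        subst h4
        have h6 := List.all_eq_true.1 hA _ h3
        have hq' := invQ_add S hq (by omega) (r (ψ x)) hy s4 s6
        have hc' := invC_add S (r (ψ x)) hq hc
        have hb := hc'.bound hq' (sz (r (ψ x)))
        have hcnt : cntK (sz (r (ψ x))) (sz (r (ψ x)) :: fs) = cntK (sz (r (ψ x))) fs + 1 := by
          simp [cntK]
        rw [hcnt] at hb
        simp only at h6
        rw [if_pos (by omega)] at h6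
        have hn' := hq'.card_le
        have hr' : InvR r (n + 2 * sz (r (ψ x))) tr (ext p q n ψ (r (ψ x))) := by
          intro z hz hz'
          obtain ⟨a, b, c, d⟩ := hr z hz hz'
          refine ⟨by omega, b, by omega, ?_⟩
          simp only [ext, a, c, if_true]; exact d
        obtain ⟨tr', h7, h8⟩ := glueK_sound S hq' (by omega) _ _ _ (Stk.cons x n Stk.nil) hr'
          ⟨⟨hx, by omega, hq.n8, by omega, by
            have : x < n := by omega
            simp [ext, this, altS]⟩, trivial⟩ h6
        exact ih _ _ _ _ _ _ hq' h7 hc' hx (by omega) h8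
    · exact ih _ _ _ _ _ ψ hq hr hc (by omega) (by omega) h
end sound2
end FG

namespace FG
/-! ### Flag systems -/
structure FSys {V X F : Type} (G : SimpleGraph V) (s0 s1 s2 : X → X) (fz : X → ℕ) (vt : X → V)
    (fc : X → F) : Prop where
  i0 : ∀ x, s0 (s0 x) = x
  i1 : ∀ x, s1 (s1 x) = x
  i2 : ∀ x, s2 (s2 x) = x
  n1 : ∀ x, s1 x ≠ x
  n2 : ∀ x, s2 x ≠ x
  comm : ∀ x, s0 (s2 x) = s2 (s0 x)
  braid : ∀ x, s2 (s1 (s2 x)) = s1 (s2 (s1 x))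
  z0 : ∀ x, fz (s0 x) = fz x
  z1 : ∀ x, fz (s1 x) = fz x
  f0 : ∀ x, fc (s0 x) = fc x
  f1 : ∀ x, fc (s1 x) = fc x
  v1 : ∀ x, vt (s1 x) = vt x
  v2 : ∀ x, vt (s2 x) = vt x
  adj : ∀ x, G.Adj (vt x) (vt (s0 x))
  close : ∀ x, altS s0 s1 x (2 * fz x) = x
  inj : ∀ x, ∀ i j, i < j → j < 2 * fz x → altS s0 s1 x i ≠ altS s0 s1 x j
  trans : ∀ S : Set X, S.Nonempty → (∀ y ∈ S, s0 y ∈ S ∧ s1 y ∈ S ∧ s2 y ∈ S) → S = Set.univ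
  vsurj : ∀ v, ∃ x, vt x = v

structure Deco0 {X : Type} (s0 s1 s2 : X → X) (c h : X → Bool) : Prop where
  c0 : ∀ x, c (s0 x) = c x
  c2 : ∀ x, c (s2 x) = c x
  h0 : ∀ x, h (s0 x) = h x
  h1 : ∀ x, h (s1 x) = h x
  a1 : ∀ x, h x = true → c x = true
  a2 : ∀ x, h x = false → c x = true → c (s1 x) = false
  a3 : ∀ x, h x = true → h (s2 x) = false
  a3' : ∀ x, h x = true → c (s1 (s2 x)) = false
  a5 : ∀ x, c x = false → c (s1 x) = true → c (s1 (s2 x)) = true → h (s2 (s1 x)) = true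

structure Deco {X F : Type} (s0 s1 s2 : X → X) (fz : X → ℕ) (fc : X → F) (c h : X → Bool) : Prop
    extends Deco0 s0 s1 s2 c h where
  a4 : ∀ x, c x = false → c (s1 x) = false → c (s1 (s2 x)) = true
  f56 : ∀ x, fz x = 5 ∨ fz x = 6
  hex : ∀ x, fz x = 6 → c x = false → c (s1 x) = true
  pent : ∀ x x', fz x = 5 → c x = false → c (s1 x) = false → fc x' = fc x → c x' = false →
    c (s1 x') = false → x' = x ∨ x' = s1 x

/-- the decorated system on the contracted flags -/
structure Dec {V Y : Type} (G : SimpleGraph V) (p q r : Y → Y) (sz : Y → ℕ) (δ : Y → Bool)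
    (φ : Y → V) : Prop where
  dp : ∀ y, δ (p y) = δ y
  dq : ∀ y, sz y = 4 → δ (q y) = !(δ y)
  dh : ∀ y, sz y ≠ 4 → δ y = false
  dr : ∀ y, δ y = true → δ (r y) = false
  fq : ∀ y, φ (q y) = φ y
  fp : ∀ y, δ y = true → φ (p y) = φ y
  ar : ∀ y, G.Adj (φ y) (φ (r y))
  ap : ∀ y, δ y = false → G.Adj (φ y) (φ (p y))
  surj : ∀ v, ∃ y, φ y = v

section contr
variable {V X F : Type} {G : SimpleGraph V} {s0 s1 s2 : X → X} {fz : X → ℕ} {vt : X → V} {fc : X → F}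
  {c h : X → Bool}

abbrev YT (c : X → Bool) : Type := {x : X // c x = false}

/-- underlying map of `p` -/
def pf (s0 s1 : X → X) (c : X → Bool) (x : X) : X := if c (s1 x) = false then s1 x else s1 (s0 (s1 x))

theorem Deco0.hF (D : Deco0 s0 s1 s2 c h) {x : X} (hx : c x = false) : h x = false := by
  by_contra h1
  have := D.a1 x (by simpa using h1)
  rw [hx] at this; cases this

theorem Deco0.c_pf (D : Deco0 s0 s1 s2 c h) {x : X} (hx : c x = false) :
    c (pf s0 s1 c x) = false := by
  unfold pf
  split_ifs with h1
  · exact h1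
  · apply D.a2
    · rw [D.h0, D.h1]; exact D.hF hx
    · rw [D.c0]; simpa using h1

def pY (D : Deco0 s0 s1 s2 c h) (y : YT c) : YT c := ⟨pf s0 s1 c y.1, D.c_pf y.2⟩
def qY (D : Deco0 s0 s1 s2 c h) (y : YT c) : YT c := ⟨s2 y.1, by rw [D.c2]; exact y.2⟩
def rY (D : Deco0 s0 s1 s2 c h) (y : YT c) : YT c := ⟨s0 y.1, by rw [D.c0]; exact y.2⟩
def dY (s1 : X → X) (c : X → Bool) (y : YT c) : Bool := !(c (s1 y.1))
def htB (s1 s2 : X → X) (c : X → Bool) (x : X) : Bool := c (s1 x) && c (s1 (s2 x))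
def sY (s1 s2 : X → X) (fz : X → ℕ) (c : X → Bool) (y : YT c) : ℕ :=
  if htB s1 s2 c y.1 = true then fz (s2 (s1 y.1)) else 4

theorem pf_of_true {x : X} (h1 : c (s1 x) = true) : pf s0 s1 c x = s1 (s0 (s1 x)) := by
  unfold pf; rw [if_neg (by simp [h1])]
theorem pf_of_false {x : X} (h1 : c (s1 x) = false) : pf s0 s1 c x = s1 x := by
  unfold pf; rw [if_pos h1]

theorem pY_pY (S : FSys G s0 s1 s2 fz vt fc) (D : Deco0 s0 s1 s2 c h) (y : YT c) :
    pY D (pY D y) = y := by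
  apply Subtype.ext
  change pf s0 s1 c (pf s0 s1 c y.1) = y.1
  rcases h1 : c (s1 y.1)
  · rw [pf_of_false h1, pf_of_false (by rw [S.i1]; exact y.2), S.i1]
  · rw [pf_of_true h1, pf_of_true (by rw [S.i1, D.c0]; exact h1), S.i1, S.i0, S.i1]

/-- T-step in a non-H face -/
theorem pr_step (S : FSys G s0 s1 s2 fz vt fc) (x : X) :
    pf s0 s1 c (s0 x) = if c (s1 (s0 x)) = false then s1 (s0 x) else s1 (s0 (s1 (s0 x))) := rfl

theorem altS_even (s0 s1 : X → X) (x : X) (i : ℕ) :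
    altS s0 s1 x (2 * i + 2) = s1 (s0 (altS s0 s1 x (2 * i))) := by
  have h1 : (2 * i + 1) % 2 = 1 := by omega
  have h2 : (2 * i) % 2 = 0 := by omega
  simp [altS, h1, h2]

theorem altS_oddE (s0 s1 : X → X) (x : X) (i : ℕ) :
    altS s0 s1 x (2 * i + 1) = s0 (altS s0 s1 x (2 * i)) := by
  have h2 : (2 * i) % 2 = 0 := by omega
  simp [altS]

theorem pr3 (S : FSys G s0 s1 s2 fz vt fc) (D : Deco s0 s1 s2 fz fc c h) (x : X) (hx : c x = false) :
    pf s0 s1 c (s0 (pf s0 s1 c (s0 (pf s0 s1 c (s0 x))))) = x := by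
  have hF : h x = false := D.hF hx
  have hcl := S.close x
  have T : ∀ z, h z = false → c z = true → c (s1 (s0 z)) = false := by
    intro z h1 h2
    exact D.a2 _ (by rw [D.h0, h1]) (by rw [D.c0, h2])
  have e1 := altS_even s0 s1 x 0
  have e2 := altS_even s0 s1 x 1
  have e3 := altS_even s0 s1 x 2
  have e4 := altS_even s0 s1 x 3
  have e5 := altS_even s0 s1 x 4
  have e6 := altS_even s0 s1 x 5
  simp only [Nat.reduceMul, Nat.reduceAdd] at e1 e2 e3 e4 e5 e6
  have e0 : altS s0 s1 x 0 = x := rfl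
  rw [e0] at e1
  have hh : ∀ n, h (altS s0 s1 x n) = false := by
    intro n
    induction n with
    | zero => exact hF
    | succ n ih => simp only [altS]; split_ifs <;> simp [D.h0, D.h1, ih]
  have hfz : ∀ n, fz (altS s0 s1 x n) = fz x := by
    intro n
    induction n with
    | zero => rfl
    | succ n ih => simp only [altS]; split_ifs <;> simp [S.z0, S.z1, ih]
  have hfc : ∀ n, fc (altS s0 s1 x n) = fc x := by
    intro n
    induction n with
    | zero => rfl
    | succ n ih => simp only [altS]; split_ifs <;> simp [S.f0, S.f1, ih]
  rcases D.f56 x with h5 | h6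
  · rw [h5] at hcl
    simp only [Nat.reduceMul] at hcl
    -- two consecutive-false corners coincide
    have uniq : ∀ i j, i < j → j < 5 → c (altS s0 s1 x (2 * i)) = false →
        c (altS s0 s1 x (2 * i + 2)) = false → c (altS s0 s1 x (2 * j)) = false →
        c (altS s0 s1 x (2 * j + 2)) = false → False := by
      intro i j hij hj a1 a2 b1 b2
      rw [altS_even] at a2 b2
      have := D.pent (s0 (altS s0 s1 x (2 * i))) (s0 (altS s0 s1 x (2 * j)))
        (by rw [S.z0, hfz, h5]) (by rw [D.c0, a1]) a2 (by rw [S.f0, S.f0, hfc, hfc])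
        (by rw [D.c0, b1]) b2
      rw [← altS_even s0 s1 x i, ← altS_oddE s0 s1 x i, ← altS_oddE s0 s1 x j] at this
      have i1 := S.inj x (2 * i + 1) (2 * j + 1) (by omega) (by omega)
      rcases this with h | h
      · exact i1 h.symm
      · exact S.inj x (2 * i + 2) (2 * j + 1) (by omega) (by omega) h.symm
    have u01 := uniq 0 1 (by omega) (by omega)
    have u02 := uniq 0 2 (by omega) (by omega)
    have u03 := uniq 0 3 (by omega) (by omega)
    have u04 := uniq 0 4 (by omega) (by omega)
    have u12 := uniq 1 2 (by omega) (by omega)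
    have u13 := uniq 1 3 (by omega) (by omega)
    have u14 := uniq 1 4 (by omega) (by omega)
    have u23 := uniq 2 3 (by omega) (by omega)
    have u24 := uniq 2 4 (by omega) (by omega)
    have u34 := uniq 3 4 (by omega) (by omega)
    have t1 := T _ (hh 2)
    have t2 := T _ (hh 4)
    have t3 := T _ (hh 6)
    have t4 := T _ (hh 8)
    simp only [Nat.reduceMul, Nat.reduceAdd] at u01 u02 u03 u04 u12 u13 u14 u23 u24 u34
    rw [hcl] at e5 u04 u14 u24 u34
    rw [e0] at u01 u02 u03 u04
    rw [← e3] at t2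
    rw [← e2] at t1
    rw [← e4] at t3
    rw [← e5] at t4
    rcases b1 : c (altS s0 s1 x 2) <;> rcases b2 : c (altS s0 s1 x 4) <;>
    rcases b3 : c (altS s0 s1 x 6) <;> rcases b4 : c (altS s0 s1 x 8) <;>
      simp only [b1, b2, b3, b4, hx, reduceCtorEq, imp_false, not_true_eq_false, not_false_eq_true,
        forall_const] at t1 t2 t3 t4 u01 u02 u03 u04 u12 u13 u14 u23 u24 u34 <;>
      simp only [pr_step S, ← e1, ← e2, ← e3, ← e4, ← e5, b1, b2, b3, b4, hx, if_true,
        reduceCtorEq, if_false]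
  · rw [h6] at hcl
    simp only [Nat.reduceMul] at hcl
    have N : ∀ z, fz z = 6 → c z = false → c (s1 (s0 z)) = true := by
      intro z h1 h2
      exact D.hex _ (by rw [S.z0, h1]) (by rw [D.c0, h2])
    have b1 : c (altS s0 s1 x 2) = true := by rw [e1]; exact N _ h6 hx
    have b2 : c (altS s0 s1 x 4) = false := by rw [e2]; exact T _ (hh _) b1
    have b3 : c (altS s0 s1 x 6) = true := by rw [e3]; exact N _ (by rw [hfz, h6]) b2
    have b4 : c (altS s0 s1 x 8) = false := by rw [e4]; exact T _ (hh _) b3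
    have b5 : c (altS s0 s1 x 10) = true := by rw [e5]; exact N _ (by rw [hfz, h6]) b4
    rw [hcl] at e6
    simp only [pr_step S, ← e1, ← e2, ← e3, ← e4, ← e5, ← e6, b1, b2, b3, b4, b5, hx, if_true,
        reduceCtorEq, if_false]
end contr
end FG

namespace FG
section contr2
variable {V X F : Type} {G : SimpleGraph V} {s0 s1 s2 : X → X} {fz : X → ℕ} {vt : X → V} {fc : X → F}
  {c h : X → Bool}

theorem htB_iff {x : X} : htB s1 s2 c x = true ↔ c (s1 x) = true ∧ c (s1 (s2 x)) = true := by
  simp [htB]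

theorem ht_q (S : FSys G s0 s1 s2 fz vt fc) {x : X} (hx : htB s1 s2 c x = true) :
    htB s1 s2 c (s2 x) = true := by
  rw [htB_iff] at *
  rw [S.i2]; exact ⟨hx.2, hx.1⟩

theorem ht_p (S : FSys G s0 s1 s2 fz vt fc) (D : Deco0 s0 s1 s2 c h) {x : X} (h0 : c x = false)
    (hx : htB s1 s2 c x = true) : htB s1 s2 c (pf s0 s1 c x) = true := by
  rw [htB_iff] at *
  have h5 := D.a5 x h0 hx.1 hx.2
  rw [pf_of_true hx.1]
  refine ⟨by rw [S.i1, D.c0]; exact hx.1, ?_⟩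
  rw [← D.c2, S.braid, S.i1]
  apply D.a1
  rw [D.h1, ← S.comm, D.h0]; exact h5

theorem ht_pY (S : FSys G s0 s1 s2 fz vt fc) (D : Deco0 s0 s1 s2 c h) (y : YT c) :
    htB s1 s2 c (pY D y).1 = htB s1 s2 c y.1 := by
  rw [Bool.eq_iff_iff]
  constructor
  · intro h1
    have := ht_p S D (pY D y).2 h1
    rw [← pY_pY S D y]; exact this
  · exact ht_p S D y.2

theorem ht_qY (S : FSys G s0 s1 s2 fz vt fc) (D : Deco0 s0 s1 s2 c h) (y : YT c) :
    htB s1 s2 c (qY D y).1 = htB s1 s2 c y.1 := by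
  rw [Bool.eq_iff_iff]
  constructor
  · intro h1
    have := ht_q S h1
    change htB s1 s2 c (s2 (s2 y.1)) = true at this
    rw [S.i2] at this; exact this
  · exact ht_q S

theorem kp (S : FSys G s0 s1 s2 fz vt fc) {x : X} (h1 : c (s1 x) = true) :
    s2 (s1 (pf s0 s1 c x)) = s0 (s2 (s1 x)) := by
  rw [pf_of_true h1, S.i1, S.comm]

theorem alt_k (S : FSys G s0 s1 s2 fz vt fc) (D : Deco0 s0 s1 s2 c h) (y : YT c)
    (hy : htB s1 s2 c y.1 = true) (n : ℕ) :
    htB s1 s2 c (altS (pY D) (qY D) y n).1 = true ∧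
    s2 (s1 (altS (pY D) (qY D) y n).1) = altS s0 s1 (s2 (s1 y.1)) n := by
  induction n with
  | zero => exact ⟨hy, rfl⟩
  | succ n ih =>
    simp only [altS]
    split_ifs with h1
    · exact ⟨by rw [ht_pY S D]; exact ih.1, by
        rw [← ih.2]; exact kp S (htB_iff.1 ih.1).1⟩
    · exact ⟨by rw [ht_qY S D]; exact ih.1, by
        rw [← ih.2]; exact S.braid _⟩

theorem sY_p (S : FSys G s0 s1 s2 fz vt fc) (D : Deco0 s0 s1 s2 c h) (y : YT c) :
    sY s1 s2 fz c (pY D y) = sY s1 s2 fz c y := by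
  unfold sY
  rw [ht_pY S D]
  split_ifs with h1
  · have : s2 (s1 (pY D y).1) = s0 (s2 (s1 y.1)) := kp S (htB_iff.1 h1).1
    rw [this, S.z0]
  · rfl

theorem sY_q (S : FSys G s0 s1 s2 fz vt fc) (D : Deco0 s0 s1 s2 c h) (y : YT c) :
    sY s1 s2 fz c (qY D y) = sY s1 s2 fz c y := by
  unfold sY
  rw [ht_qY S D]
  split_ifs with h1
  · have : s2 (s1 (qY D y).1) = s1 (s2 (s1 y.1)) := S.braid _
    rw [this, S.z1]
  · rfl

theorem altS_add2 {Y : Type} (p q : Y → Y) (y : Y) (i : ℕ) :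
    altS p q y (i + 2) = altS p q (q (p y)) i := by
  induction i with
  | zero => simp [altS]
  | succ i ih =>
    have e : (i + 2) % 2 = i % 2 := by omega
    change (if (i + 2) % 2 = 0 then p (altS p q y (i + 2)) else q (altS p q y (i + 2))) = _
    rw [e, ih]; rfl

theorem altS_per {Y : Type} (p q : Y → Y) (y : Y) (h : altS p q y 8 = y) (i : ℕ) :
    altS p q y (i + 8) = altS p q y i := by
  have e : ∀ j, altS p q y (j + 8) = altS p q (altS p q y 8) j := by
    intro j
    rw [show j + 8 = (((j + 2) + 2) + 2) + 2 from rfl, altS_add2, altS_add2, altS_add2, altS_add2]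
    congr 1
  rw [e, h]

theorem shift8 {Y : Type} (p q : Y → Y) (y z : Y) (hz : q (p y) = z) (h : altS p q y 8 = y)
    (hi : ∀ i j, i < j → j < 8 → altS p q y i ≠ altS p q y j) :
    altS p q z 8 = z ∧ ∀ i j, i < j → j < 8 → altS p q z i ≠ altS p q z j := by
  have e : ∀ i, altS p q z i = altS p q y (i + 2) := fun i => by rw [altS_add2, hz]
  constructor
  · rw [e, show 8 + 2 = 2 + 8 from rfl, altS_per p q y h, ← hz]; simp [altS]
  · intro i j hij hj
    rw [e, e]
    by_cases h1 : j < 6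
    · exact hi _ _ (by omega) (by omega)
    · rw [show j + 2 = (j - 6) + 8 by omega, altS_per p q y h]
      by_cases h2 : i < 6
      · exact (hi _ _ (by omega) (by omega)).symm
      · rw [show i + 2 = (i - 6) + 8 by omega, altS_per p q y h]
        exact hi _ _ (by omega) (by omega)

theorem dY_p (S : FSys G s0 s1 s2 fz vt fc) (D : Deco0 s0 s1 s2 c h) (y : YT c) :
    c (s1 (pY D y).1) = c (s1 y.1) := by
  change c (s1 (pf s0 s1 c y.1)) = _
  rcases h1 : c (s1 y.1)
  · rw [pf_of_false h1, S.i1]; exact y.2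
  · rw [pf_of_true h1, S.i1, D.c0]; exact h1

theorem dY_q (S : FSys G s0 s1 s2 fz vt fc) (D : Deco s0 s1 s2 fz fc c h) (y : YT c)
    (hy : htB s1 s2 c y.1 = false) : c (s1 (s2 y.1)) = !(c (s1 y.1)) := by
  rcases h1 : c (s1 y.1)
  · exact D.a4 _ y.2 h1
  · simpa [htB, h1] using hy

theorem quad0 (S : FSys G s0 s1 s2 fz vt fc) (D : Deco s0 s1 s2 fz fc c h) (y : YT c)
    (hy : htB s1 s2 c y.1 = false) (h1 : c (s1 y.1) = true) :
    altS (pY D.toDeco0) (qY D.toDeco0) y 8 = y ∧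
    ∀ i j, i < j → j < 8 → altS (pY D.toDeco0) (qY D.toDeco0) y i ≠
      altS (pY D.toDeco0) (qY D.toDeco0) y j := by
  obtain ⟨x, hx⟩ : ∃ x, x = s1 y.1 := ⟨_, rfl⟩
  have yx : y.1 = s1 x := by rw [hx, S.i1]
  have cx : c x = true := by rw [hx]; exact h1
  have cx1 : c (s1 x) = false := by rw [← yx]; exact y.2
  have e0 : y.1 = s1 x := yx
  have d : c (s1 (s2 (s1 x))) = false := by
    have := dY_q S D y hy
    rw [← yx, this, h1]; rfl
  have hp : ∀ z : YT c, (pY D.toDeco0 z).1 = pf s0 s1 c z.1 := fun _ => rfl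
  have hq : ∀ z : YT c, (qY D.toDeco0 z).1 = s2 z.1 := fun _ => rfl
  have a0 : (altS (pY D.toDeco0) (qY D.toDeco0) y 0).1 = s1 x := yx
  have s1' : altS (pY D.toDeco0) (qY D.toDeco0) y 1 = pY D.toDeco0 y := by simp [altS]
  have s2' : altS (pY D.toDeco0) (qY D.toDeco0) y 2 = qY D.toDeco0 (altS (pY D.toDeco0) (qY D.toDeco0) y 1) := by simp [altS]
  have s3' : altS (pY D.toDeco0) (qY D.toDeco0) y 3 = pY D.toDeco0 (altS (pY D.toDeco0) (qY D.toDeco0) y 2) := by simp [altS]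
  have s4' : altS (pY D.toDeco0) (qY D.toDeco0) y 4 = qY D.toDeco0 (altS (pY D.toDeco0) (qY D.toDeco0) y 3) := by simp [altS]
  have s5' : altS (pY D.toDeco0) (qY D.toDeco0) y 5 = pY D.toDeco0 (altS (pY D.toDeco0) (qY D.toDeco0) y 4) := by simp [altS]
  have s6' : altS (pY D.toDeco0) (qY D.toDeco0) y 6 = qY D.toDeco0 (altS (pY D.toDeco0) (qY D.toDeco0) y 5) := by simp [altS]
  have s7' : altS (pY D.toDeco0) (qY D.toDeco0) y 7 = pY D.toDeco0 (altS (pY D.toDeco0) (qY D.toDeco0) y 6) := by simp [altS]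
  have s8' : altS (pY D.toDeco0) (qY D.toDeco0) y 8 = qY D.toDeco0 (altS (pY D.toDeco0) (qY D.toDeco0) y 7) := by simp [altS]
  have t1 : htB s1 s2 c (pY D.toDeco0 y).1 = false := by rw [ht_pY S, hy]
  have a1 : (altS (pY D.toDeco0) (qY D.toDeco0) y 1).1 = s1 (s0 x) := by
    rw [s1', hp, yx, pf_of_true (by rw [S.i1]; exact cx), S.i1]
  have a2 : (altS (pY D.toDeco0) (qY D.toDeco0) y 2).1 = s2 (s1 (s0 x)) := by rw [s2', hq, a1]
  have d2 : c (s1 (s2 (s1 (s0 x)))) = false := by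
    have := dY_q S D _ t1
    rw [← s1', a1] at this
    rw [this, S.i1, D.c0, cx]; rfl
  have a3 : (altS (pY D.toDeco0) (qY D.toDeco0) y 3).1 = s1 (s2 (s1 (s0 x))) := by
    rw [s3', hp, a2, pf_of_false d2]
  have a4 : (altS (pY D.toDeco0) (qY D.toDeco0) y 4).1 = s1 (s0 (s2 x)) := by
    rw [s4', hq, a3, ← S.braid, S.i2, S.comm]
  have a5 : (altS (pY D.toDeco0) (qY D.toDeco0) y 5).1 = s1 (s2 x) := by
    rw [s5', hp, a4, pf_of_true (by rw [S.i1, D.c0, D.c2]; exact cx), S.i1, S.i0]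
  have a6 : (altS (pY D.toDeco0) (qY D.toDeco0) y 6).1 = s2 (s1 (s2 x)) := by rw [s6', hq, a5]
  have a7 : (altS (pY D.toDeco0) (qY D.toDeco0) y 7).1 = s2 (s1 x) := by
    rw [s7', hp, a6, S.braid, pf_of_false, S.i1]
    rw [S.i1, D.c2]; exact cx1
  have a8 : (altS (pY D.toDeco0) (qY D.toDeco0) y 8).1 = s1 x := by
    rw [s8', hq, a7, S.i2]
  have a3' : (altS (pY D.toDeco0) (qY D.toDeco0) y 3).1 = s2 (s1 (s0 (s2 x))) := by
    rw [a3, ← S.braid, S.comm]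
  refine ⟨Subtype.ext (by rw [a8, yx]), ?_⟩
  -- distinctness
  have i1 : ∀ {a b}, s1 a = s1 b → a = b := fun {a b} e => by rw [← S.i1 a, e, S.i1]
  have i2 : ∀ {a b}, s2 a = s2 b → a = b := fun {a b} e => by rw [← S.i2 a, e, S.i2]
  have i0 : ∀ {a b}, s0 a = s0 b → a = b := fun {a b} e => by rw [← S.i0 a, e, S.i0]
  have v0 : ∀ a, vt a ≠ vt (s0 a) := fun a => (S.adj a).ne
  have n01 : s1 x ≠ s1 (s0 x) := fun e => v0 x (by rw [← i1 e])
  have n04 : s1 x ≠ s1 (s0 (s2 x)) := fun e => v0 x (by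
    have := i1 e; rw [S.comm] at this; rw [← S.v2 (s0 x), ← this])
  have n05 : s1 x ≠ s1 (s2 x) := fun e => S.n2 x (i1 e).symm
  have n14 : s1 (s0 x) ≠ s1 (s0 (s2 x)) := fun e => S.n2 x (i0 (i1 e)).symm
  have n15 : s1 (s0 x) ≠ s1 (s2 x) := fun e => v0 x (by rw [i1 e, S.v2])
  have n45 : s1 (s0 (s2 x)) ≠ s1 (s2 x) := fun e => v0 (s2 x) (by rw [i1 e])
  have cF : ∀ a, c (s1 (s1 a)) = c a := fun a => by rw [S.i1]
  have g0 : c (s1 (s1 x)) = true := by rw [cF, cx]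
  have g1 : c (s1 (s1 (s0 x))) = true := by rw [cF, D.c0, cx]
  have g4 : c (s1 (s1 (s0 (s2 x)))) = true := by rw [cF, D.c0, D.c2, cx]
  have g5 : c (s1 (s1 (s2 x))) = true := by rw [cF, D.c2, cx]
  have g7 : c (s1 (s2 (s1 x))) = false := d
  have g2 : c (s1 (s2 (s1 (s0 x)))) = false := d2
  have g3 : c (s1 (s2 (s1 (s0 (s2 x))))) = false := by
    rw [S.comm x, ← S.braid, S.i2, D.c2, ← a1]
    exact (altS (pY D.toDeco0) (qY D.toDeco0) y 1).2
  have g6 : c (s1 (s2 (s1 (s2 x)))) = false := by rw [S.braid, S.i1, D.c2]; exact cx1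
  have ne : ∀ {a b : X}, c (s1 a) = true → c (s1 b) = false → a ≠ b := by
    intro a b ha hb e; rw [e, hb] at ha; cases ha
  intro i j hij hj e
  have e' := congrArg Subtype.val e
  clear e
  interval_cases j <;> interval_cases i <;> simp only [a0, a1, a2, a3', a4, a5, a6, a7] at e' <;>
  first
    | exact n01 e' | exact n04 e' | exact n05 e' | exact n14 e' | exact n15 e' | exact n45 e'
    | exact n45 e'.symm 
    | exact n01 (i2 e').symm | exact n04 (i2 e').symm | exact n05 (i2 e').symm
    | exact n14 (i2 e') | exact n15 (i2 e') | exact n45 (i2 e')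
    | exact ne (by assumption) (by assumption) e'
    | exact ne (by assumption) (by assumption) e'.symm

theorem quad1 (S : FSys G s0 s1 s2 fz vt fc) (D : Deco s0 s1 s2 fz fc c h) (y : YT c)
    (hy : htB s1 s2 c y.1 = false) :
    altS (pY D.toDeco0) (qY D.toDeco0) y 8 = y ∧
    ∀ i j, i < j → j < 8 → altS (pY D.toDeco0) (qY D.toDeco0) y i ≠
      altS (pY D.toDeco0) (qY D.toDeco0) y j := by
  rcases h1 : c (s1 y.1)
  · have hq : qY D.toDeco0 (qY D.toDeco0 y) = y := Subtype.ext (S.i2 _)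
    have hy' : htB s1 s2 c (pY D.toDeco0 (qY D.toDeco0 y)).1 = false := by
      rw [ht_pY S, ht_qY S, hy]
    have := quad0 S D (pY D.toDeco0 (qY D.toDeco0 y)) hy' (by
      rw [dY_p S D.toDeco0]
      exact D.a4 _ y.2 h1)
    exact shift8 _ _ _ _ (by rw [pY_pY S, hq]) this.1 this.2
  · exact quad0 S D y hy h1

theorem mkSys (S : FSys G s0 s1 s2 fz vt fc) (D : Deco s0 s1 s2 fz fc c h) :
    Sys (YT c) (pY D.toDeco0) (qY D.toDeco0) (rY D.toDeco0) (sY s1 s2 fz c) where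
  pp := pY_pY S _
  qq := fun y => Subtype.ext (S.i2 _)
  rr := fun y => Subtype.ext (S.i0 _)
  rne := fun y e => by
    have e' : s0 y.1 = y.1 := congrArg Subtype.val e
    have := S.adj y.1
    rw [e'] at this
    exact this.ne rfl
  rneq := fun y e => by
    have e' : s0 y.1 = s2 y.1 := congrArg Subtype.val e
    have := S.adj y.1
    rw [e', S.v2] at this
    exact this.ne rfl
  rq := fun y => Subtype.ext (S.comm _)
  hprp := fun y => by
    have : pY D.toDeco0 (rY D.toDeco0 (pY D.toDeco0 (rY D.toDeco0 (pY D.toDeco0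
        (rY D.toDeco0 y))))) = y := Subtype.ext (pr3 S D y.1 y.2)
    conv_rhs => rw [← this]
    rw [pY_pY S]
  szp := sY_p S _
  szq := sY_q S _
  close := fun y => by
    rcases hy : htB s1 s2 c y.1
    · have : sY s1 s2 fz c y = 4 := by simp [sY, hy]
      rw [this]; exact (quad1 S D y hy).1
    · have : sY s1 s2 fz c y = fz (s2 (s1 y.1)) := by simp [sY, hy]
      rw [this]
      apply Subtype.ext
      have := (alt_k S D.toDeco0 y hy (2 * fz (s2 (s1 y.1)))).2
      rw [S.close] at this
      have := congrArg (fun z => s1 (s2 z)) this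
      simpa only [S.i2, S.i1] using this
  inj := fun y i j hij hj e => by
    rcases hy : htB s1 s2 c y.1
    · have : sY s1 s2 fz c y = 4 := by simp [sY, hy]
      rw [this] at hj; exact (quad1 S D y hy).2 i j hij hj e
    · have : sY s1 s2 fz c y = fz (s2 (s1 y.1)) := by simp [sY, hy]
      rw [this] at hj
      have a := (alt_k S D.toDeco0 y hy i).2
      rw [e, (alt_k S D.toDeco0 y hy j).2] at a
      exact S.inj _ i j hij hj a.symm
  trans := fun T hT hc => by
    classical
    -- representative in Y of a flag
    obtain ⟨S', hS'⟩ : ∃ S' : Set X, S' = {x | (c x = false ∧ ∀ hx : c x = false, (⟨x, hx⟩ : YT c) ∈ T) ∨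
      (c x = true ∧ h x = true ∧ ∀ hx : c (s1 (s2 x)) = false, (⟨_, hx⟩ : YT c) ∈ T) ∨
      (c x = true ∧ h x = false ∧ ∀ hx : c (s1 x) = false, (⟨_, hx⟩ : YT c) ∈ T)} := ⟨_, rfl⟩
    have P : ∀ (y : YT c) (x : X), y ∈ T → pf s0 s1 c y.1 = x → ∀ hx : c x = false, (⟨x, hx⟩ : YT c) ∈ T := by
      intro y x hy e hx
      have := (hc y hy).1
      have e' : pY D.toDeco0 y = ⟨x, hx⟩ := Subtype.ext e
      rw [← e']; exact this
    have Q : ∀ (y : YT c) (x : X), y ∈ T → s2 y.1 = x → ∀ hx : c x = false, (⟨x, hx⟩ : YT c) ∈ T := by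
      intro y x hy e hx
      have := (hc y hy).2.1
      have e' : qY D.toDeco0 y = ⟨x, hx⟩ := Subtype.ext e
      rw [← e']; exact this
    have R : ∀ (y : YT c) (x : X), y ∈ T → s0 y.1 = x → ∀ hx : c x = false, (⟨x, hx⟩ : YT c) ∈ T := by
      intro y x hy e hx
      have := (hc y hy).2.2
      have e' : rY D.toDeco0 y = ⟨x, hx⟩ := Subtype.ext e
      rw [← e']; exact this
    have key : S' = Set.univ := by
      apply S.trans
      · obtain ⟨y, hy⟩ := hT
        refine ⟨y.1, ?_⟩
        rw [hS']; exact Or.inl ⟨y.2, fun _ => hy⟩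
      · intro x hx
        rw [hS'] at hx ⊢
        rcases hx with ⟨h1, h2⟩ | ⟨h1, h2, h3⟩ | ⟨h1, h2, h3⟩
        · have hm := h2 h1
          have hF := D.hF h1
          refine ⟨Or.inl ⟨by rw [D.c0, h1], R _ _ hm rfl⟩, ?_, Or.inl ⟨by rw [D.c2, h1], Q _ _ hm rfl⟩⟩
          rcases h4 : c (s1 x)
          · exact Or.inl ⟨h4, P _ _ hm (pf_of_false h4)⟩
          · refine Or.inr (Or.inr ⟨h4, by rw [D.h1, hF], ?_⟩)
            intro hx; simp only [S.i1]; exact hm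
        · have h4 := D.a3' x h2
          have hm := h3 h4
          have ht : htB s1 s2 c (s1 (s2 x)) = true := by
            rw [htB_iff, S.i1, D.c2]
            refine ⟨h1, ?_⟩
            rw [← D.c2, S.braid, S.i1, S.i2]
            exact D.a1 _ (by rw [D.h1, h2])
          refine ⟨Or.inr (Or.inl ⟨by rw [D.c0, h1], by rw [D.h0, h2], ?_⟩),
            Or.inr (Or.inl ⟨D.a1 _ (by rw [D.h1, h2]), by rw [D.h1, h2], ?_⟩),
            Or.inr (Or.inr ⟨by rw [D.c2, h1], D.a3 _ h2, ?_⟩)⟩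
          · apply P _ _ hm
            have := kp S (x := s1 (s2 x)) (htB_iff.1 ht).1
            rw [S.i1, S.i2] at this
            rw [← this, S.i2, S.i1]
          · apply Q _ _ hm
            rw [S.braid]
          · intro _; exact hm
        · have h4 := D.a2 x h2 h1
          have hm := h3 h4
          refine ⟨Or.inr (Or.inr ⟨by rw [D.c0, h1], by rw [D.h0, h2], ?_⟩), Or.inl ⟨h4, fun _ => hm⟩, ?_⟩
          · apply P _ _ hm
            rw [pf_of_true (by rw [S.i1, h1]), S.i1]
          · rcases h5 : h (s2 x)
            · refine Or.inr (Or.inr ⟨by rw [D.c2, h1], h5, ?_⟩)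
              have hq4 : c (s2 (s1 x)) = false := by rw [D.c2, h4]
              have hqm := Q _ _ hm rfl hq4
              -- A-type
              have hA : htB s1 s2 c (s1 x) = false := by
                by_contra hh
                have h6 := D.a5 (s1 x) h4 (by rw [S.i1, h1]) (htB_iff.1 (by simpa using hh)).2
                rw [S.i1, h5] at h6
                cases h6
              have h7 : c (s1 (s2 (s1 x))) = false := by
                have := dY_q S D ⟨s1 x, h4⟩ hA
                simp only [S.i1, h1] at this
                exact this
              have hpm := P _ _ hqm (pf_of_false h7) h7
              exact Q _ _ hpm (show s2 (s1 (s2 (s1 x))) = s1 (s2 x) by rw [← S.braid, S.i2])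
            · refine Or.inr (Or.inl ⟨by rw [D.c2, h1], h5, ?_⟩)
              simp only [S.i2]; intro _; exact hm
    ext y
    simp only [Set.mem_univ, iff_true]
    have hy : y.1 ∈ S' := by rw [key]; trivial
    rw [hS'] at hy
    have hy2 := y.2
    rcases hy with ⟨_, h2⟩ | ⟨h1, _⟩ | ⟨h1, _⟩
    · exact h2 y.2
    · rw [hy2] at h1; cases h1
    · rw [hy2] at h1; cases h1

theorem mkDec (S : FSys G s0 s1 s2 fz vt fc) (D : Deco s0 s1 s2 fz fc c h) :
    Dec G (pY D.toDeco0) (qY D.toDeco0) (rY D.toDeco0) (sY s1 s2 fz c) (dY s1 c)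
      (fun y => vt y.1) where
  dp := fun y => by unfold dY; rw [dY_p S D.toDeco0 y]
  dq := fun y hy => by
    have : htB s1 s2 c y.1 = false := by
      by_contra hh
      have hh : htB s1 s2 c y.1 = true := by simpa using hh
      simp only [sY, hh, if_true] at hy
      have := D.f56 (s2 (s1 y.1))
      omega
    have := dY_q S D y this
    unfold dY
    change (!c (s1 (s2 y.1))) = _
    rw [this]
  dh := fun y hy => by
    have : htB s1 s2 c y.1 = true := by
      by_contra hh
      exact hy (by simp [sY, hh])
    simp [dY, (htB_iff.1 this).1]
  dr := fun y hy => by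
    have h1 : c (s1 y.1) = false := by simpa [dY] using hy
    by_contra hh
    have h2 : c (s1 (s0 y.1)) = false := by simpa [dY, rY] using hh
    have v0 := (S.adj y.1).ne
    rcases D.f56 y.1 with h5 | h6
    · rcases D.pent y.1 (s0 y.1) h5 y.2 h1 (S.f0 _) (by rw [D.c0]; exact y.2) h2 with e | e
      · rw [e] at v0; exact v0 rfl
      · rw [e, S.v1] at v0; exact v0 rfl
    · have := D.hex y.1 h6 y.2
      rw [h1] at this; cases this
  fq := fun y => S.v2 _
  fp := fun y hy => by
    have h1 : c (s1 y.1) = false := by simpa [dY] using hy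
    change vt (pf s0 s1 c y.1) = _
    rw [pf_of_false h1, S.v1]
  ar := fun y => S.adj _
  ap := fun y hy => by
    have h1 : c (s1 y.1) = true := by simpa [dY] using hy
    change G.Adj _ (vt (pf s0 s1 c y.1))
    rw [pf_of_true h1, S.v1]
    have := S.adj (s1 y.1)
    rwa [S.v1] at this
  surj := fun v => by
    obtain ⟨x, rfl⟩ := S.vsurj v
    rcases h1 : h x
    · rcases h2 : c x
      · exact ⟨⟨x, h2⟩, rfl⟩
      · exact ⟨⟨s1 x, D.a2 x h1 h2⟩, S.v1 x⟩
    · exact ⟨⟨s1 (s2 x), D.a3' x h1⟩, by rw [S.v1, S.v2]⟩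
end contr2
end FG

namespace FG
/-! ### Sextet decorations and counting -/
structure Sext {X : Type} (s0 s1 s2 : X → X) (fz : X → ℕ) (m h : X → Bool) : Prop where
  m0 : ∀ x, m (s0 x) = m x
  m2 : ∀ x, m (s2 x) = m x
  h0 : ∀ x, h (s0 x) = h x
  h1 : ∀ x, h (s1 x) = h x
  u1 : ∀ x, m x = true → m (s1 x) = false
  u2 : ∀ x, m x = true → m (s1 (s2 x)) = false
  u3 : ∀ x, m x = true ∨ m (s1 x) = true ∨ m (s1 (s2 x)) = true
  h3 : ∀ x, h x = true → h (s2 x) = false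
  hm : ∀ x, h x = true → m x = true ∨ m (s1 x) = true
  h6 : ∀ x, h x = true → fz x = 6

def cS {X : Type} (s2 : X → X) (m h : X → Bool) (x : X) : Bool := h x || h (s2 x) || m x

section cnt
variable {V X F : Type} {G : SimpleGraph V} {s0 s1 s2 : X → X} {fz : X → ℕ} {vt : X → V} {fc : X → F}
  {c h m : X → Bool}

theorem Sext.deco0 (S : FSys G s0 s1 s2 fz vt fc) (T : Sext s0 s1 s2 fz m h) :
    Deco0 s0 s1 s2 (cS s2 m h) h ∧
      ∀ x, cS s2 m h x = false → cS s2 m h (s1 x) = false → cS s2 m h (s1 (s2 x)) = true := by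
  have key : ∀ x, h (s2 (s1 (s2 x))) = h (s2 (s1 x)) := by intro x; rw [S.braid, T.h1]
  have mkey : ∀ x, m (s1 (s2 (s1 x))) = m (s1 (s2 x)) := by intro x; rw [← S.braid, T.m2]
  have u4 : ∀ x, m (s1 x) = true → m (s1 (s2 x)) = false := by
    intro x h; have := T.u2 (s1 x) h; rwa [mkey] at this
  have g1 : ∀ x, h x = true → h (s2 (s1 x)) = false := by
    intro x hx; exact T.h3 _ (by rw [T.h1, hx])
  have g2 : ∀ x, h (s2 x) = true → h (s2 (s1 x)) = false := by
    intro x hx; have := g1 _ hx; rwa [key] at this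
  refine ⟨⟨?_, ?_, T.h0, T.h1, ?_, ?_, T.h3, ?_, ?_⟩, ?_⟩
  · intro x; simp only [cS, T.h0, T.m0, ← S.comm]
  · intro x; simp only [cS, T.m2, S.i2]; rw [Bool.or_comm (h (s2 x))]
  · intro x hx; simp [cS, hx]
  · intro x hx hc
    simp only [cS, hx, Bool.false_or, Bool.or_eq_true] at hc
    simp only [cS, T.h1, hx, Bool.false_or]
    rcases hc with hc | hc
    · have := T.hm _ hc
      rw [T.m2] at this
      rw [g2 x hc]
      rcases this with h | h
      · rw [T.u1 _ h]; rfl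
      · rcases h' : m (s1 x)
        · rfl
        · rw [u4 x h'] at h; cases h
    · rw [T.u1 _ hc]
      rcases h' : h (s2 (s1 x))
      · rfl
      · have := T.hm _ h'
        rw [T.m2, mkey, T.u1 _ hc, T.u2 _ hc] at this
        simp at this
  · intro x hx
    simp only [cS, T.h1, T.h3 x hx, key, g1 x hx, Bool.false_or]
    rcases T.hm x hx with h | h
    · exact T.u2 _ h
    · exact u4 _ h
  · intro x hx h1 h2
    simp only [cS, Bool.or_eq_false_iff] at hx
    simp only [cS, T.h1, hx.1.1, hx.1.2, Bool.false_or, key, Bool.or_eq_true] at h1 h2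
    rcases h1 with h1 | h1
    · exact h1
    · rcases h2 with h2 | h2
      · exact h2
      · rw [u4 x h1] at h2; cases h2
  · intro x hx h1
    simp only [cS, Bool.or_eq_false_iff] at hx h1
    rcases T.u3 x with h | h | h
    · rw [hx.2] at h; cases h
    · rw [h1.2] at h; cases h
    · simp [cS, h]

variable [Fintype X]

theorem card_inv (g : X → X) (hg : ∀ x, g (g x) = x) (P Q : X → Prop) [DecidablePred P]
    [DecidablePred Q] (hPQ : ∀ x, P x ↔ Q (g x)) :
    (Finset.univ.filter P).card = (Finset.univ.filter Q).card := by
  apply Finset.card_bij (fun x _ => g x)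
  · intro x hx; simp only [Finset.mem_filter_univ] at hx ⊢; exact (hPQ x).1 hx
  · intro a _ b _ e; rw [← hg a, e, hg]
  · intro b hb; simp only [Finset.mem_filter_univ] at hb
    exact ⟨g b, by simp only [Finset.mem_filter_univ]; rw [hPQ, hg]; exact hb, hg b⟩

theorem card_split (P Q : X → Prop) [DecidablePred P] [DecidablePred Q] :
    (Finset.univ.filter P).card = (Finset.univ.filter fun x => P x ∧ Q x).card +
      (Finset.univ.filter fun x => P x ∧ ¬ Q x).card := by
  rw [← Finset.card_filter_add_card_filter_not (s := Finset.univ.filter P) Q, Finset.filter_filter,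
    Finset.filter_filter]

theorem counts (S : FSys G s0 s1 s2 fz vt fc) (D : Deco0 s0 s1 s2 c h)
    (a4 : ∀ x, c x = false → c (s1 x) = false → c (s1 (s2 x)) = true) :
    (Finset.univ.filter fun x => c x = false ∧ htB s1 s2 c x = true).card =
      (Finset.univ.filter fun x => h x = true).card ∧
    (Finset.univ.filter fun x => c x = false ∧ ¬ htB s1 s2 c x = true).card =
      2 * (Finset.univ.filter fun x => c x = false ∧ c (s1 x) = false).card ∧
    Fintype.card X = 3 * (Finset.univ.filter fun x => h x = true).card +
      3 * (Finset.univ.filter fun x => c x = false ∧ c (s1 x) = false).card := by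
  have i1 : (Finset.univ.filter fun x => c x = false ∧ htB s1 s2 c x = true).card =
      (Finset.univ.filter fun x => h x = true).card := by
    have e1 : (Finset.univ.filter fun x => c x = false ∧ htB s1 s2 c x = true).card =
        (Finset.univ.filter fun x => c (s1 x) = false ∧ htB s1 s2 c (s1 x) = true).card :=
      card_inv s1 S.i1 _ _ (fun x => by rw [S.i1])
    have e2 : (Finset.univ.filter fun x => c (s1 x) = false ∧ htB s1 s2 c (s1 x) = true).card =
        (Finset.univ.filter fun x => h x = true).card := by
      apply card_inv s2 S.i2
      intro x
      constructor
      · rintro ⟨h1, h2⟩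
        rw [htB_iff] at h2
        have := D.a5 _ h1 h2.1 h2.2
        rwa [S.i1] at this
      · intro h1
        have h2 := D.a3' _ h1
        rw [S.i2] at h2
        refine ⟨h2, ?_⟩
        rw [htB_iff, S.i1, ← D.c2]
        refine ⟨D.a1 _ h1, ?_⟩
        rw [← S.braid, D.c2]
        exact D.a1 _ (by rw [D.h1, h1])
    rw [e1, e2]
  have i2 : (Finset.univ.filter fun x => c x = false ∧ ¬ htB s1 s2 c x = true).card =
      2 * (Finset.univ.filter fun x => c x = false ∧ c (s1 x) = false).card := by
    rw [card_split _ (fun x => c (s1 x) = false), two_mul]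
    congr 1
    · congr 1
      ext x
      simp only [Finset.mem_filter_univ]
      constructor
      · rintro ⟨⟨h1, _⟩, h2⟩; exact ⟨h1, h2⟩
      · rintro ⟨h1, h2⟩; exact ⟨⟨h1, by simp [htB, h2]⟩, h2⟩
    · apply card_inv s2 S.i2
      intro x
      rw [D.c2]
      constructor
      · rintro ⟨⟨h1, h3⟩, h2⟩
        refine ⟨h1, ?_⟩
        simpa [htB, h2] using h3
      · rintro ⟨h1, h2⟩
        have h3 := a4 _ (by rw [D.c2]; exact h1) h2
        rw [S.i2] at h3
        exact ⟨⟨h1, by simp [htB, h2]⟩, by simp [h3]⟩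
  refine ⟨i1, i2, ?_⟩
  have j0 : Fintype.card X = (Finset.univ.filter fun x => c x = false).card +
      (Finset.univ.filter fun x => ¬ c x = false).card := by
    rw [Finset.card_filter_add_card_filter_not, Finset.card_univ]
  have j1 := card_split (fun x => c x = false) (fun x => htB s1 s2 c x = true)
  have j2 := card_split (fun x => ¬ c x = false) (fun x => h x = true)
  have j3 := card_split (fun x => ¬ c x = false ∧ ¬ h x = true) (fun x => h (s2 x) = true)
  have k1 : (Finset.univ.filter fun x => ¬ c x = false ∧ h x = true).card =
      (Finset.univ.filter fun x => h x = true).card := by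
    congr 1; ext x; simp only [Finset.mem_filter_univ]
    exact ⟨fun h => h.2, fun h => ⟨by simp [D.a1 x h], h⟩⟩
  have k2 : (Finset.univ.filter fun x => (¬ c x = false ∧ ¬ h x = true) ∧ h (s2 x) = true).card =
      (Finset.univ.filter fun x => h x = true).card := by
    apply card_inv s2 S.i2
    intro x
    constructor
    · rintro h; exact h.2
    · intro h1
      have h2 := D.a3 _ h1
      rw [S.i2] at h2
      have h3 := D.a1 _ h1
      rw [D.c2] at h3
      exact ⟨⟨by simp [h3], by simp [h2]⟩, h1⟩
  have k3 : (Finset.univ.filter fun x => (¬ c x = false ∧ ¬ h x = true) ∧ ¬ h (s2 x) = true).card =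
      (Finset.univ.filter fun x => c x = false ∧ c (s1 x) = false).card := by
    have e1 : (Finset.univ.filter fun x => (¬ c x = false ∧ ¬ h x = true) ∧ ¬ h (s2 x) = true).card =
        (Finset.univ.filter fun x => (¬ c (s1 x) = false ∧ ¬ h (s1 x) = true) ∧
          ¬ h (s2 (s1 x)) = true).card :=
      card_inv s1 S.i1 _ _ (fun x => by rw [S.i1])
    rw [e1]
    apply card_inv s2 S.i2
    intro x
    rw [D.c2, D.h1]
    constructor
    · rintro ⟨⟨h1, h2⟩, h3⟩
      have h2 : h x = false := by simpa using h2
      have h4 := D.a2 (s1 x) (by rw [D.h1, h2]) (by simpa using h1)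
      rw [S.i1] at h4
      refine ⟨h4, ?_⟩
      by_contra h5
      exact h3 (D.a5 x h4 (by simpa using h1) (by simpa using h5))
    · rintro ⟨h1, h2⟩
      have h3 := a4 _ (by rw [D.c2]; exact h1) h2
      rw [S.i2] at h3
      refine ⟨⟨by simp [h3], by simp [D.hF h1]⟩, ?_⟩
      intro h5
      have h6 := D.a1 _ (show h (s1 (s2 (s1 x))) = true by rw [D.h1, h5])
      rw [← S.braid, D.c2, h2] at h6
      cases h6
  omega

theorem pentE (S : FSys G s0 s1 s2 fz vt fc) (D : Deco0 s0 s1 s2 c h)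
    (x : X) (h5 : fz x = 5) (hx : h x = false) :
    ∃ y, fc y = fc x ∧ c y = false ∧ c (s1 y) = false := by
  have hcl := S.close x
  rw [h5] at hcl
  have T : ∀ z, h z = false → c z = true → c (s1 (s0 z)) = false := by
    intro z h1 h2
    exact D.a2 _ (by rw [D.h0, h1]) (by rw [D.c0, h2])
  have hh : ∀ n, h (altS s0 s1 x n) = false := by
    intro n
    induction n with
    | zero => exact hx
    | succ n ih => simp only [altS]; split_ifs <;> simp [D.h0, D.h1, ih]
  have hfc : ∀ n, fc (altS s0 s1 x n) = fc x := by
    intro n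
    induction n with
    | zero => rfl
    | succ n ih => simp only [altS]; split_ifs <;> simp [S.f0, S.f1, ih]
  by_contra hne
  push Not at hne
  have N : ∀ i, c (altS s0 s1 x (2 * i)) = false → c (altS s0 s1 x (2 * i + 2)) = true := by
    intro i hi
    have := hne (s0 (altS s0 s1 x (2 * i))) (by rw [S.f0, hfc]) (by rw [D.c0, hi])
    rw [altS_even]; simpa using this
  have P : ∀ i, c (altS s0 s1 x (2 * i)) = true → c (altS s0 s1 x (2 * i + 2)) = false := by
    intro i hi
    rw [altS_even]; exact T _ (hh _) hi
  have n0 := N 0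
  have n1 := N 1
  have n2 := N 2
  have n3 := N 3
  have n4 := N 4
  have p0 := P 0
  have p1 := P 1
  have p2 := P 2
  have p3 := P 3
  have p4 := P 4
  have e0 : altS s0 s1 x 0 = x := rfl
  simp only [Nat.reduceMul, Nat.reduceAdd] at *
  rw [hcl] at n4 p4
  rw [e0] at n0 p0
  clear N P
  clear T hh hfc hne hcl
  generalize c x = b0 at *
  generalize c (altS s0 s1 x 2) = b1 at *
  generalize c (altS s0 s1 x 4) = b2 at *
  generalize c (altS s0 s1 x 6) = b3 at *
  generalize c (altS s0 s1 x 8) = b4 at *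
  cases b0 <;> simp_all

theorem sext_main [DecidableEq F] (S : FSys G s0 s1 s2 fz vt fc) (T : Sext s0 s1 s2 fz m h)
    (hX : Fintype.card X = 360) (PF : Finset F) (hPF : PF.card = 12)
    (p1 : ∀ f ∈ PF, ∃ x, fc x = f) (p2 : ∀ x, fc x ∈ PF ↔ fz x = 5) :
    (Finset.univ.filter fun x => h x = true).card ≤ 96 ∧
    ((∀ x, fz x = 5 ∨ fz x = 6) → (Finset.univ.filter fun x => h x = true).card = 96 →
      Deco s0 s1 s2 fz fc (cS s2 m h) h ∧
      (Finset.univ.filter fun x => cS s2 m h x = false ∧ htB s1 s2 (cS s2 m h) x = true).card = 96 ∧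
      (Finset.univ.filter fun x => cS s2 m h x = false ∧ ¬ htB s1 s2 (cS s2 m h) x = true).card = 48) := by
  classical
  obtain ⟨D, a4⟩ := T.deco0 S
  obtain ⟨c1, c2, c3⟩ := counts S D a4
  set c := cS s2 m h with hc
  have hp : ∀ x, fz x = 5 → h x = false := by
    intro x hx
    by_contra h1
    have := T.h6 x (by simpa using h1)
    omega
  -- E-flags of a face
  have hE2 : ∀ f ∈ PF, 2 ≤ (Finset.univ.filter fun x => (c x = false ∧ c (s1 x) = false) ∧ fc x = f).card := by
    intro f hf
    obtain ⟨x, rfl⟩ := p1 f hf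
    have hx := (p2 x).1 hf
    obtain ⟨y, hy1, hy2, hy3⟩ := pentE S D x hx (hp x hx)
    have : ({y, s1 y} : Finset X) ⊆ (Finset.univ.filter fun z => (c z = false ∧ c (s1 z) = false) ∧ fc z = fc x) := by
      intro z hz
      simp only [Finset.mem_insert, Finset.mem_singleton] at hz
      rw [Finset.mem_filter_univ]
      rcases hz with rfl | rfl
      · exact ⟨⟨hy2, hy3⟩, hy1⟩
      · exact ⟨⟨hy3, by rw [S.i1]; exact hy2⟩, by rw [S.f1, hy1]⟩
    have h2 := Finset.card_le_card this
    rwa [Finset.card_pair (S.n1 y).symm] at h2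
  have hsum : ∑ f ∈ PF, (Finset.univ.filter fun x => (c x = false ∧ c (s1 x) = false) ∧ fc x = f).card
      = (Finset.univ.filter fun x => (c x = false ∧ c (s1 x) = false) ∧ fc x ∈ PF).card := by
    rw [Finset.card_eq_sum_card_fiberwise (f := fc) (t := PF)]
    · apply Finset.sum_congr rfl
      intro f hf
      congr 1
      ext x
      simp only [Finset.mem_filter_univ, Finset.mem_filter, Finset.mem_univ, true_and]
      constructor
      · rintro ⟨h1, h2⟩; exact ⟨⟨h1, by rw [h2]; exact hf⟩, h2⟩
      · rintro ⟨h1, h2⟩; exact ⟨h1.1, h2⟩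
    · intro x hx
      simp only [Finset.coe_filter, Finset.mem_univ, true_and] at hx
      exact hx.2
  have hle := Finset.sum_le_sum hE2
  simp only [Finset.sum_const, hPF, smul_eq_mul] at hle
  rw [hsum] at hle
  have hsp := card_split (fun x => c x = false ∧ c (s1 x) = false) (fun x => fc x ∈ PF)
  refine ⟨by omega, ?_⟩
  intro h56 h96
  have hz : (Finset.univ.filter fun x => (c x = false ∧ c (s1 x) = false) ∧ ¬ fc x ∈ PF).card = 0 := by
    omega
  have heq : ∀ f ∈ PF, (Finset.univ.filter fun x => (c x = false ∧ c (s1 x) = false) ∧ fc x = f).card = 2 := by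
    have h24 : ∑ f ∈ PF, 2 = ∑ f ∈ PF, (Finset.univ.filter fun x => (c x = false ∧ c (s1 x) = false) ∧ fc x = f).card := by
      rw [hsum]; simp only [Finset.sum_const, hPF, smul_eq_mul]; omega
    intro f hf
    exact (((Finset.sum_eq_sum_iff_of_le hE2).1 h24) f hf).symm
  refine ⟨⟨D, a4, h56, ?_, ?_⟩, by omega, by omega⟩
  · intro x hx hx1
    by_contra hx2
    rw [Finset.card_eq_zero] at hz
    have : x ∈ (Finset.univ.filter fun x => (c x = false ∧ c (s1 x) = false) ∧ ¬ fc x ∈ PF) := by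
      rw [Finset.mem_filter_univ]
      exact ⟨⟨hx1, by simpa using hx2⟩, by rw [p2]; omega⟩
    rw [hz] at this; simp at this
  · intro x x' hx hx1 hx2 hf hx1' hx2'
    have h2 := heq (fc x) ((p2 x).2 hx)
    have hsub : ({x, s1 x} : Finset X) ⊆ (Finset.univ.filter fun z => (c z = false ∧ c (s1 z) = false) ∧ fc z = fc x) := by
      intro z hz
      simp only [Finset.mem_insert, Finset.mem_singleton] at hz
      rw [Finset.mem_filter_univ]
      rcases hz with rfl | rfl
      · exact ⟨⟨hx1, hx2⟩, rfl⟩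
      · exact ⟨⟨hx2, by rw [S.i1]; exact hx1⟩, by rw [S.f1]⟩
    have he := Finset.eq_of_subset_of_card_le hsub (by rw [h2, Finset.card_pair (S.n1 x).symm])
    have hm : x' ∈ ({x, s1 x} : Finset X) := by
      rw [he, Finset.mem_filter_univ]; exact ⟨⟨hx1', hx2'⟩, hf⟩
    simpa using hm

/-- isolated pentagons -/
theorem ipr_main (S : FSys G s0 s1 s2 fz vt fc)
    (hX : Fintype.card X = 360) (h5 : (Finset.univ.filter fun x => fz x = 5).card = 120)
    (h56 : ∀ x, fz x = 5 ∨ fz x = 6) (hi : ∀ x, fz x = 5 → fz (s2 x) ≠ 5) :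
    ∃ c h : X → Bool, Deco s0 s1 s2 fz fc c h ∧ (∀ x, c x = false → htB s1 s2 c x = true ∧
      fz (s2 (s1 x)) = 5) ∧ (Finset.univ.filter fun x => c x = false).card = 120 := by
  classical
  have key : ∀ x, fz (s2 (s1 (s2 x))) = fz (s2 (s1 x)) := by intro x; rw [S.braid, S.z1]
  have g1 : ∀ x, fz x = 5 → fz (s2 (s1 x)) ≠ 5 := fun x hx => hi _ (by rw [S.z1, hx])
  have g2 : ∀ x, fz (s2 x) = 5 → fz (s2 (s1 x)) ≠ 5 := fun x hx => by
    have := g1 _ hx; rwa [key] at this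
  have n2 : (Finset.univ.filter fun x => fz (s2 x) = 5).card = 120 := by
    rw [← h5]; exact card_inv s2 S.i2 _ _ (fun x => Iff.rfl)
  have n3 : (Finset.univ.filter fun x => fz (s2 (s1 x)) = 5).card = 120 := by
    rw [← n2]; exact card_inv s1 S.i1 _ _ (fun x => Iff.rfl)
  have all : ∀ x, fz x = 5 ∨ fz (s2 x) = 5 ∨ fz (s2 (s1 x)) = 5 := by
    have d1 : Disjoint (Finset.univ.filter fun x => fz x = 5) (Finset.univ.filter fun x => fz (s2 x) = 5) := by
      rw [Finset.disjoint_filter]; intro x _ h1; exact hi x h1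
    have d2 : Disjoint ((Finset.univ.filter fun x => fz x = 5) ∪ (Finset.univ.filter fun x => fz (s2 x) = 5))
        (Finset.univ.filter fun x => fz (s2 (s1 x)) = 5) := by
      rw [Finset.disjoint_union_left]
      constructor
      · rw [Finset.disjoint_filter]; intro x _ h1; exact g1 x h1
      · rw [Finset.disjoint_filter]; intro x _ h1; exact g2 x h1
    have hc := Finset.card_union_of_disjoint d2
    rw [Finset.card_union_of_disjoint d1, h5, n2, n3] at hc
    have hu := Finset.eq_univ_of_card _ (by rw [hc, hX])
    intro x
    have := Finset.mem_univ x
    rw [← hu] at this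
    simp only [Finset.mem_union, Finset.mem_filter_univ] at this
    tauto
  have cF : ∀ x, (decide (fz x = 5) || decide (fz (s2 x) = 5)) = false ↔ fz (s2 (s1 x)) = 5 := by
    intro x
    simp only [Bool.or_eq_false_iff, decide_eq_false_iff_not]
    constructor
    · intro h; have := all x; tauto
    · intro h; exact ⟨fun h1 => g1 x h1 h, fun h1 => g2 x h1 h⟩
  have cT : ∀ x, (decide (fz x = 5) || decide (fz (s2 x) = 5)) = true ↔ (fz x = 5 ∨ fz (s2 x) = 5) := by
    intro x; simp
  refine ⟨fun x => decide (fz x = 5) || decide (fz (s2 x) = 5), fun x => decide (fz x = 5),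
    ⟨⟨?_, ?_, ?_, ?_, ?_, ?_, ?_, ?_, ?_⟩, ?_, h56, ?_, ?_⟩, ?_, ?_⟩
  · intro x; simp only [S.z0, ← S.comm]
  · intro x; simp only [S.i2]; rw [Bool.or_comm]
  · intro x; simp only [S.z0]
  · intro x; simp only [S.z1]
  · intro x hx; rw [cT]; left; simpa using hx
  · intro x hx hc
    rw [cT] at hc
    rw [cF, S.i1]
    have hx : fz x ≠ 5 := by simpa using hx
    tauto
  · intro x hx; have := hi x (by simpa using hx); simpa using this
  · intro x hx
    have hx : fz x = 5 := by simpa using hx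
    rw [cF, S.i1, S.i2]; exact hx
  · intro x hx _ _
    rw [cF] at hx; simpa using hx
  · intro x hx h1
    rw [cF] at hx
    rw [cF, S.i1] at h1
    exact absurd hx (g2 x h1)
  · intro x _ hx
    rw [cF] at hx
    rw [cT]; exact Or.inr hx
  · intro x _ _ hx h1
    rw [cF] at hx
    rw [cF, S.i1] at h1
    exact absurd hx (g2 x h1)
  · intro x hx
    rw [cF] at hx
    refine ⟨?_, hx⟩
    rw [htB_iff, cT, cT]
    exact ⟨Or.inr hx, Or.inr (by rw [key]; exact hx)⟩
  · rw [← n3]; congr 1; ext x; simp only [Finset.mem_filter_univ]; exact cF x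
end cnt
end FG

namespace FG
/-! ### Cyclic structure of faces -/
theorem mem_edges_getVert {W : Type} {G : SimpleGraph W} {u v : W} (p : G.Walk u v) (e : Sym2 W) :
    e ∈ p.edges ↔ ∃ i, i < p.length ∧ e = s(p.getVert i, p.getVert (i + 1)) := by
  induction p with
  | nil => simp
  | cons h p ih =>
    simp only [SimpleGraph.Walk.edges_cons, List.mem_cons, ih, SimpleGraph.Walk.length_cons]
    constructor
    · rintro (rfl | ⟨i, hi, rfl⟩)
      · exact ⟨0, by omega, by simp⟩
      · exact ⟨i + 1, by omega, by simp⟩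
    · rintro ⟨i, hi, rfl⟩
      cases i with
      | zero => left; simp
      | succ i => right; exact ⟨i, by omega, by simp⟩

section
variable {V : Type} [Fintype V] [DecidableEq V]

/-- the cyclic vertex sequence of a face -/
structure Cyc (f : Finset (Sym2 V)) (u : ℤ → V) : Prop where
  three : 3 ≤ f.card
  eq : ∀ i j, u i = u j ↔ (f.card : ℤ) ∣ i - j
  mem : ∀ e, e ∈ f ↔ ∃ i, e = s(u i, u (i + 1))

theorem Cyc.shift {f : Finset (Sym2 V)} {u : ℤ → V} (h : Cyc f u) (k : ℤ) :
    Cyc f (fun i => u (i + k)) where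
  three := h.three
  eq := fun i j => by rw [h.eq, add_sub_add_right_eq_sub]
  mem := fun e => by
    rw [h.mem]
    constructor
    · rintro ⟨i, rfl⟩
      exact ⟨i - k, by rw [show i - k + k = i by ring, show i - k + 1 + k = i + 1 by ring]⟩
    · rintro ⟨i, rfl⟩
      exact ⟨i + k, by rw [show i + 1 + k = i + k + 1 by ring]⟩

theorem Cyc.refl {f : Finset (Sym2 V)} {u : ℤ → V} (h : Cyc f u) :
    Cyc f (fun i => u (-i)) where
  three := h.three
  eq := fun i j => by rw [h.eq, ← dvd_neg]; congr! 1; ring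
  mem := fun e => by
    rw [h.mem]
    constructor
    · rintro ⟨i, rfl⟩
      refine ⟨-i - 1, ?_⟩
      rw [Sym2.eq_swap, show -(-i - 1) = i + 1 by ring, show -(-i - 1 + 1) = i by ring]
    · rintro ⟨i, rfl⟩
      refine ⟨-i - 1, ?_⟩
      rw [Sym2.eq_swap, show -(i + 1) = -i - 1 by ring, show -i - 1 + 1 = -i by ring]

theorem cyc0 (P : PlaneGraph V) {f : Finset (Sym2 V)} (hf : f ∈ P.faces) :
    ∃ u, Cyc f u := by
  obtain ⟨v, c, hc, rfl⟩ := P.face_cycle f hf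
  have h3 := hc.three_le_length
  have hcard : c.edges.toFinset.card = c.length := by
    rw [List.toFinset_card_of_nodup hc.edges_nodup, SimpleGraph.Walk.length_edges]
  have hn : (0 : ℤ) < c.length := by omega
  refine ⟨fun i => c.getVert (i % c.length).toNat, ?_, ?_, ?_⟩
  · rw [hcard]; exact h3
  · intro i j
    rw [hcard]
    have hi := Int.emod_nonneg i hn.ne'
    have hi2 := Int.emod_lt_of_pos i hn
    have hj := Int.emod_nonneg j hn.ne'
    have hj2 := Int.emod_lt_of_pos j hn
    rw [← Int.emod_emod_of_dvd i dvd_rfl, ← Int.emod_emod_of_dvd j dvd_rfl] 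
    constructor
    · intro h
      simp only [Int.emod_emod] at h
      have := hc.getVert_injOn' (by simp only [Set.mem_ofPred_eq]; omega) (by simp only [Set.mem_ofPred_eq]; omega) h
      apply Int.dvd_of_emod_eq_zero
      rw [Int.sub_emod]
      have : i % c.length = j % c.length := by omega
      rw [this]; simp
    · intro h
      simp only [Int.emod_emod]
      have : i % c.length = j % c.length := Int.ModEq.symm ((Int.modEq_iff_dvd).2 h)
      rw [this]
  · intro e
    rw [List.mem_toFinset, mem_edges_getVert]
    have key : ∀ i : ℕ, i < c.length → c.getVert ((((i : ℤ) + 1) % c.length).toNat) = c.getVert (i + 1) := by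
      intro i hi
      rcases Nat.lt_or_ge (i + 1) c.length with h | h
      · rw [Int.emod_eq_of_lt (by omega) (by omega)]; congr 1
      · have : i + 1 = c.length := by omega
        have h2 : (i : ℤ) + 1 = c.length := by omega
        rw [h2, this]; simp
    constructor
    · rintro ⟨i, hi, rfl⟩
      refine ⟨i, ?_⟩
      rw [key i hi, Int.emod_eq_of_lt (by omega) (by omega)]; simp
    · rintro ⟨i, rfl⟩
      have hi := Int.emod_nonneg i hn.ne'
      have hi2 := Int.emod_lt_of_pos i hn
      refine ⟨(i % c.length).toNat, by omega, ?_⟩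
      rw [← key _ (by omega)]
      have : (((i % c.length).toNat : ℤ) + 1) % c.length = (i + 1) % c.length := by
        rw [Int.toNat_of_nonneg hi, Int.emod_add_emod]
      rw [this]

theorem cycU (P : PlaneGraph V) {f : Finset (Sym2 V)} (hf : f ∈ P.faces) {v w : V}
    (h : s(v, w) ∈ f) : ∃ u, Cyc f u ∧ u 0 = v ∧ u 1 = w := by
  obtain ⟨u, hu⟩ := cyc0 P hf
  obtain ⟨i, hi⟩ := (hu.mem _).1 h
  rw [Sym2.eq_iff] at hi
  rcases hi with ⟨rfl, rfl⟩ | ⟨rfl, rfl⟩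
  · exact ⟨_, hu.shift i, by simp, by simp [add_comm]⟩
  · refine ⟨_, (hu.shift (i + 1)).refl, by simp, by simp⟩

/-- the edges of a face at a vertex -/
theorem Cyc.nbr {f : Finset (Sym2 V)} {u : ℤ → V} (h : Cyc f u) (i : ℤ) (w : V) :
    s(u i, w) ∈ f ↔ w = u (i + 1) ∨ w = u (i - 1) := by
  rw [h.mem]
  constructor
  · rintro ⟨j, hj⟩
    rw [Sym2.eq_iff] at hj
    rcases hj with ⟨h1, rfl⟩ | ⟨h1, rfl⟩
    · left
      rw [h.eq] at h1 ⊢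
      rw [← dvd_neg] at h1; ring_nf at h1 ⊢; exact h1
    · right
      rw [h.eq] at h1 ⊢
      rw [← dvd_neg] at h1; ring_nf at h1 ⊢; exact h1
  · rintro (rfl | rfl)
    · exact ⟨i, rfl⟩
    · exact ⟨i - 1, by rw [Sym2.eq_swap]; congr 3; ring⟩

theorem Cyc.ne2 {f : Finset (Sym2 V)} {u : ℤ → V} (h : Cyc f u) (i : ℤ) : u (i + 1) ≠ u (i - 1) := by
  intro e
  rw [h.eq] at e
  have h3 := h.three
  have := Int.le_of_dvd (by omega) e
  omega

theorem Cyc.ne1 {f : Finset (Sym2 V)} {u : ℤ → V} (h : Cyc f u) (i : ℤ) : u i ≠ u (i + 1) := by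
  intro e
  have e := e.symm
  rw [h.eq] at e
  have h3 := h.three
  have := Int.le_of_dvd (by omega) e
  omega
end
end FG

namespace FG
/-! ### Flags of a plane graph -/
section flags
variable {V : Type} [Fintype V] [DecidableEq V]

abbrev Flag (P : PlaneGraph V) : Type :=
  {x : V × V × Finset (Sym2 V) // x.2.2 ∈ P.faces ∧ s(x.1, x.2.1) ∈ x.2.2}

variable {P : PlaneGraph V}

theorem flag_ext {x y : Flag P} (h1 : x.1.1 = y.1.1) (h2 : x.1.2.1 = y.1.2.1)
    (h3 : x.1.2.2 = y.1.2.2) : x = y :=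
  Subtype.ext (Prod.ext h1 (Prod.ext h2 h3))

theorem ex1 (x : Flag P) : ∃ y : Flag P, (y.1.1 = x.1.1 ∧ y.1.2.2 = x.1.2.2 ∧ y.1.2.1 ≠ x.1.2.1) ∧
    ∀ w, s(x.1.1, w) ∈ x.1.2.2 → w = x.1.2.1 ∨ w = y.1.2.1 := by
  obtain ⟨⟨v, w, f⟩, hf, hx⟩ := x
  obtain ⟨u, hu, rfl, rfl⟩ := cycU P hf hx
  refine ⟨⟨(u 0, u (0 - 1), f), hf, (hu.nbr 0 _).2 (Or.inr rfl)⟩, ⟨rfl, rfl, ?_⟩, ?_⟩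
  · exact (hu.ne2 0).symm
  · intro w hw
    exact (hu.nbr 0 w).1 hw

theorem ex2 (x : Flag P) : ∃ y : Flag P, (y.1.1 = x.1.1 ∧ y.1.2.1 = x.1.2.1 ∧ y.1.2.2 ≠ x.1.2.2) ∧
    ∀ f ∈ P.faces, s(x.1.1, x.1.2.1) ∈ f → f = x.1.2.2 ∨ f = y.1.2.2 := by
  obtain ⟨⟨v, w, f⟩, hf, hx⟩ := x
  simp only at hf hx
  have h2 := P.edge_faces _ (P.face_edges f hf _ hx)
  rw [Finset.card_eq_two] at h2
  obtain ⟨a, b, hab, he⟩ := h2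
  have key : ∀ g, (g ∈ P.faces ∧ s(v, w) ∈ g) ↔ (g = a ∨ g = b) := by
    intro g
    rw [← Finset.mem_filter (p := fun f => s(v, w) ∈ f), he]; simp
  have hb := (key b).2 (Or.inr rfl)
  have ha := (key a).2 (Or.inl rfl)
  rcases (key f).1 ⟨hf, hx⟩ with rfl | rfl
  · exact ⟨⟨(v, w, b), hb⟩, ⟨rfl, rfl, hab.symm⟩, fun g hg hg' => (key g).1 ⟨hg, hg'⟩⟩
  · exact ⟨⟨(v, w, a), ha⟩, ⟨rfl, rfl, hab⟩, fun g hg hg' => ((key g).1 ⟨hg, hg'⟩).symm⟩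

def t0 (x : Flag P) : Flag P := ⟨(x.1.2.1, x.1.1, x.1.2.2), x.2.1, by rw [Sym2.eq_swap]; exact x.2.2⟩
noncomputable def t1 (x : Flag P) : Flag P := (ex1 x).choose
noncomputable def t2 (x : Flag P) : Flag P := (ex2 x).choose

theorem t1v (x : Flag P) : (t1 x).1.1 = x.1.1 := (ex1 x).choose_spec.1.1
theorem t1f (x : Flag P) : (t1 x).1.2.2 = x.1.2.2 := (ex1 x).choose_spec.1.2.1
theorem t1w (x : Flag P) : (t1 x).1.2.1 ≠ x.1.2.1 := (ex1 x).choose_spec.1.2.2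
theorem t1u (x : Flag P) : ∀ w, s(x.1.1, w) ∈ x.1.2.2 → w = x.1.2.1 ∨ w = (t1 x).1.2.1 :=
  (ex1 x).choose_spec.2
theorem t2v (x : Flag P) : (t2 x).1.1 = x.1.1 := (ex2 x).choose_spec.1.1
theorem t2w (x : Flag P) : (t2 x).1.2.1 = x.1.2.1 := (ex2 x).choose_spec.1.2.1
theorem t2f (x : Flag P) : (t2 x).1.2.2 ≠ x.1.2.2 := (ex2 x).choose_spec.1.2.2
theorem t2u (x : Flag P) : ∀ f ∈ P.faces, s(x.1.1, x.1.2.1) ∈ f → f = x.1.2.2 ∨ f = (t2 x).1.2.2 :=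
  (ex2 x).choose_spec.2

theorem t1_eq {x y : Flag P} (h1 : y.1.1 = x.1.1) (h2 : y.1.2.2 = x.1.2.2)
    (h3 : y.1.2.1 ≠ x.1.2.1) : t1 x = y := by
  apply flag_ext
  · rw [t1v, h1]
  · have := t1u x y.1.2.1 (by rw [← h1, ← h2]; exact y.2.2)
    tauto
  · rw [t1f, h2]

theorem t2_eq {x y : Flag P} (h1 : y.1.1 = x.1.1) (h2 : y.1.2.1 = x.1.2.1)
    (h3 : y.1.2.2 ≠ x.1.2.2) : t2 x = y := by
  apply flag_ext
  · rw [t2v, h1]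
  · rw [t2w, h2]
  · have := t2u x y.1.2.2 y.2.1 (by rw [← h1, ← h2]; exact y.2.2)
    tauto

theorem t0t0 (x : Flag P) : t0 (t0 x) = x := rfl
theorem t1t1 (x : Flag P) : t1 (t1 x) = x := t1_eq (t1v x).symm (t1f x).symm (t1w x).symm
theorem t2t2 (x : Flag P) : t2 (t2 x) = x := t2_eq (t2v x).symm (t2w x).symm (t2f x).symm
theorem t0t2 (x : Flag P) : t0 (t2 x) = t2 (t0 x) := by
  symm
  exact t2_eq (t2w x) (t2v x) (t2f x)

theorem flag_adj (x : Flag P) : P.graph.Adj x.1.1 x.1.2.1 := by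
  have := P.face_edges _ x.2.1 _ x.2.2
  simpa using this

theorem ex_flag {v w : V} (h : P.graph.Adj v w) : ∃ x : Flag P, x.1.1 = v ∧ x.1.2.1 = w := by
  have h2 := P.edge_faces s(v, w) (by simpa using h)
  have : (P.faces.filter fun f => s(v, w) ∈ f).Nonempty := by
    rw [← Finset.card_pos]; omega
  obtain ⟨f, hf⟩ := this
  rw [Finset.mem_filter] at hf
  exact ⟨⟨(v, w, f), hf⟩, rfl, rfl⟩

/-- the three neighbours of a vertex -/
theorem cubic_nbr (hc : ∀ v : V, (P.graph.neighborSet v).ncard = 3) {v a b d w : V}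
    (ha : P.graph.Adj v a) (hb : P.graph.Adj v b) (hd : P.graph.Adj v d) (hab : a ≠ b) (had : a ≠ d)
    (hbd : b ≠ d) (hw : P.graph.Adj v w) : w = a ∨ w = b ∨ w = d := by
  classical
  have h3 := hc v
  rw [Set.ncard_eq_three] at h3
  obtain ⟨x, y, z, h1, h2, h3, he⟩ := h3
  have key : ∀ t, P.graph.Adj v t ↔ (t = x ∨ t = y ∨ t = z) := by
    intro t
    rw [← SimpleGraph.mem_neighborSet, he]; simp
  rw [key] at ha hb hd hw
  rcases ha with rfl | rfl | rfl <;> rcases hb with rfl | rfl | rfl <;> rcases hd with rfl | rfl | rfl <;>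
    rcases hw with rfl | rfl | rfl <;> simp_all

theorem ex_third (hc : ∀ v : V, (P.graph.neighborSet v).ncard = 3) (v a b : V) :
    ∃ w, P.graph.Adj v w ∧ w ≠ a ∧ w ≠ b := by
  by_contra h
  push Not at h
  have h1 : P.graph.neighborSet v ⊆ {a, b} := by
    intro w hw
    by_cases e : w = a
    · left; exact e
    · right; exact h w hw e
  have := Set.ncard_le_ncard h1
  rw [hc] at this
  have h2 := Set.ncard_insert_le a {b}
  rw [Set.ncard_singleton] at h2
  omega

theorem w12 (hc : ∀ v : V, (P.graph.neighborSet v).ncard = 3) (x : Flag P) :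
    (t1 (t2 x)).1.2.1 ≠ (t1 x).1.2.1 := by
  intro e
  obtain ⟨w, h1, h2, h3⟩ := ex_third hc x.1.1 x.1.2.1 (t1 x).1.2.1
  obtain ⟨y, hy1, hy2⟩ := ex_flag h1
  have a1 := flag_adj x
  have a2 := flag_adj (t1 x)
  rw [t1v] at a2
  have a3 := flag_adj (t1 y)
  rw [t1v, hy1] at a3
  have hne := t1w y
  -- the face of `y` contains `w` and one of the other two
  have f1 : s(x.1.1, w) ∉ x.1.2.2 := fun h => by
    rcases t1u x w h with h | h
    · exact h2 h
    · exact h3 h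
  have f2 : s(x.1.1, w) ∉ (t2 x).1.2.2 := fun h => by
    rcases t1u (t2 x) w (by rw [t2v]; exact h) with h | h
    · rw [t2w] at h; exact h2 h
    · rw [e] at h; exact h3 h
  have hyf : s(x.1.1, w) ∈ y.1.2.2 := by rw [← hy1, ← hy2]; exact y.2.2
  have hyf' : s(x.1.1, (t1 y).1.2.1) ∈ y.1.2.2 := by
    have := (t1 y).2.2
    rw [t1v, hy1, t1f] at this; exact this
  rcases cubic_nbr hc a1 a2 h1 (t1w x).symm h2.symm h3.symm a3 with h | h | h
  · rw [h] at hyf'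
    rcases t2u x _ y.2.1 hyf' with h | h
    · rw [h] at hyf; exact f1 hyf
    · rw [h] at hyf; exact f2 hyf
  · rw [h] at hyf'
    rcases t2u (t1 x) _ y.2.1 (by rw [t1v]; exact hyf') with h' | h'
    · rw [h', t1f] at hyf; exact f1 hyf
    · have h2x : s(x.1.1, (t1 x).1.2.1) ∈ (t2 x).1.2.2 := by
        have := (t1 (t2 x)).2.2
        rw [t1v, t2v, t1f, e] at this; exact this
      rcases t2u (t1 x) _ (t2 x).2.1 (by rw [t1v]; exact h2x) with h'' | h''
      · rw [t1f] at h''; exact t2f x h''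
      · rw [h', ← h''] at hyf; exact f2 hyf
  · exact hne (by rw [h, hy2])

theorem tbraid (hc : ∀ v : V, (P.graph.neighborSet v).ncard = 3) (x : Flag P) :
    t2 (t1 (t2 x)) = t1 (t2 (t1 x)) := by
  have a1 := flag_adj x
  have a2 := flag_adj (t1 x)
  rw [t1v] at a2
  have a3 := flag_adj (t1 (t2 x))
  rw [t1v, t2v] at a3
  have n12 : x.1.2.1 ≠ (t1 x).1.2.1 := (t1w x).symm
  have n13 : x.1.2.1 ≠ (t1 (t2 x)).1.2.1 := by
    have := t1w (t2 x); rw [t2w] at this; exact this.symm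
  have n23 : (t1 x).1.2.1 ≠ (t1 (t2 x)).1.2.1 := (w12 hc x).symm
  have b1 := t1w (t2 (t1 x))
  rw [t2w] at b1
  have b2 := w12 hc (t1 x)
  rw [t1t1] at b2
  have a4 := flag_adj (t1 (t2 (t1 x)))
  rw [t1v, t2v, t1v] at a4
  have hw : (t1 (t2 (t1 x))).1.2.1 = (t1 (t2 x)).1.2.1 := by
    rcases cubic_nbr hc a1 a2 a3 n12 n13 n23 a4 with h | h | h
    · exact absurd h b2
    · exact absurd h b1
    · exact h
  apply t2_eq
  · rw [t1v, t2v, t1v, t1v, t2v]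
  · exact hw
  · rw [t1f, t1f]
    intro h
    have := (t2 (t1 x)).2.2
    rw [t2v, t1v, t2w, h] at this
    rcases t1u (t2 x) _ (by rw [t2v]; exact this) with h' | h'
    · rw [t2w] at h'; exact n12 h'.symm
    · exact n23 h'

theorem alt_flag (x : Flag P) (u : ℤ → V) (hu : Cyc x.1.2.2 u) (h0 : u 0 = x.1.1) (h1 : u 1 = x.1.2.1)
    (i : ℕ) : (altS t0 t1 x (2 * i)).1 = (u i, u (i + 1), x.1.2.2) ∧
      (altS t0 t1 x (2 * i + 1)).1 = (u (i + 1), u i, x.1.2.2) := by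
  induction i with
  | zero =>
    have : (altS t0 t1 x 0).1 = (u 0, u 1, x.1.2.2) := by rw [h0, h1]; rfl
    refine ⟨this, ?_⟩
    rw [altS_oddE]
    simp only [t0, Nat.mul_zero, this]; simp
  | succ i ih =>
    have e : (altS t0 t1 x (2 * i + 2)).1 = (u ((i + 1 : ℕ) : ℤ), u ((i + 1 : ℕ) + 1 : ℤ), x.1.2.2) := by
      rw [altS_even, ← altS_oddE t0 t1 x i]
      have hm : s(u ((i + 1 : ℕ) : ℤ), u ((i + 1 : ℕ) + 1 : ℤ)) ∈ x.1.2.2 := (hu.mem _).2 ⟨_, rfl⟩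
      have : t1 (altS t0 t1 x (2 * i + 1)) = ⟨(u ((i + 1 : ℕ) : ℤ), u ((i + 1 : ℕ) + 1 : ℤ), x.1.2.2), x.2.1, hm⟩ := by
        apply t1_eq
        · rw [ih.2]; push_cast; rfl
        · rw [ih.2]
        · rw [ih.2]
          have := hu.ne2 (i + 1)
          simp only; push_cast
          rwa [show (i : ℤ) + 1 - 1 = i by ring] at this
      rw [this]
    refine ⟨e, ?_⟩
    rw [altS_oddE]
    have e' : (altS t0 t1 x (2 * (i + 1))).1 = (u ((i + 1 : ℕ) : ℤ), u ((i + 1 : ℕ) + 1 : ℤ), x.1.2.2) := e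
    simp only [t0, e']

theorem mkFSys (hF : IsFullerene P) :
    FSys P.graph (t0 (P := P)) t1 t2 (fun x => x.1.2.2.card) (fun x => x.1.1) (fun x => x.1.2.2) where
  i0 := t0t0
  i1 := t1t1
  i2 := t2t2
  n1 := fun x e => t1w x (by rw [e])
  n2 := fun x e => t2f x (by rw [e])
  comm := t0t2
  braid := tbraid hF.cubic
  z0 := fun x => rfl
  z1 := fun x => by rw [t1f]
  f0 := fun x => rfl
  f1 := t1f
  v1 := t1v
  v2 := t2v
  adj := fun x => flag_adj x
  close := fun x => by
    obtain ⟨u, hu, h0, h1⟩ := cycU P x.2.1 x.2.2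
    have := (alt_flag x u hu h0 h1 x.1.2.2.card).1
    apply Subtype.ext
    rw [this]
    have e1 : u (x.1.2.2.card : ℤ) = x.1.1 := by rw [← h0, hu.eq]; simp
    have e2 : u ((x.1.2.2.card : ℤ) + 1) = x.1.2.1 := by rw [← h1, hu.eq]; simp
    rw [e1, e2]
  inj := fun x i j hij hj e => by
    obtain ⟨u, hu, h0, h1⟩ := cycU P x.2.1 x.2.2
    have h3 := hu.three
    have A := alt_flag x u hu h0 h1
    have e' := congrArg Subtype.val e
    clear e
    have no : ∀ a : ℤ, 0 < a → a < x.1.2.2.card → ¬ (x.1.2.2.card : ℤ) ∣ a := by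
      intro a h1 h2 h3; have := Int.le_of_dvd h1 h3; omega
    obtain ⟨a, ha⟩ : ∃ a, i = 2 * a ∨ i = 2 * a + 1 := ⟨i / 2, by omega⟩
    obtain ⟨b, hb⟩ : ∃ b, j = 2 * b ∨ j = 2 * b + 1 := ⟨j / 2, by omega⟩
    rcases ha with rfl | rfl <;> rcases hb with rfl | rfl
    · rw [(A a).1, (A b).1] at e'
      simp only [Prod.mk.injEq, hu.eq] at e'
      have := dvd_neg.2 e'.1
      exact no (-((a : ℤ) - b)) (by omega) (by omega) this
    · rw [(A a).1, (A b).2] at e'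
      simp only [Prod.mk.injEq, hu.eq] at e'
      have := dvd_sub e'.2.1 e'.1
      exact no 2 (by omega) (by omega) (by ring_nf at this; exact this)
    · rw [(A a).2, (A b).1] at e'
      simp only [Prod.mk.injEq, hu.eq] at e'
      have := dvd_sub e'.1 e'.2.1
      exact no 2 (by omega) (by omega) (by ring_nf at this; exact this)
    · rw [(A a).2, (A b).2] at e'
      simp only [Prod.mk.injEq, hu.eq] at e'
      have := dvd_neg.2 e'.2.1
      exact no (-((a : ℤ) - b)) (by omega) (by omega) this
  trans := fun S hS hcl => by
    have loc : ∀ x ∈ S, ∀ y : Flag P, y.1.1 = x.1.1 → y ∈ S := by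
      intro x hx y hy
      have h1 := (hcl x hx).2.1
      have h2 := (hcl x hx).2.2
      have h3 := (hcl _ h2).2.1
      have edge : ∀ z ∈ S, z.1.1 = x.1.1 → y.1.2.1 = z.1.2.1 → y ∈ S := by
        intro z hz hzv hzw
        by_cases hf : y.1.2.2 = z.1.2.2
        · have : y = z := flag_ext (by rw [hy, hzv]) hzw hf
          rw [this]; exact hz
        · have : t2 z = y := t2_eq (by rw [hy, hzv]) hzw hf
          rw [← this]; exact (hcl z hz).2.2
      have a1 := flag_adj x
      have a2 := flag_adj (t1 x)
      rw [t1v] at a2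
      have a3 := flag_adj (t1 (t2 x))
      rw [t1v, t2v] at a3
      have n13 : x.1.2.1 ≠ (t1 (t2 x)).1.2.1 := by
        have := t1w (t2 x); rw [t2w] at this; exact this.symm
      have a4 := flag_adj y
      rw [hy] at a4
      rcases cubic_nbr hF.cubic a1 a2 a3 (t1w x).symm n13 (w12 hF.cubic x).symm a4 with h | h | h
      · exact edge x hx rfl h
      · exact edge _ h1 (t1v x) h
      · exact edge _ h3 (by rw [t1v, t2v]) h
    obtain ⟨x0, hx0⟩ := hS
    have conn := (hF.threeConnected ∅ (by simp)).preconnected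
    have step : ∀ a b : ((∅ : Set V)ᶜ : Set V), (SimpleGraph.induce (∅ : Set V)ᶜ P.graph).Walk a b →
        (∃ x ∈ S, x.1.1 = a.1) → ∃ x ∈ S, x.1.1 = b.1 := by
      intro a b p
      induction p with
      | nil => exact id
      | cons h p ih =>
        rintro ⟨x, hx, hxv⟩
        apply ih
        have h' : P.graph.Adj _ _ := h
        obtain ⟨y, hy1, hy2⟩ := ex_flag h'
        have : y ∈ S := loc x hx y (hy1.trans hxv.symm)
        exact ⟨t0 y, (hcl y this).1, hy2⟩
    ext y
    simp only [Set.mem_univ, iff_true]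
    obtain ⟨p⟩ := conn ⟨x0.1.1, by simp⟩ ⟨y.1.1, by simp⟩
    obtain ⟨x, hx, hxv⟩ := step _ _ p ⟨x0, hx0, rfl⟩
    exact loc x hx y hxv.symm
  vsurj := fun v => by
    obtain ⟨w, h, _⟩ := ex_third hF.cubic v v v
    obtain ⟨x, hx, _⟩ := ex_flag h
    exact ⟨x, hx⟩
end flags
end FG

namespace FG
/-! ### Counting flags; sextet patterns -/
section flags2
variable {V : Type} [Fintype V] [DecidableEq V] {P : PlaneGraph V}

theorem card_face_flags {f : Finset (Sym2 V)} (hf : f ∈ P.faces) :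
    (Finset.univ.filter fun x : Flag P => x.1.2.2 = f).card = 2 * f.card := by
  classical
  rw [Finset.card_eq_sum_card_fiberwise (f := fun x : Flag P => s(x.1.1, x.1.2.1)) (t := f)]
  · rw [mul_comm, ← smul_eq_mul]
    apply Finset.sum_const_nat
    intro e he
    induction e using Sym2.ind with
    | _ a b =>
    have hab : a ≠ b := by
      have := P.face_edges f hf _ he
      rw [SimpleGraph.mem_edgeSet] at this
      exact this.ne
    have : ((Finset.univ.filter fun x : Flag P => x.1.2.2 = f).filter
        fun x => s(x.1.1, x.1.2.1) = s(a, b)) =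
        {(⟨(a, b, f), hf, he⟩ : Flag P), ⟨(b, a, f), hf, by rw [Sym2.eq_swap]; exact he⟩} := by
      ext x
      simp only [Finset.mem_filter, Finset.mem_univ, true_and, Finset.mem_insert,
        Finset.mem_singleton, Sym2.eq_iff]
      constructor
      · rintro ⟨h1, h2 | h2⟩
        · left; exact flag_ext h2.1 h2.2 h1
        · right; exact flag_ext h2.1 h2.2 h1
      · rintro (rfl | rfl)
        · simp
        · simp
    rw [this, Finset.card_pair]
    intro h
    have := congrArg (fun x : Flag P => x.1.1) h
    exact hab this
  · intro x hx
    simp only [Finset.coe_filter, Finset.mem_univ, true_and, Set.mem_ofPred_eq] at hx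
    rw [← hx]; exact x.2.2

theorem card_faces_flags (A : Finset (Finset (Sym2 V))) (hA : A ⊆ P.faces) :
    (Finset.univ.filter fun x : Flag P => x.1.2.2 ∈ A).card = 2 * ∑ f ∈ A, f.card := by
  classical
  rw [Finset.card_eq_sum_card_fiberwise (f := fun x : Flag P => x.1.2.2) (t := A), Finset.mul_sum]
  · apply Finset.sum_congr rfl
    intro f hf
    rw [← card_face_flags (hA hf)]
    congr 1
    ext x
    simp only [Finset.mem_filter, Finset.mem_univ, true_and]
    constructor
    · exact fun h => h.2
    · rintro rfl; exact ⟨hf, rfl⟩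
  · intro x hx
    simpa using hx

theorem fl_counts (hF : IsFullerene P) (hV : Fintype.card V = 60) :
    Fintype.card (Flag P) = 360 ∧
      (Finset.univ.filter fun x : Flag P => x.1.2.2.card = 5).card = 120 := by
  have e0 := P.euler
  have e1 : ∑ f ∈ P.faces, f.card = ∑ f ∈ P.faces.filter (fun f => f.card = 5), f.card +
      ∑ f ∈ P.faces.filter (fun f => ¬ f.card = 5), f.card :=
    (Finset.sum_filter_add_sum_filter_not _ _ _).symm
  have e2 : ∑ f ∈ P.faces.filter (fun f => f.card = 5), f.card = 12 * 5 := by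
    rw [← hF.pentTwelve]
    apply Finset.sum_const_nat
    intro f hf; exact (Finset.mem_filter.1 hf).2
  have e3 : ∑ f ∈ P.faces.filter (fun f => ¬ f.card = 5), f.card =
      (P.faces.filter (fun f => ¬ f.card = 5)).card * 6 := by
    apply Finset.sum_const_nat
    intro f hf
    have := Finset.mem_filter.1 hf
    rcases hF.faceSize f this.1 with h | h
    · exact absurd h this.2
    · exact h
  have e4 := Finset.card_filter_add_card_filter_not (s := P.faces) (fun f => f.card = 5)
  rw [hF.pentTwelve] at e4
  constructor
  · have := card_faces_flags (P := P) P.faces subset_rfl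
    have h : (Finset.univ.filter fun x : Flag P => x.1.2.2 ∈ P.faces) = Finset.univ := by
      ext x; simp [x.2.1]
    rw [h, Finset.card_univ] at this
    omega
  · have := card_faces_flags (P := P) (P.faces.filter fun f => f.card = 5) (Finset.filter_subset _ _)
    rw [e2] at this
    rw [← show 2 * (12 * 5) = 120 from rfl, ← this]
    congr 1
    ext x; simp [x.2.1]

theorem mem_edgeVerts {f : Finset (Sym2 V)} {e : Sym2 V} {v : V} (h : e ∈ f) (hv : v ∈ e) :
    v ∈ edgeVerts f := by
  simp only [edgeVerts, Finset.mem_filter, Finset.mem_univ, true_and]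
  exact ⟨e, h, hv⟩

theorem sext_of (hF : IsFullerene P) {H : Finset (Finset (Sym2 V))} {M : Finset (Sym2 V)}
    (h1 : ∀ f ∈ H, f ∈ P.faces ∧ f.card = 6)
    (h2 : ∀ f ∈ H, ∀ g ∈ H, f ≠ g → Disjoint (edgeVerts f) (edgeVerts g))
    (hM : IsPerfectMatching P M) (h3 : ∀ f ∈ H, (f ∩ M).card = 3) :
    Sext (t0 (P := P)) t1 t2 (fun x => x.1.2.2.card) (fun x => decide (s(x.1.1, x.1.2.1) ∈ M))
      (fun x => decide (x.1.2.2 ∈ H)) where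
  m0 := fun x => by
    have : s((t0 x).1.1, (t0 x).1.2.1) = s(x.1.1, x.1.2.1) := Sym2.eq_swap
    simp only [this]
  m2 := fun x => by rw [t2v, t2w]
  h0 := fun x => rfl
  h1 := fun x => by rw [t1f]
  u1 := fun x hx => by
    simp only [decide_eq_true_eq, decide_eq_false_iff_not] at hx ⊢
    rw [t1v]
    intro h
    refine hM.2.1.2 _ hx _ h ?_ x.1.1 (by simp) (by simp)
    intro e
    rw [Sym2.congr_right] at e
    exact t1w x e.symm
  u2 := fun x hx => by
    simp only [decide_eq_true_eq, decide_eq_false_iff_not] at hx ⊢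
    rw [t1v, t2v]
    intro h
    refine hM.2.1.2 _ hx _ h ?_ x.1.1 (by simp) (by simp)
    intro e
    rw [Sym2.congr_right] at e
    have := t1w (t2 x)
    rw [t2w] at this
    exact this e.symm
  u3 := fun x => by
    simp only [decide_eq_true_eq]
    obtain ⟨e, he, hv⟩ := hM.2.2 x.1.1
    obtain ⟨w, rfl⟩ := hv
    have a0 := hM.1 _ he
    rw [SimpleGraph.mem_edgeSet] at a0
    have a1 := flag_adj x
    have a2 := flag_adj (t1 x)
    rw [t1v] at a2
    have a3 := flag_adj (t1 (t2 x))
    rw [t1v, t2v] at a3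
    have n13 : x.1.2.1 ≠ (t1 (t2 x)).1.2.1 := by
      have := t1w (t2 x); rw [t2w] at this; exact this.symm
    rw [t1v, t1v, t2v]
    rcases cubic_nbr hF.cubic a1 a2 a3 (t1w x).symm n13 (w12 hF.cubic x).symm a0 with h | h | h
    · left; rwa [← h]
    · right; left; rwa [← h]
    · right; right; rwa [← h]
  h3 := fun x hx => by
    simp only [decide_eq_true_eq, decide_eq_false_iff_not] at hx ⊢
    intro h
    have d := h2 _ hx _ h (t2f x).symm
    rw [Finset.disjoint_left] at d
    refine d (mem_edgeVerts x.2.2 (v := x.1.1) (by simp)) (mem_edgeVerts (t2 x).2.2 ?_)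
    rw [t2v]; simp
  hm := fun x hx => by
    simp only [decide_eq_true_eq] at hx ⊢
    by_contra hc
    push Not at hc
    rw [t1v] at hc
    obtain ⟨u, hu, hu0, hu1⟩ := cycU P x.2.1 x.2.2
    have h6 := (h1 _ hx).2
    have hcard := h3 _ hx
    have n0 : s(u 0, u 1) ∉ M := by rw [hu0, hu1]; exact hc.1
    have n5 : s(u (-1), u 0) ∉ M := by
      have : u (-1) = (t1 x).1.2.1 := by
        have k : s(x.1.1, u (-1)) ∈ x.1.2.2 := by
          rw [← hu0]; exact (hu.nbr 0 _).2 (Or.inr rfl)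
        rcases t1u x _ k with k | k
        · exfalso
          rw [← hu1, hu.eq, h6] at k
          omega
        · exact k
      rw [this, hu0, Sym2.eq_swap]; exact hc.2
    have one : ∀ i : ℤ, s(u i, u (i + 1)) ∈ M → s(u (i + 1), u (i + 2)) ∉ M := by
      intro i k1 k2
      refine hM.2.1.2 _ k1 _ k2 ?_ (u (i + 1)) (by simp) (by simp)
      intro e
      rw [Sym2.eq_swap, Sym2.congr_right, hu.eq, h6] at e
      omega
    have per : ∀ i : ℤ, u i = u (i % 6) := by
      intro i
      rw [hu.eq, h6]; push_cast; omega
    have sub : (x.1.2.2 ∩ M) ⊆ {if s(u 1, u 2) ∈ M then s(u 1, u 2) else s(u 2, u 3),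
        if s(u 3, u 4) ∈ M then s(u 3, u 4) else s(u 4, u 5)} := by
      intro e he
      rw [Finset.mem_inter, hu.mem] at he
      obtain ⟨⟨i, rfl⟩, he⟩ := he
      rw [per i, per (i + 1)] at he ⊢
      have o1 := one 1
      have o3 := one 3
      have p6 : u 0 = u 6 := per 6 ▸ rfl
      have pm : u (-1) = u 5 := per (-1)
      norm_num at o1 o3
      have hi : i % 6 = 0 ∨ i % 6 = 1 ∨ i % 6 = 2 ∨ i % 6 = 3 ∨ i % 6 = 4 ∨ i % 6 = 5 := by omega
      rcases hi with h | h | h | h | h | h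
      · rw [h, show (i + 1) % 6 = 1 by omega] at he
        exact absurd he n0
      · rw [h, show (i + 1) % 6 = 2 by omega] at he ⊢
        simp [he]
      · rw [h, show (i + 1) % 6 = 3 by omega] at he ⊢
        have : s(u 1, u 2) ∉ M := fun k => o1 k he
        simp [this]
      · rw [h, show (i + 1) % 6 = 4 by omega] at he ⊢
        simp [he]
      · rw [h, show (i + 1) % 6 = 5 by omega] at he ⊢
        have : s(u 3, u 4) ∉ M := fun k => o3 k he
        simp [this]
      · rw [h, show (i + 1) % 6 = 0 by omega, ← pm] at he
        exact absurd he n5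
    have := Finset.card_le_card sub
    have h2 := Finset.card_le_two (a := if s(u 1, u 2) ∈ M then s(u 1, u 2) else s(u 2, u 3))
      (b := if s(u 3, u 4) ∈ M then s(u 3, u 4) else s(u 4, u 5))
    omega
  h6 := fun x hx => by
    simp only [decide_eq_true_eq] at hx
    exact (h1 _ hx).2

theorem pf_ex {f : Finset (Sym2 V)} (hf : f ∈ P.faces) : ∃ x : Flag P, x.1.2.2 = f := by
  obtain ⟨u, hu⟩ := cyc0 P hf
  exact ⟨⟨(u 0, u (0 + 1), f), hf, (hu.mem _).2 ⟨0, rfl⟩⟩, rfl⟩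

/-- main facts on sextet patterns -/
theorem sext_facts (hF : IsFullerene P) (hV : Fintype.card V = 60) {H : Finset (Finset (Sym2 V))}
    (hS : IsSextetPattern P H) :
    H.card ≤ 8 ∧ (H.card = 8 → ∃ c h : Flag P → Bool,
      ∃ _ : Deco (t0 (P := P)) t1 t2 (fun x => x.1.2.2.card) (fun x => x.1.2.2) c h,
      (∀ x, c x = false → htB t1 t2 c x = true → (t2 (t1 x)).1.2.2.card = 6) ∧
      (Finset.univ.filter fun x => c x = false ∧ htB t1 t2 c x = true).card = 96 ∧
      (Finset.univ.filter fun x => c x = false ∧ ¬ htB t1 t2 c x = true).card = 48) := by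
  obtain ⟨h1, h2, M, hM, h3⟩ := hS
  have T := sext_of hF h1 h2 hM h3
  obtain ⟨m1, m2⟩ := sext_main (mkFSys hF) T (fl_counts hF hV).1 (P.faces.filter fun f => f.card = 5)
    hF.pentTwelve (fun f hf => pf_ex (Finset.mem_filter.1 hf).1)
    (fun x => by simp [x.2.1])
  have hcard := card_faces_flags (P := P) H (fun f hf => (h1 f hf).1)
  have e : ∑ f ∈ H, f.card = H.card * 6 := Finset.sum_const_nat (fun f hf => (h1 f hf).2)
  rw [e] at hcard
  simp only [decide_eq_true_eq] at m1 m2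
  refine ⟨by omega, fun h8 => ?_⟩
  obtain ⟨D, c1, c2⟩ := m2 (fun x => hF.faceSize _ x.2.1) (by omega)
  refine ⟨_, _, D, ?_, c1, c2⟩
  intro x hx hh
  simp only [htB, Bool.and_eq_true] at hh
  exact T.h6 _ (D.a5 x hx hh.1 hh.2)

theorem ipr_facts (hF : IsFullerene P) (hV : Fintype.card V = 60) (hN : NoAdjacentPentagons P) :
    ∃ c h : Flag P → Bool,
      ∃ _ : Deco (t0 (P := P)) t1 t2 (fun x => x.1.2.2.card) (fun x => x.1.2.2) c h,
      (∀ x, c x = false → htB t1 t2 c x = true ∧ (t2 (t1 x)).1.2.2.card = 5) ∧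
      (Finset.univ.filter fun x => c x = false).card = 120 := by
  obtain ⟨c, h, D, k1, k2⟩ := ipr_main (mkFSys hF) (fl_counts hF hV).1 (fl_counts hF hV).2
    (fun x => hF.faceSize _ x.2.1) (fun x h5 h5' => by
      have := hN _ x.2.1 _ (t2 x).2.1 (t2f x).symm h5 h5'
      have k : s(x.1.1, x.1.2.1) ∈ x.1.2.2 ∩ (t2 x).1.2.2 := by
        rw [Finset.mem_inter]
        refine ⟨x.2.2, ?_⟩
        have := (t2 x).2.2
        rwa [t2v, t2w] at this
      rw [this] at k
      simp at k)
  exact ⟨c, h, D, k1, k2⟩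
end flags2
end FG

namespace FG
/-! ### Reading off the leaves -/
/-- identification of a contracted graph: tables, leaf relabellings, quadrangle representatives,
    and certificates `(mask, graph index, vertex labels, representatives)` -/
structure KD : Type where
  q : ℕ
  r : ℕ
  nus : List ℕ
  reps : List ℕ
  certs : List (ℕ × ℕ × ℕ × ℕ)

def inB (N m : ℕ) : Bool := Nat.ble (nat_lit 8) m && Nat.ble (Nat.succ m) N
noncomputable def chkNu (N qK rK ν tq tr : ℕ) : Bool :=
  allB (fun i => frc (Nat.add i (nat_lit 8)) fun k => frc (gt ν k) fun m =>
    inB N m && Nat.beq (gt ν (px k)) (px m) &&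
    (frc (gt qK k) fun a => inB N a && Nat.beq (gt ν a) (gt tq m)) &&
    (frc (gt rK k) fun a => inB N a && Nat.beq (Nat.succ (gt ν a)) (gt tr m))) (Nat.sub N (nat_lit 8))
noncomputable def leafF (N : ℕ) (KL : List KD) (n tq tr : ℕ) : Bool :=
  allB (fun i => !(Nat.beq (gt tr (Nat.add i (nat_lit 8))) (nat_lit 0))) (Nat.sub n (nat_lit 8)) && Nat.ble (nat_lit 9) n &&
  (Nat.ble (Nat.succ n) N || Nat.beq n N && KL.any fun K => K.nus.any fun ν => chkNu N K.q K.r ν tq tr)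

theorem allB_off {P : ℕ → Bool} {N : ℕ} {Q : ℕ → Bool} (h : allB P (N - 8) = true)
    (e : ∀ i, P i = Q (i + 8)) (k : ℕ) (h1 : 8 ≤ k) (h2 : k < N) : Q k = true := by
  have := (allB_iff _ _).1 h (k - 8) (by omega)
  rw [e, Nat.sub_add_cancel h1] at this
  exact this

theorem inB_iff (N m : ℕ) : inB N m = true ↔ 8 ≤ m ∧ m < N := by
  unfold inB
  rw [Bool.and_eq_true, Nat.ble_eq, Nat.ble_eq]; exact Iff.rfl

structure Mk {Y : Type} (p q r : Y → Y) (N qK rK : ℕ) (Ψ : ℕ → Y) : Prop where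
  pr : ∀ k, 8 ≤ k → k < N → 8 ≤ px k ∧ px k < N
  pd : ∀ k, 8 ≤ k → k < N → p (Ψ k) = Ψ (px k)
  qr : ∀ k, 8 ≤ k → k < N → 8 ≤ gt qK k ∧ gt qK k < N
  qd : ∀ k, 8 ≤ k → k < N → q (Ψ k) = Ψ (gt qK k)
  rr : ∀ k, 8 ≤ k → k < N → 8 ≤ gt rK k ∧ gt rK k < N
  rd : ∀ k, 8 ≤ k → k < N → r (Ψ k) = Ψ (gt rK k)
  surj : ∀ y, ∃ k, 8 ≤ k ∧ k < N ∧ Ψ k = y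

section leaf
variable {Y : Type} {p q r : Y → Y} {sz : Y → ℕ}

theorem leaf_mk [Fintype Y] (S : Sys Y p q r sz) {N : ℕ} (hN : Fintype.card Y = N - 8)
    (KL : List KD) {n tq tr : ℕ} {ψ : ℕ → Y} (hq : InvQ p q n tq ψ) (hr : InvR r n tr ψ)
    (h : leafF N KL n tq tr = true) : ∃ K ∈ KL, ∃ Ψ, Mk p q r N K.q K.r Ψ := by
  unfold leafF at h
  rw [Bool.and_eq_true, Bool.and_eq_true, Bool.or_eq_true] at h
  obtain ⟨⟨h1, hn⟩, h2⟩ := h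
  rw [Nat.ble_eq] at hn
  replace hn : 9 ≤ n := hn
  have hr' : ∀ k, 8 ≤ k → k < n → gt tr k ≠ 0 := by
    intro k a b
    have := allB_off (Q := fun i => !(Nat.beq (gt tr i) (nat_lit 0))) h1 (fun i => rfl) k a b
    intro e
    rw [e] at this
    exact absurd this (by decide)
  rcases h2 with h2 | h2
  · exfalso
    rw [Nat.ble_eq, Nat.succ_le_iff] at h2
    classical
    have key : ∀ y, y ∈ (Finset.Ico 8 n).image ψ := by
      have := S.trans {y | y ∈ (Finset.Ico 8 n).image ψ} ⟨ψ 8, by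
        simp only [Set.mem_ofPred_eq]
        exact Finset.mem_image_of_mem _ (by simp; omega)⟩ (by
        intro y hy
        simp only [Set.mem_ofPred_eq, Finset.mem_image, Finset.mem_Ico] at hy ⊢
        obtain ⟨k, ⟨a, b⟩, rfl⟩ := hy
        obtain ⟨_, c1, c2, c3⟩ := hr k a (hr' k a b)
        obtain ⟨d1, d2, d3⟩ := hq.qd k a b
        exact ⟨⟨_, hq.px_mem a b, (hq.pd k a b).symm⟩, ⟨_, ⟨d1, d2⟩, d3.symm⟩, ⟨_, ⟨c1, c2⟩, c3.symm⟩⟩)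
      intro y
      have k : y ∈ (Set.univ : Set Y) := trivial
      rw [← this] at k
      exact k
    have e : (Finset.Ico 8 n).image ψ = Finset.univ := by ext y; simp [key y]
    have := Finset.card_image_le (s := Finset.Ico 8 n) (f := ψ)
    rw [e, Finset.card_univ, hN, Nat.card_Ico] at this
    omega
  · rw [Bool.and_eq_true] at h2
    obtain ⟨hn', h2⟩ := h2
    have hn' := Nat.eq_of_beq_eq_true hn'
    subst hn'
    rw [List.any_eq_true] at h2
    obtain ⟨K, hK, h2⟩ := h2
    rw [List.any_eq_true] at h2
    obtain ⟨ν, _, h2⟩ := h2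
    refine ⟨K, hK, fun k => ψ (gt ν k), ?_⟩
    unfold chkNu at h2
    have h3 := allB_off (Q := fun k => inB n (gt ν k) && Nat.beq (gt ν (px k)) (px (gt ν k)) &&
      (inB n (gt K.q k) && Nat.beq (gt ν (gt K.q k)) (gt tq (gt ν k))) &&
      (inB n (gt K.r k) && Nat.beq (Nat.succ (gt ν (gt K.r k))) (gt tr (gt ν k)))) h2
      (fun i => by simp only [frc_eq])
    simp only [Bool.and_eq_true, inB_iff] at h3
    have hp : ∀ k, 8 ≤ k → k < n → 8 ≤ px k ∧ px k < n := fun k a b => hq.px_mem a b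
    have hd : ∀ k, 8 ≤ k → k < n → p (ψ (gt ν k)) = ψ (gt ν (px k)) := by
      intro k a b
      obtain ⟨⟨⟨⟨m1, m2⟩, m3⟩, _⟩, _⟩ := h3 k a b
      rw [hq.pd _ m1 m2, Nat.eq_of_beq_eq_true m3]
    have qd : ∀ k, 8 ≤ k → k < n → q (ψ (gt ν k)) = ψ (gt ν (gt K.q k)) := by
      intro k a b
      obtain ⟨⟨⟨⟨m1, m2⟩, _⟩, _, m4⟩, _⟩ := h3 k a b
      rw [(hq.qd _ m1 m2).2.2, Nat.eq_of_beq_eq_true m4]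
    have rd : ∀ k, 8 ≤ k → k < n → r (ψ (gt ν k)) = ψ (gt ν (gt K.r k)) := by
      intro k a b
      obtain ⟨⟨⟨⟨m1, m2⟩, _⟩, _⟩, _, m4⟩ := h3 k a b
      have e := Nat.eq_of_beq_eq_true m4
      rw [(hr _ m1 (hr' _ m1 m2)).2.2.2, ← e]
      rfl
    refine ⟨hp, hd, fun k a b => (h3 k a b).1.2.1, qd, fun k a b => (h3 k a b).2.1, rd, ?_⟩
    have key := S.trans {y | ∃ k, 8 ≤ k ∧ k < n ∧ ψ (gt ν k) = y} ⟨_, 8, le_rfl, hn, rfl⟩ (by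
      rintro y ⟨k, a, b, rfl⟩
      have c1 := hp k a b
      have c2 := (h3 k a b).1.2.1
      have c3 := (h3 k a b).2.1
      exact ⟨⟨_, c1.1, c1.2, (hd k a b).symm⟩, ⟨_, c2.1, c2.2, (qd k a b).symm⟩,
        ⟨_, c3.1, c3.2, (rd k a b).symm⟩⟩)
    intro y
    have k : y ∈ (Set.univ : Set Y) := trivial
    rw [← key] at k
    exact k

theorem start_mk [Fintype Y] (S : Sys Y p q r sz) {N : ℕ} (hN : Fintype.card Y = N - 8)
    (h8 : N ≤ 152) (sizes : List (ℕ × ℕ))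
    (hs : ∀ y, 4 ≤ sz y ∧ sz y ≤ 6 ∧
      ∃ kc ∈ sizes, kc.1 = sz y ∧ (Finset.univ.filter fun y' => sz y' = sz y).card ≤ kc.2)
    (KL : List KD) (y : Y) (f : ℕ)
    (h : search sizes (leafF N KL) f (8 + 2 * sz y) (addF 8 (sz y) 0) 0 [sz y] 8 = true) :
    ∃ K ∈ KL, ∃ Ψ, Mk p q r N K.q K.r Ψ := by
  have h0 : InvQ p q 8 0 (fun _ => y) :=
    ⟨le_rfl, rfl, fun a b h1 h2 => by omega, fun a h1 h2 => by omega, fun a h1 h2 => by omega,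
      fun a _ => gt_zero a⟩
  have h1 := invQ_add S h0 (by omega) y (fun a h1 h2 => by omega) (hs y).1 (hs y).2.1
  have c0 : InvC sz 8 (fun _ => y) [] := by
    intro k; simp [cntK]
  have c1 := invC_add S y h0 c0
  have r1 : InvR r (8 + 2 * sz y) 0 (ext p q 8 (fun _ => y) y) := by
    intro x _ hx; exact absurd (gt_zero x) hx
  obtain ⟨n, tq, tr, ψ, a, b, c⟩ := search_sound S (by omega) sizes (leafF N KL) hs f _ _ _ _ 8 _ h1 r1 c1
    le_rfl (by omega) h
  exact leaf_mk S hN KL a b c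
end leaf
end FG

namespace FG
/-! ### Decorations of the contracted graphs and identification of the graph -/
def stepK (qK k : ℕ) : ℕ := gt qK (px k)
def step6 (qK k : ℕ) : Bool :=
  Nat.beq (stepK qK (stepK qK (stepK qK (stepK qK (stepK qK (stepK qK k)))))) k
def step4 (qK k : ℕ) : Bool := Nat.beq (stepK qK (stepK qK (stepK qK (stepK qK k)))) k
noncomputable def setB (a m : ℕ) : ℕ := frc a fun a => Nat.lor m (Nat.shiftLeft (nat_lit 1) a)
noncomputable def orbs (qK a m : ℕ) : ℕ :=
  setB a (setB (px a) (setB (stepK qK (stepK qK a)) (setB (px (stepK qK (stepK qK a))) m)))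
noncomputable def dtree (N qK : ℕ) (leaf : ℕ → Bool) : List ℕ → ℕ → Bool
  | [], m => leaf m
  | a :: l, m => inB N a && step4 qK a && (frc (orbs qK a m) fun m' => dtree N qK leaf l m') &&
      (frc (orbs qK (gt qK a) m) fun m' => dtree N qK leaf l m')

noncomputable def isoChk (nb N qK rK m v rep : ℕ) : Bool :=
  allB (fun i => frc (Nat.add i (nat_lit 8)) fun k => frc (gt qK k) fun qk =>
    Nat.ble (Nat.succ (gt v k)) (nat_lit 60) &&
    (frc (gt rep (gt v k)) fun c => Nat.beq c k || Nat.beq c qk ||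
      (m.testBit k && Nat.beq c (gt qK (px k))) ||
      (m.testBit qk && Nat.beq c (gt qK (px qk))))) (Nat.sub N (nat_lit 8)) &&
  allB (fun a => frc (gt rep a) fun k => frc (px (gt qK k)) fun k' =>
    inB N k && !(m.testBit k) &&
    (frc (gt v (gt rK k)) fun n1 => frc (gt v (px k)) fun n2 =>
     frc (bif m.testBit (gt qK k) then gt v (gt rK k') else gt v k') fun n3 =>
     allB (fun t => frc (gt nb (Nat.add (Nat.mul (nat_lit 3) a) t)) fun b =>
      Nat.beq b n1 || Nat.beq b n2 || Nat.beq b n3) (nat_lit 3))) (nat_lit 60)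

noncomputable def dleaf (tab : ℕ → ℕ) (N : ℕ) (hexf : ℕ → Bool) (K : KD) (m : ℕ) : Bool :=
  allB (fun i => frc (Nat.add i (nat_lit 8)) fun k =>
    m.testBit k || m.testBit (gt K.q k) || hexf k) (Nat.sub N (nat_lit 8)) &&
  (!(allB (fun i => frc (Nat.add i (nat_lit 8)) fun k => !(m.testBit k && m.testBit (gt K.r k)))
      (Nat.sub N (nat_lit 8))) ||
   K.certs.any fun c => Nat.beq c.1 m && isoChk (tab c.2.1) N K.q K.r m c.2.2.1 c.2.2.2)

section iso
variable {V Y : Type} {p q r : Y → Y} {sz : Y → ℕ} {G : SimpleGraph V} {δ : Y → Bool} {φ : Y → V}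
  {N qK rK : ℕ} {Ψ : ℕ → Y}

theorem Mk.step (H : Mk p q r N qK rK Ψ) {k : ℕ} (h1 : 8 ≤ k) (h2 : k < N) :
    (8 ≤ stepK qK k ∧ stepK qK k < N) ∧ Ψ (stepK qK k) = q (p (Ψ k)) := by
  have a := H.pr k h1 h2
  refine ⟨H.qr _ a.1 a.2, ?_⟩
  rw [H.pd k h1 h2, H.qd _ a.1 a.2]; rfl

theorem Mk.iso (H : Mk p q r N qK rK Ψ) (D : Dec G p q r sz δ φ) {nb m v rep : ℕ}
    (hm : ∀ k, 8 ≤ k → k < N → δ (Ψ k) = m.testBit k)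
    (h : isoChk nb N qK rK m v rep = true) :
    ∃ g : ℕ → V, (∀ x, ∃ a, a < 60 ∧ g a = x) ∧
      ∀ a t, a < 60 → t < 3 → G.Adj (g a) (g (gt nb (3 * a + t))) := by
  unfold isoChk at h
  rw [Bool.and_eq_true] at h
  obtain ⟨h1, h2⟩ := h
  have h1 := allB_off (Q := fun k => Nat.ble (Nat.succ (gt v k)) (nat_lit 60) &&
    (Nat.beq (gt rep (gt v k)) k || Nat.beq (gt rep (gt v k)) (gt qK k) ||
      (m.testBit k && Nat.beq (gt rep (gt v k)) (gt qK (px k))) ||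
      (m.testBit (gt qK k) && Nat.beq (gt rep (gt v k)) (gt qK (px (gt qK k)))))) h1
      (fun i => by simp only [frc_eq])
  rw [allB_iff] at h2
  simp only [frc_eq, allB_iff, Bool.and_eq_true, Bool.or_eq_true, inB_iff, Nat.ble_eq] at h1 h2
  have hφ : ∀ k, 8 ≤ k → k < N → φ (Ψ k) = φ (Ψ (gt rep (gt v k))) := by
    intro k a b
    obtain ⟨_, c⟩ := h1 k a b
    have q1 := H.qr k a b
    rcases c with ((c | c) | ⟨c1, c⟩) | ⟨c1, c⟩
    · rw [Nat.eq_of_beq_eq_true c]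
    · rw [Nat.eq_of_beq_eq_true c, ← H.qd k a b, D.fq]
    · rw [Nat.eq_of_beq_eq_true c]
      have := (H.step a b).2
      unfold stepK at this
      rw [this, D.fq, D.fp]
      rw [hm k a b, c1]
    · rw [Nat.eq_of_beq_eq_true c]
      have := (H.step q1.1 q1.2).2
      unfold stepK at this
      rw [this, D.fq, D.fp, ← H.qd k a b, D.fq]
      rw [hm _ q1.1 q1.2, c1]
  refine ⟨fun a => φ (Ψ (gt rep a)), ?_, ?_⟩
  · intro x
    obtain ⟨y, rfl⟩ := D.surj x
    obtain ⟨k, a, b, rfl⟩ := H.surj y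
    exact ⟨gt v k, (h1 k a b).1, (hφ k a b).symm⟩
  · intro a t ha ht
    obtain ⟨⟨⟨k1, k2⟩, k3⟩, k4⟩ := h2 a ha
    have k4 := k4 t ht
    change ((Nat.beq (gt nb (3 * a + t)) _ = true ∨ Nat.beq (gt nb (3 * a + t)) _ = true) ∨
      Nat.beq (gt nb (3 * a + t)) _ = true) at k4
    have q1 := H.qr _ k1 k2
    have p1 := H.pr _ k1 k2
    have r1 := H.rr _ k1 k2
    have p2 := H.pr _ q1.1 q1.2
    have r2 := H.rr _ p2.1 p2.2
    rcases k4 with (k4 | k4) | k4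
    · simp only [Nat.eq_of_beq_eq_true k4]
      rw [← hφ _ r1.1 r1.2, ← H.rd _ k1 k2]
      exact D.ar _
    · simp only [Nat.eq_of_beq_eq_true k4]
      rw [← hφ _ p1.1 p1.2, ← H.pd _ k1 k2]
      apply D.ap
      rw [hm _ k1 k2]; simpa using k3
    · simp only [Nat.eq_of_beq_eq_true k4]
      rw [← D.fq (Ψ (gt rep a)), H.qd _ k1 k2]
      cases hb : m.testBit (gt qK (gt rep a)) with
      | true =>
        simp only [cond_true]
        rw [← hφ _ r2.1 r2.2, ← H.rd _ p2.1 p2.2, ← D.fp, H.pd _ q1.1 q1.2]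
        · exact D.ar _
        · rw [hm _ q1.1 q1.2, hb]
      | false =>
        simp only [cond_false]
        rw [← hφ _ p2.1 p2.2, ← H.pd _ q1.1 q1.2]
        apply D.ap
        rw [hm _ q1.1 q1.2, hb]

theorem testBit_setB (a m k : ℕ) : (setB a m).testBit k = (m.testBit k || decide (k = a)) := by
  unfold setB
  rw [frc_eq]
  change (m ||| 1 <<< a).testBit k = _
  rw [Nat.testBit_or, Nat.one_shiftLeft, Nat.testBit_two_pow]
  congr 1
  simp [eq_comm]

theorem Mk.orb (H : Mk p q r N qK rK Ψ) (S : Sys Y p q r sz) (D : Dec G p q r sz δ φ) {a m : ℕ}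
    (h1 : 8 ≤ a) (h2 : a < N) (h4 : sz (Ψ a) = 4) (hd : δ (Ψ a) = true)
    (hm : ∀ k, 8 ≤ k → k < N → m.testBit k = true → δ (Ψ k) = true) :
    ∀ k, 8 ≤ k → k < N → (orbs qK a m).testBit k = true → δ (Ψ k) = true := by
  intro k k1 k2 h
  unfold orbs at h
  simp only [testBit_setB, Bool.or_eq_true, decide_eq_true_eq] at h
  have e1 := H.step h1 h2
  have e2 := H.step e1.1.1 e1.1.2
  have d2 : δ (Ψ (stepK qK (stepK qK a))) = true := by
    rw [e2.2, e1.2, D.dq, D.dp, D.dq, D.dp, hd]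
    · rfl
    · rw [S.szp, h4]
    · rw [S.szp, S.szq, S.szp, h4]
  rcases h with (((h | rfl) | rfl) | rfl) | rfl
  · exact hm k k1 k2 h
  · rw [← H.pd _ e2.1.1 e2.1.2, D.dp, d2]
  · exact d2
  · rw [← H.pd _ h1 h2, D.dp, hd]
  · exact hd

theorem Mk.tree (H : Mk p q r N qK rK Ψ) (S : Sys Y p q r sz) (D : Dec G p q r sz δ φ)
    (h4 : ∀ k, 8 ≤ k → k < N → step4 qK k = true → sz (Ψ k) = 4) (leaf : ℕ → Bool) (l : List ℕ) :
    ∀ m, (∀ k, 8 ≤ k → k < N → m.testBit k = true → δ (Ψ k) = true) → dtree N qK leaf l m = true →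
      ∃ m, (∀ k, 8 ≤ k → k < N → m.testBit k = true → δ (Ψ k) = true) ∧ leaf m = true := by
  induction l with
  | nil => intro m hm h; exact ⟨m, hm, h⟩
  | cons a l ih =>
    intro m hm h
    simp only [dtree, Bool.and_eq_true, inB_iff, frc_eq] at h
    obtain ⟨⟨⟨⟨a1, a2⟩, a3⟩, a4⟩, a5⟩ := h
    have z := h4 a a1 a2 a3
    cases hd : δ (Ψ a) with
    | true => exact ih _ (H.orb S D a1 a2 z hd hm) a4
    | false =>
      have b := H.qr a a1 a2
      have c := H.qd a a1 a2
      exact ih _ (H.orb S D b.1 b.2 (by rw [← c, S.szq, z]) (by rw [← c, D.dq _ z, hd]; rfl) hm) a5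

theorem Mk.all (K : KD) (H : Mk p q r N K.q K.r Ψ) (S : Sys Y p q r sz) (D : Dec G p q r sz δ φ)
    (h4 : ∀ k, 8 ≤ k → k < N → step4 K.q k = true → sz (Ψ k) = 4)
    (hexf : ℕ → Bool) (hx : ∀ k, 8 ≤ k → k < N → hexf k = true → δ (Ψ k) = false)
    (tab : ℕ → ℕ) (h : dtree N K.q (dleaf tab N hexf K) K.reps 0 = true) :
    ∃ c ∈ K.certs, ∃ g : ℕ → V, (∀ x, ∃ a, a < 60 ∧ g a = x) ∧
      ∀ a t, a < 60 → t < 3 → G.Adj (g a) (g (gt (tab c.2.1) (3 * a + t))) := by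
  obtain ⟨m, hm, h⟩ := H.tree S D h4 _ _ 0 (by simp) h
  unfold dleaf at h
  rw [Bool.and_eq_true, Bool.or_eq_true] at h
  obtain ⟨h1, h2⟩ := h
  have h1 := allB_off (Q := fun k => m.testBit k || m.testBit (gt K.q k) || hexf k) h1
    (fun i => by simp only [frc_eq])
  have hm' : ∀ k, 8 ≤ k → k < N → δ (Ψ k) = m.testBit k := by
    intro k a b
    cases hb : m.testBit k with
    | true => exact hm k a b hb
    | false =>
      have := h1 k a b
      simp only [hb, Bool.false_or, Bool.or_eq_true] at this
      rcases this with h | h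
      · by_cases hz : sz (Ψ k) = 4
        · have c := H.qr k a b
          have := hm _ c.1 c.2 h
          rw [← H.qd k a b, D.dq _ hz] at this
          simpa using this
        · exact D.dh _ hz
      · exact hx k a b h
  rcases h2 with h2 | h2
  · exfalso
    rw [Bool.not_eq_true', ← Bool.not_eq_true, allB_iff] at h2
    apply h2
    intro i hi
    have hi : i < N - 8 := hi
    rw [frc_eq]
    have b1 : 8 ≤ i + 8 := by omega
    have b2 : i + 8 < N := by omega
    change (!(m.testBit (i + 8) && m.testBit (gt K.r (i + 8)))) = true
    have c := H.rr _ b1 b2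
    rw [← hm' _ b1 b2, ← hm' _ c.1 c.2, ← H.rd _ b1 b2]
    cases hb : δ (Ψ (i + 8)) with
    | true => rw [D.dr _ hb]; rfl
    | false => rfl
  · rw [List.any_eq_true] at h2
    obtain ⟨c, hc, h2⟩ := h2
    rw [Bool.and_eq_true] at h2
    exact ⟨c, hc, H.iso D hm' h2.2⟩

theorem Mk.altS_eq (H : Mk p q r N qK rK Ψ) {k : ℕ} (h1 : 8 ≤ k) (h2 : k < N) :
    (step4 qK k = true → altS p q (Ψ k) 8 = Ψ k) ∧ (step6 qK k = true → altS p q (Ψ k) 12 = Ψ k) := by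
  have e1 := H.step h1 h2
  have e2 := H.step e1.1.1 e1.1.2
  have e3 := H.step e2.1.1 e2.1.2
  have e4 := H.step e3.1.1 e3.1.2
  have e5 := H.step e4.1.1 e4.1.2
  have e6 := H.step e5.1.1 e5.1.2
  constructor
  · intro h
    have h := Nat.eq_of_beq_eq_true h
    rw [h, e3.2, e2.2, e1.2] at e4
    exact e4.2.symm
  · intro h
    have h := Nat.eq_of_beq_eq_true h
    rw [h, e5.2, e4.2, e3.2, e2.2, e1.2] at e6
    exact e6.2.symm

theorem Mk.four (H : Mk p q r N qK rK Ψ) (S : Sys Y p q r sz) (h46 : ∀ y, 4 ≤ sz y)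
    (k : ℕ) (h1 : 8 ≤ k) (h2 : k < N) (h : step4 qK k = true) : sz (Ψ k) = 4 := by
  rcases Nat.eq_or_lt_of_le (h46 (Ψ k)) with h3 | h3
  · exact h3.symm
  · exfalso
    exact S.inj (Ψ k) 0 8 (by omega) (by omega) ((H.altS_eq h1 h2).1 h).symm

theorem Mk.six (H : Mk p q r N qK rK Ψ) (S : Sys Y p q r sz)
    (k : ℕ) (h1 : 8 ≤ k) (h2 : k < N) (h : step6 qK k = true) : sz (Ψ k) ≠ 4 := by
  intro h4
  have e := (H.altS_eq h1 h2).2 h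
  have c := S.close (Ψ k)
  rw [h4] at c
  have : altS p q (Ψ k) 12 = q (p (q (p (altS p q (Ψ k) 8)))) := rfl
  rw [this, show altS p q (Ψ k) 8 = Ψ k from c] at e
  exact S.inj (Ψ k) 0 4 (by omega) (by omega) e.symm

end iso
end FG

namespace FG
section top
variable {V : Type} [Fintype V] [DecidableEq V] {P : PlaneGraph V}

theorem card_YT {X : Type} [Fintype X] (c : X → Bool) (Q : X → Prop) [DecidablePred Q] :
    (Finset.univ.filter fun y : YT c => Q y.1).card =
      (Finset.univ.filter fun x => c x = false ∧ Q x).card := by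
  classical
  apply Finset.card_bij (fun y _ => y.1)
  · intro y hy; simp at hy ⊢; exact ⟨y.2, hy⟩
  · intro a _ b _ h; exact Subtype.ext h
  · intro x hx
    simp only [Finset.mem_filter, Finset.mem_univ, true_and] at hx
    exact ⟨⟨x, hx.1⟩, by simpa using hx.2, rfl⟩

/-- outcome of the identification -/
def Ident (P : PlaneGraph V) (tab : ℕ → ℕ) (KL : List KD) : Prop :=
  ∃ K ∈ KL, ∃ c ∈ K.certs, ∃ g : ℕ → V, (∀ x, ∃ a, a < 60 ∧ g a = x) ∧
      ∀ a t, a < 60 → t < 3 → P.graph.Adj (g a) (g (gt (tab c.2.1) (3 * a + t)))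

theorem sext_ident (hF : IsFullerene P) (hV : Fintype.card V = 60) {H : Finset (Finset (Sym2 V))}
    (hS : IsSextetPattern P H) (h8 : H.card = 8) (KL : List KD) (tab : ℕ → ℕ)
    (h1 : search [(4, 48), (6, 96)] (leafF 152 KL) 500 16 (addF 8 4 0) 0 [4] 8 = true)
    (h2 : ∀ K ∈ KL, dtree 152 K.q (dleaf tab 152 (step6 K.q) K) K.reps 0 = true) :
    Ident P tab KL := by
  classical
  obtain ⟨c, h, D, k0, k1, k2⟩ := (sext_facts hF hV hS).2 h8
  have S := mkSys (mkFSys hF) D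
  have D' := mkDec (mkFSys hF) D
  have z6 : ∀ y : YT c, htB t1 t2 c y.1 = true →
      sY t1 t2 (fun x : Flag P => x.1.2.2.card) c y = 6 := by
    intro y hy; unfold sY; rw [if_pos hy]; exact k0 y.1 y.2 hy
  have z4 : ∀ y : YT c, ¬ htB t1 t2 c y.1 = true →
      sY t1 t2 (fun x : Flag P => x.1.2.2.card) c y = 4 := by
    intro y hy; unfold sY; rw [if_neg hy]
  have n6 : (Finset.univ.filter fun y : YT c =>
      sY t1 t2 (fun x : Flag P => x.1.2.2.card) c y = 6).card = 96 := by
    refine Eq.trans (congrArg Finset.card (Finset.filter_congr ?_))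
      ((card_YT c (fun x => htB t1 t2 c x = true)).trans k1)
    intro y _
    by_cases hy : htB t1 t2 c y.1 = true
    · simp [hy, z6 y hy]
    · simp [hy, z4 y hy]
  have n4 : (Finset.univ.filter fun y : YT c =>
      sY t1 t2 (fun x : Flag P => x.1.2.2.card) c y = 4).card = 48 := by
    refine Eq.trans (congrArg Finset.card (Finset.filter_congr ?_))
      ((card_YT c (fun x => ¬ htB t1 t2 c x = true)).trans k2)
    intro y _
    by_cases hy : htB t1 t2 c y.1 = true
    · simp [hy, z6 y hy]
    · simp [hy, z4 y hy]
  have h46 : ∀ y : YT c, sY t1 t2 (fun x : Flag P => x.1.2.2.card) c y = 4 ∨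
      sY t1 t2 (fun x : Flag P => x.1.2.2.card) c y = 6 := by
    intro y
    by_cases hy : htB t1 t2 c y.1 = true
    · right; exact z6 y hy
    · left; exact z4 y hy
  have ncard : Fintype.card (YT c) = 152 - 8 := by
    have := Finset.card_filter_add_card_filter_not (s := (Finset.univ : Finset (YT c)))
      (fun y => sY t1 t2 (fun x : Flag P => x.1.2.2.card) c y = 6)
    have e : (Finset.univ.filter fun y : YT c =>
      ¬ sY t1 t2 (fun x : Flag P => x.1.2.2.card) c y = 6) = (Finset.univ.filter fun y : YT c =>
      sY t1 t2 (fun x : Flag P => x.1.2.2.card) c y = 4) := by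
      ext y
      simp only [Finset.mem_filter, Finset.mem_univ, true_and]
      have := h46 y
      omega
    rw [e, n6, n4, Finset.card_univ] at this
    omega
  have : (Finset.univ.filter fun y : YT c =>
      sY t1 t2 (fun x : Flag P => x.1.2.2.card) c y = 4).Nonempty := by
    rw [← Finset.card_pos, n4]; norm_num
  obtain ⟨y, hy⟩ := this
  rw [Finset.mem_filter] at hy
  obtain ⟨K, hK, Ψ, HM⟩ := start_mk S ncard (by omega) [(4, 48), (6, 96)] (by
    intro y
    rcases h46 y with e | e
    · rw [e]; exact ⟨by omega, by omega, (4, 48), by simp, rfl, n4.le⟩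
    · rw [e]; exact ⟨by omega, by omega, (6, 96), by simp, rfl, n6.le⟩) KL y 500 (by rw [hy.2]; exact h1)
  obtain ⟨ct, hc, g, g1, g2⟩ := HM.all K S D' (HM.four S (fun y => by have := h46 y; omega)) (step6 K.q)
    (fun k a b e => D'.dh _ (HM.six S k a b e)) tab (h2 K hK)
  exact ⟨K, hK, ct, hc, g, g1, g2⟩

theorem ipr_ident (hF : IsFullerene P) (hV : Fintype.card V = 60) (hN : NoAdjacentPentagons P)
    (KL : List KD) (tab : ℕ → ℕ)
    (h1 : search [(5, 120)] (leafF 128 KL) 500 18 (addF 8 5 0) 0 [5] 8 = true)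
    (h2 : ∀ K ∈ KL, dtree 128 K.q (dleaf tab 128 (fun _ => true) K) K.reps 0 = true) :
    Ident P tab KL := by
  classical
  obtain ⟨c, h, D, k0, k1⟩ := ipr_facts hF hV hN
  have S := mkSys (mkFSys hF) D
  have D' := mkDec (mkFSys hF) D
  have z5 : ∀ y : YT c, sY t1 t2 (fun x : Flag P => x.1.2.2.card) c y = 5 := by
    intro y; unfold sY; rw [if_pos (k0 y.1 y.2).1]; exact (k0 y.1 y.2).2
  have ncard : Fintype.card (YT c) = 128 - 8 := by
    have := card_YT c (fun _ => True)
    simp only [and_true, k1, Finset.filter_true, Finset.card_univ] at this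
    omega
  have : Nonempty (YT c) := by
    rw [← Fintype.card_pos_iff]; omega
  obtain ⟨y⟩ := this
  obtain ⟨K, hK, Ψ, HM⟩ := start_mk S ncard (by omega) [(5, 120)] (by
    intro y
    rw [z5]
    refine ⟨by omega, by omega, (5, 120), by simp, rfl, ?_⟩
    refine (Finset.card_le_univ _).trans ?_
    omega) KL y 500 (by rw [z5]; exact h1)
  obtain ⟨ct, hc, g, g1, g2⟩ := HM.all K S D' (HM.four S (fun y => by have := z5 y; omega)) (fun _ => true)
    (fun k a b e => D'.dh _ (by rw [z5]; omega)) tab (h2 K hK)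
  exact ⟨K, hK, ct, hc, g, g1, g2⟩
end top
end FG

namespace FG
/-! ### Data -/
structure GD : Type where
  nb : ℕ
  fs : List (List ℕ)
  hx : List (List ℕ)
  mt : ℕ
  c0 : ℕ
instance : Inhabited GD := ⟨⟨0, [], [], 0, 0⟩⟩

def gd0 : GD where
  nb := 6918675377831902387493392517788240595703311033633454848720166320020437584037558922569632652689450161468090617824493400322146731139074344634102515959996145475527756397217128734498058354327649464972890936739522797512925563255300221246061472775725512731530149967739033468707774364906037746189840284250729237463550484727136706537696203305345696370291320556821722997378822166913242796295644314424407172665244394706168483188373425957896705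
  fs := [[0,1,3,6,2], [1,0,4,8,5], [0,2,7,10,4], [3,1,5,11,9],
    [2,6,12,16,13,7], [6,3,9,15,18,12], [5,8,14,21,19,11], [4,10,17,20,14,8],
    [9,11,19,23,15], [7,13,22,17,10], [12,18,25,28,24,16], [13,16,24,31,29,22],
    [14,20,26,32,27,21], [18,15,23,30,33,25], [19,21,27,35,30,23], [17,22,29,34,26,20],
    [24,28,36,40,37,31], [25,33,39,42,36,28], [27,32,38,45,43,35], [29,31,37,46,41,34],
    [26,34,41,44,38,32], [33,30,35,43,47,39], [36,42,49,53,48,40], [37,40,48,52,46],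
    [38,44,50,55,51,45], [39,47,54,56,49,42], [43,45,51,54,47], [41,46,52,57,50,44],
    [48,53,58,57,52], [49,56,59,58,53], [51,55,59,56,54], [50,57,58,59,55]]
  hx := [[2,6,12,16,13,7], [5,8,14,21,19,11], [18,15,23,30,33,25], [17,22,29,34,26,20],
    [24,28,36,40,37,31], [27,32,38,45,43,35], [39,47,54,56,49,42], [41,46,52,57,50,44]]
  mt := 710091283058269771003775501232806365057994154610088885374854609030108299148369121851549589911320597402258431120316440507933950558438807063363585
  c0 := 73452533465453656919615306689985462730375426571739222297353349790617848683042808040899713628117489507725457915700221755802210677123267286009350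

def gd1 : GD where
  nb := 6919141400382037022820298730777377674423257258933272476312353128946664322496889606430670743660398313837568164839085647886561780449305715715716437598841285303306516819641325996639797352711586821502631791873293090008327359514691736187302340424758710212805550300742191190784583379116046069412942081654940196918593432507713999778518655463499872017562455121620140146372779723499965612920336337286473298920101883202358722686052989264986625
  fs := [[0,1,3,6,2], [1,0,4,8,5], [0,2,7,10,4], [3,1,5,11,9],
    [2,6,12,16,13,7], [6,3,9,15,18,12], [5,8,14,21,19,11], [4,10,17,20,14,8],
    [9,11,19,23,15], [7,13,22,17,10], [12,18,25,28,24,16], [13,16,24,31,29,22],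
    [14,20,26,32,27,21], [18,15,23,30,33,25], [19,21,27,35,30,23], [17,22,29,34,26,20],
    [24,28,36,40,37,31], [25,33,39,42,36,28], [27,32,38,45,43,35], [29,31,37,46,41,34],
    [26,34,41,44,38,32], [33,30,35,43,47,39], [36,42,49,48,40], [37,40,48,54,52,46],
    [38,44,50,51,45], [39,47,53,55,49,42], [43,45,51,57,53,47], [41,46,52,56,50,44],
    [48,49,55,58,54], [51,50,56,59,57], [52,54,58,59,56], [53,57,59,58,55]]
  hx := [[2,6,12,16,13,7], [5,8,14,21,19,11], [18,15,23,30,33,25], [17,22,29,34,26,20],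
    [24,28,36,40,37,31], [27,32,38,45,43,35], [39,47,53,55,49,42], [41,46,52,56,50,44]]
  mt := 710091095539468907933384880694978141399716129738480944534786646183270816221320647543876276680603261583064280633023145078318679997285162558029825
  c0 := 73452533465453569935231894067188134003769087905612364914173986931927002900659008608204655414912580908443649718262097737212767975932959941461510

def gd2 : GD where
  nb := 6560762749419877529911628027472115055546201642300099222861367730288427440108927079719515234967838413125987499581389046012287701160151461904833021695454609938031044551791334065894638002617048726126673899370930664343011635337825396685006304084045605161066676785965991361464884572961636562931308216083743339083672326278733298827573343789682390339249618451964544950820108539523500842642395342015455826429020262607265196832852218948616705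
  fs := [[0,1,3,6,2], [1,0,4,8,5], [0,2,7,13,10,4], [3,1,5,11,14,9],
    [2,6,12,15,7], [6,3,9,17,19,12], [5,8,16,20,11], [4,10,18,22,16,8],
    [9,14,23,29,25,17], [7,15,24,26,21,13], [10,13,21,31,27,18], [12,19,28,24,15],
    [14,11,20,30,33,23], [16,22,32,37,30,20], [19,17,25,34,38,28], [21,26,35,42,40,31],
    [18,27,36,32,22], [25,29,39,48,43,34], [23,33,41,44,39,29], [24,28,38,45,35,26],
    [27,31,40,49,46,36], [33,30,37,47,41], [32,36,46,51,47,37], [38,34,43,52,45],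
    [39,44,53,57,54,48], [35,45,52,56,50,42], [40,42,50,58,55,49], [43,48,54,56,52],
    [41,47,51,59,53,44], [46,49,55,59,51], [50,56,54,57,58], [53,59,55,58,57]]
  hx := [[6,3,9,17,19,12], [4,10,18,22,16,8], [7,15,24,26,21,13], [14,11,20,30,33,23],
    [25,29,39,48,43,34], [27,31,40,49,46,36], [35,45,52,56,50,42], [41,47,51,59,53,44]]
  mt := 624540805432659915201520282457414901548831416875224025486898270475139676387772955027701856206373725861756126123014761206343497307068730020201730
  c0 := 48968604710839007178338444070229983020323332510854915600414212677233064316936120488138390959350402600143371909681840088482091494003674498466820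

def gd3 : GD where
  nb := 6918675377748785952955025836646363780820471767095301011136169014930451318099026059847956723801127633693627065140725915658117755115211549247063792503239459326250616692136786084855360924039689534525610558608394440879755130424653305839703735127578837485507750829370415276628915586881430471201808923098279022271178748922716900251789473030524962185403678789138397733264807812514454944467474572587881287363647756151503061123225286846185985
  fs := [[0,1,3,6,2], [1,0,4,8,5], [0,2,7,13,10,4], [3,1,5,11,14,9],
    [2,6,12,15,7], [6,3,9,17,19,12], [5,8,16,20,11], [4,10,18,22,16,8],
    [9,14,23,25,17], [7,15,24,26,21,13], [10,13,21,30,27,18], [12,19,28,33,24,15],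
    [14,11,20,29,32,23], [16,22,31,37,29,20], [19,17,25,34,38,28], [21,26,35,39,30],
    [18,27,36,31,22], [25,23,32,40,42,34], [24,33,41,43,35,26], [27,30,39,47,44,36],
    [28,38,46,48,41,33], [32,29,37,45,49,40], [31,36,44,50,45,37], [38,34,42,51,46],
    [35,43,52,53,47,39], [41,48,54,58,52,43], [42,40,49,55,57,51], [44,47,53,56,50],
    [45,50,56,59,55,49], [46,51,57,54,48], [52,58,59,56,53], [54,57,55,59,58]]
  hx := [[6,3,9,17,19,12], [4,10,18,22,16,8], [7,15,24,26,21,13], [14,11,20,29,32,23],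
    [28,38,46,48,41,33], [31,36,44,50,45,37], [35,43,52,53,47,39], [42,40,49,55,57,51]]
  mt := 685464269553573025473132393557224207131585225995532737795565776505496682814731076945446862782536904007930671909386797137722757663257635709781250
  c0 := 48968604705160665953568392256424992352113526567852576509314620571796374626569751567172212323467080821929770914210961414197632978043968346653700

def gd4 : GD where
  nb := 6560764562737408129861347651672926677394072477061206263468102945933413592103793414747348334922348065358389639429373458470518751655008821321591939652935464706041280068284325610691686097694312252995929091358326706602800283197619478566556365122345392689254984679959381048423327868758312140980119759603059448961080975836126975274845747043601108844403389121692471176077744951534425727616979665492262089022596303458150949787327383216587265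
  fs := [[0,1,3,6,2], [1,0,4,8,5], [0,2,7,13,10,4], [3,1,5,11,14,9],
    [2,6,12,15,7], [6,3,9,17,19,12], [5,8,16,20,11], [4,10,18,22,16,8],
    [9,14,23,29,25,17], [7,15,24,26,21,13], [10,13,21,31,27,18], [12,19,28,24,15],
    [14,11,20,30,33,23], [16,22,32,30,20], [19,17,25,34,37,28], [21,26,35,42,39,31],
    [18,27,36,40,32,22], [25,29,38,47,43,34], [23,33,41,44,38,29], [24,28,37,45,35,26],
    [27,31,39,48,46,36], [33,30,32,40,49,41], [37,34,43,51,45], [38,44,52,57,54,47],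
    [35,45,51,56,50,42], [39,42,50,58,55,48], [36,46,53,49,40], [43,47,54,56,51],
    [41,49,53,59,52,44], [46,48,55,59,53], [50,56,54,57,58], [52,59,55,58,57]]
  hx := [[6,3,9,17,19,12], [4,10,18,22,16,8], [7,15,24,26,21,13], [14,11,20,30,33,23],
    [25,29,38,47,43,34], [27,31,39,48,46,36], [35,45,51,56,50,42], [41,49,53,59,52,44]]
  mt := 648929465255165528025294585888270321345871328979144083477939109963526202340903206706073721396136725208346326021056595799186703568867820870567170
  c0 := 48968604710839093487127841262668761834092158998766643585836601215974252482477459935948966999909569038310936157321870670372654627877492955022340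

def gd5 : GD where
  nb := 6918675377748785952955025836646363757933185464631595942815592161548034855556411971739046986645558578703118654873097624513823986165545002048621554149601672772114080571086543338919457575398186989454247582189229800526914211819020921772890033697408204166786112966739012344765014695684101147750133314504744416860662236570744507135274564281051095316153359957317343060680411660329404806081586072666311761428949696018481371438099775879381505
  fs := [[0,1,3,6,2], [1,0,4,8,5], [0,2,7,13,10,4], [3,1,5,11,14,9],
    [2,6,12,15,7], [6,3,9,17,19,12], [5,8,16,20,11], [4,10,18,22,16,8],
    [9,14,23,25,17], [7,15,24,26,21,13], [10,13,21,27,18], [12,19,28,32,24,15],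
    [14,11,20,29,31,23], [16,22,30,36,29,20], [19,17,25,33,37,28], [21,26,34,41,35,27],
    [18,27,35,38,30,22], [25,23,31,39,42,33], [24,32,40,43,34,26], [28,37,45,47,40,32],
    [31,29,36,44,48,39], [30,38,46,50,44,36], [37,33,42,51,45], [34,43,52,53,49,41],
    [35,41,49,46,38], [40,47,54,58,52,43], [42,39,48,55,57,51], [44,50,56,59,55,48],
    [45,51,57,54,47], [49,53,56,50,46], [52,58,59,56,53], [54,57,55,59,58]]
  hx := [[6,3,9,17,19,12], [4,10,18,22,16,8], [7,15,24,26,21,13], [14,11,20,29,31,23],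
    [28,37,45,47,40,32], [30,38,46,50,44,36], [34,43,52,53,49,41], [42,39,48,55,57,51]]
  mt := 685464269550733811706357702779524643044923150103708360224868877244787739676689917661578509993982895097825748286635124538426192258081400278746370
  c0 := 48968604705160665953568432525275334443093624778052573567546414885628833986196330122103828169242255606820129220185884897150838462682297425724420

def gd6 : GD where
  nb := 6560764562737516212015066248574720144601643693563631147048127315700472378409207140880141138567118631616985003453048693652453761482453108740490253739047466695892270547430476536863329436655195902492552501360721176613785020298428322222473771939350164363149995663665384366822458868806823535462612912948446801354306166019826865788582155605712689509316645817972886255336740444424510187924355939270589649239575424787645887583438313900737025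
  fs := [[0,1,3,6,2], [1,0,4,8,5], [0,2,7,13,10,4], [3,1,5,11,14,9],
    [2,6,12,15,7], [6,3,9,17,19,12], [5,8,16,20,11], [4,10,18,22,16,8],
    [9,14,23,29,25,17], [7,15,24,26,21,13], [10,13,21,31,27,18], [12,19,28,34,24,15],
    [14,11,20,30,33,23], [16,22,32,38,30,20], [19,17,25,35,28], [21,26,36,43,40,31],
    [18,27,37,32,22], [25,29,39,48,44,35], [23,33,41,45,39,29], [24,34,42,36,26],
    [27,31,40,49,46,37], [28,35,44,50,42,34], [33,30,38,47,41], [32,37,46,52,47,38],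
    [39,45,53,57,54,48], [36,42,50,56,51,43], [40,43,51,58,55,49], [44,48,54,56,50],
    [41,47,52,59,53,45], [46,49,55,59,52], [51,56,54,57,58], [53,59,55,58,57]]
  hx := [[6,3,9,17,19,12], [4,10,18,22,16,8], [7,15,24,26,21,13], [14,11,20,30,33,23],
    [25,29,39,48,44,35], [27,31,40,49,46,37], [36,42,50,56,51,43], [41,47,52,59,53,45]]
  mt := 636735134253654355084255076203939829035612961879703460180845389615097182711347825755717647872140336554417790770391323313533819876505598545626370
  c0 := 48968604710839006839877788049622695678062454482923652278250917295376862898080179047993071969570310826920608394074424791659629118294276008313860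

def gd7 : GD where
  nb := 6919141400381820860174948717976503313967713665348199989882447904016045030302232994887340992677889772256017242685094398876598419468133362779380532389543722686075690802399453292317296771938166061099838301035392166435585947372198616767382604137009034866648326726241756388535086905031962103108022244435289539730361522133797643228498807844831472409176104729604372907341360577359565853561421523302033593685789818551536615666004728698110465
  fs := [[0,1,3,6,2], [1,0,4,8,5], [0,2,7,13,10,4], [3,1,5,11,14,9],
    [2,6,12,15,7], [6,3,9,17,19,12], [5,8,16,20,11], [4,10,18,22,16,8],
    [9,14,23,29,25,17], [7,15,24,26,21,13], [10,13,21,31,27,18], [12,19,28,34,24,15],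
    [14,11,20,30,33,23], [16,22,32,38,30,20], [19,17,25,35,28], [21,26,36,40,31],
    [18,27,37,32,22], [25,29,39,47,43,35], [23,33,41,39,29], [24,34,42,44,36,26],
    [27,31,40,48,45,37], [28,35,43,49,42,34], [33,30,38,46,50,41], [32,37,45,51,46,38],
    [39,41,50,56,53,47], [36,44,52,54,48,40], [42,49,55,58,52,44], [43,47,53,55,49],
    [45,48,54,57,51], [46,51,57,59,56,50], [53,56,59,58,55], [52,58,59,57,54]]
  hx := [[6,3,9,17,19,12], [4,10,18,22,16,8], [7,15,24,26,21,13], [14,11,20,30,33,23],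
    [28,35,43,49,42,34], [32,37,45,51,46,38], [39,41,50,56,53,47], [36,44,52,54,48,40]]
  mt := 697707715980525309137462827399137119778510439442705709531171990297507240579182312462250739376302062430535926896320015445628945453083060189791490
  c0 := 48968603257161644894586783726682070135323516693741375335154025957625416725610187869424209555167515961221623274023985570629156768614407091782660

def gd8 : GD where
  nb := 6919137773774536773761837114513481364515463731078003474767578243606276340774968653206915655059144284825953003460357672905665561187662865569770495964410973822603407305271680011214748986655671582121246109530239017424833137801947627024694743371397638164588180754479583519102578194779959521220649975616281106031301199922628815110176357337339338235858851827751361660862732237372798570213805390594018569931035184149782937547755781051646465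
  fs := [[0,1,3,6,2], [1,0,4,8,5], [0,2,7,13,10,4], [3,1,5,11,14,9],
    [2,6,12,15,7], [6,3,9,17,19,12], [5,8,16,20,11], [4,10,18,22,16,8],
    [9,14,23,25,17], [7,15,24,26,21,13], [10,13,21,30,27,18], [12,19,28,33,24,15],
    [14,11,20,29,32,23], [16,22,31,37,29,20], [19,17,25,34,38,28], [21,26,35,39,30],
    [18,27,36,31,22], [25,23,32,40,42,34], [24,33,41,43,35,26], [27,30,39,47,44,36],
    [28,38,46,48,41,33], [32,29,37,45,49,40], [31,36,44,50,45,37], [38,34,42,51,46],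
    [35,43,52,53,47,39], [41,48,54,52,43], [42,40,49,55,57,51], [44,47,53,58,56,50],
    [45,50,56,55,49], [46,51,57,59,54,48], [52,54,59,58,53], [57,55,56,58,59]]
  hx := [[6,3,9,17,19,12], [4,10,18,22,16,8], [7,15,24,26,21,13], [14,11,20,29,32,23],
    [28,38,46,48,41,33], [31,36,44,50,45,37], [35,43,52,53,47,39], [42,40,49,55,57,51]]
  mt := 661170876482672576334991338879727097666983141467563043893259271226620953595656427702696481042053636585170555272782652375403842281320576029033730
  c0 := 48968232569412167827610482816132516188521019713992083327665978445181951744533268192301266649368752357981752401679204279611005836505424066774020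

def gd9 : GD where
  nb := 6919137773774536773761837114513481341628177428614298406447001390223859878232354565098005917903575229835444593192729381761371792237996318371328257610773187268466871184221437265278845638014169037049883133111074377071992219196315242957881041941227004845866542891848180587238677303582630197768974367022746500620784687570656421993661448587865471366608532995930306988278336085187748431827916890672449043996337124016761247862630270084841985
  fs := [[0,1,3,6,2], [1,0,4,8,5], [0,2,7,13,10,4], [3,1,5,11,14,9],
    [2,6,12,15,7], [6,3,9,17,19,12], [5,8,16,20,11], [4,10,18,22,16,8],
    [9,14,23,25,17], [7,15,24,26,21,13], [10,13,21,27,18], [12,19,28,32,24,15],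
    [14,11,20,29,31,23], [16,22,30,36,29,20], [19,17,25,33,37,28], [21,26,34,41,35,27],
    [18,27,35,38,30,22], [25,23,31,39,42,33], [24,32,40,43,34,26], [28,37,45,47,40,32],
    [31,29,36,44,48,39], [30,38,46,50,44,36], [37,33,42,51,45], [34,43,52,53,49,41],
    [35,41,49,46,38], [40,47,54,52,43], [42,39,48,55,57,51], [44,50,56,55,48],
    [45,51,57,59,54,47], [49,53,58,56,50,46], [52,54,59,58,53], [57,55,56,58,59]]
  hx := [[6,3,9,17,19,12], [4,10,18,22,16,8], [7,15,24,26,21,13], [14,11,20,29,31,23],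
    [28,37,45,47,40,32], [30,38,46,50,44,36], [34,43,52,53,49,41], [42,39,48,55,57,51]]
  mt := 661170876479833362568216648102027533580321065575738666322562371965912010457615268418828128253499627675065631650030979776107276876144340597998850
  c0 := 48968232569412167827610482816440344380278340515013872348093441096397273555067129152204078146981569002426133369825612151494337619190283352933380

def gd10 : GD where
  nb := 6919137773746867745708256319644897266118595485070037296502721391722212234208943216602479384512564177271476772778094296590061453999747082257644134729196191424795500121174472083319455448845890267179812127557625219477410621418717852105258846437595848818420962304463984783945286681519557884843868326209731107506002699565166883963575497739688568524465041390245593782624425813455428927231453640815903849365688702035981384039041916761014785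
  fs := [[0,1,3,6,2], [1,0,4,8,5], [0,2,7,13,10,4], [3,1,5,11,14,9],
    [2,6,12,15,7], [6,3,9,17,19,12], [5,8,16,20,11], [4,10,18,22,16,8],
    [9,14,23,29,25,17], [7,15,24,26,21,13], [10,13,21,31,27,18], [12,19,28,34,24,15],
    [14,11,20,30,33,23], [16,22,32,38,30,20], [19,17,25,35,28], [21,26,36,40,31],
    [18,27,37,32,22], [25,29,39,47,43,35], [23,33,41,39,29], [24,34,42,44,36,26],
    [27,31,40,48,45,37], [28,35,43,49,42,34], [33,30,38,46,50,41], [32,37,45,51,46,38],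
    [39,41,50,56,53,47], [36,44,52,54,48,40], [42,49,55,52,44], [43,47,53,58,55,49],
    [45,48,54,59,57,51], [46,51,57,56,50], [53,56,57,59,58], [52,55,58,59,54]]
  hx := [[6,3,9,17,19,12], [4,10,18,22,16,8], [7,15,24,26,21,13], [14,11,20,30,33,23],
    [28,35,43,49,42,34], [32,37,45,51,46,38], [39,41,50,56,53,47], [36,44,52,54,48,40]]
  mt := 697707715980525309137462827399137119778510439442705709531171990297507240579182312462250739376302062430535926896320015445628945453083060189791490
  c0 := 48968604710816825820785477472241510461771657236959519258130203241629993852648728486316611088659162083956592972793191083657240728167725387744260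

def gd11 : GD where
  nb := 6919137773774536768807786462791557179720421701032696912559023355608856814795674068481003602788994414077013693307180070217024019025938576938087125915131237762953759230241063242960588121888138321440232281031545961168492728028788600478347326797473634672650069879978407363781082911842617267164138236380232260496091187769111857501552214634263958111617732689325489434687768723723473043624227661751790416627903247465693715757108793880871425
  fs := [[0,1,3,6,2], [1,0,4,8,5], [0,2,7,13,10,4], [3,1,5,11,14,9],
    [2,6,12,18,15,7], [6,3,9,17,20,12], [5,8,16,25,21,11], [4,10,19,23,16,8],
    [9,14,24,27,17], [7,15,26,22,13], [10,13,22,32,29,19], [12,20,30,28,18],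
    [14,11,21,31,34,24], [15,18,28,38,36,26], [16,23,33,35,25], [20,17,27,37,40,30],
    [21,25,35,45,41,31], [22,26,36,46,42,32], [19,29,39,43,33,23], [27,24,34,44,47,37],
    [28,30,40,48,38], [29,32,42,49,39], [34,31,41,50,44], [35,33,43,51,52,45],
    [36,38,48,55,53,46], [40,37,47,54,55,48], [41,45,52,57,50], [42,46,53,58,56,49],
    [39,49,56,51,43], [47,44,50,57,59,54], [52,51,56,58,59,57], [53,55,54,59,58]]
  hx := [[0,2,7,13,10,4], [3,1,5,11,14,9], [15,18,28,38,36,26], [20,17,27,37,40,30],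
    [21,25,35,45,41,31], [19,29,39,43,33,23], [42,46,53,58,56,49], [47,44,50,57,59,54]]
  mt := 661027781559665373148899975090035756447774109257194358300088669967516281039725632992491959447718164221189839834204065876073117293443956164526850
  c0 := 24484302355419546912802025691259933828243688078101633502200808777507117941216121858315184023450009190776007795601066238282516838820580352459780

def gd12 : GD where
  nb := 6919139587092175452566869765209525996119914866460348977305837785147134210525260988056139713246043146133262470929346027057464483145521437801358849022891335731389262831131672948979048147317336663905425737501878371398753674631419898925508148031780884416409358477628163167133142682627367870872193256475316334190691143459687852212421271438298626277607169764084437392969777512620134992155555531665405023351080260818087380747672398571241985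
  fs := [[0,1,3,6,2], [1,0,4,8,5], [0,2,7,13,10,4], [3,1,5,11,14,9],
    [2,6,12,18,15,7], [6,3,9,17,20,12], [5,8,16,25,21,11], [4,10,19,23,16,8],
    [9,14,24,27,17], [7,15,26,22,13], [10,13,22,32,29,19], [12,20,30,28,18],
    [14,11,21,31,34,24], [15,18,28,38,36,26], [16,23,33,35,25], [20,17,27,37,40,30],
    [21,25,35,45,41,31], [22,26,36,46,42,32], [19,29,39,43,33,23], [27,24,34,44,47,37],
    [28,30,40,50,48,38], [29,32,42,49,39], [34,31,41,51,44], [35,33,43,52,53,45],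
    [36,38,48,54,46], [40,37,47,55,50], [41,45,53,57,51], [42,46,54,58,56,49],
    [39,49,56,52,43], [47,44,51,57,59,55], [48,50,55,59,58,54], [53,52,56,58,59,57]]
  hx := [[0,2,7,13,10,4], [3,1,5,11,14,9], [15,18,28,38,36,26], [20,17,27,37,40,30],
    [21,25,35,45,41,31], [19,29,39,43,33,23], [42,46,54,58,56,49], [47,44,51,57,59,55]]
  mt := 673269932038906075531036607291989450659911039529978226174408354512852290866014570310319580881792646844555428790091708117433595928517097459548930
  c0 := 373600804983820092163801486679542192195457283683959696651139430332817092718389584911907744132943472135246664114222474481380514875415069700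

def gd13 : GD where
  nb := 6918671751141394206590550994145930258050791039770105395179205221912490259242101883322021779022392781350098108587415385768667485773261585824492229410595599204083406311346041748522076420349830944881928073642717091611725612836667621072587791953665074400270096267948122264813973318946922162014046050824258015069385106800167090055537452393203678768509384457852826602908470002646627002500720657927332506371821447128769845546015390829904385
  fs := [[0,1,3,6,2], [1,0,4,8,5], [0,2,7,13,10,4], [3,1,5,11,14,9],
    [2,6,12,18,15,7], [6,3,9,17,20,12], [5,8,16,25,21,11], [4,10,19,23,16,8],
    [9,14,24,27,17], [7,15,26,22,13], [10,13,22,32,29,19], [12,20,30,28,18],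
    [14,11,21,31,34,24], [15,18,28,38,36,26], [16,23,33,35,25], [20,17,27,37,40,30],
    [21,25,35,45,41,31], [22,26,36,46,42,32], [19,29,39,43,33,23], [27,24,34,44,47,37],
    [28,30,40,48,38], [29,32,42,49,39], [34,31,41,50,44], [35,33,43,51,45],
    [36,38,48,54,52,46], [40,37,47,53,54,48], [41,45,51,57,56,50], [42,46,52,58,55,49],
    [39,49,55,57,51,43], [47,44,50,56,59,53], [52,54,53,59,58], [56,57,55,58,59]]
  hx := [[0,2,7,13,10,4], [3,1,5,11,14,9], [15,18,28,38,36,26], [20,17,27,37,40,30],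
    [21,25,35,45,41,31], [19,29,39,43,33,23], [42,46,52,58,55,49], [47,44,50,56,59,53]]
  mt := 648786003982627496383974794342303159265748420733079831657445713361595946081999205807006912193385366186519931412928146191904949624001835082711810
  c0 := 48968231110034110006823650345583195751078741929245141683586051496355350959940383428073923984553478016468065585721010945113766451350499219342340

def gd14 : GD where
  nb := 6918673564459032888700431511927631785002195895110424371549933665340037290530753655131828627226768642023577925892622298026224062603873799266388672723022131466038527525956857693614161623924060347575193629150530658576535923102899879099224858085035945837876539477101206542335292338953333795421470728828636950721663687524434068100771343448575543996017094928693281578628520571850778988893716308910338028767369721385012688086759876621238785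
  fs := [[0,1,3,6,2], [1,0,4,8,5], [0,2,7,13,10,4], [3,1,5,11,14,9],
    [2,6,12,18,15,7], [6,3,9,17,20,12], [5,8,16,25,21,11], [4,10,19,23,16,8],
    [9,14,24,27,17], [7,15,26,22,13], [10,13,22,32,29,19], [12,20,30,28,18],
    [14,11,21,31,34,24], [15,18,28,38,36,26], [16,23,33,35,25], [20,17,27,37,40,30],
    [21,25,35,45,41,31], [22,26,36,46,42,32], [19,29,39,43,33,23], [27,24,34,44,47,37],
    [28,30,40,50,48,38], [29,32,42,49,39], [34,31,41,51,44], [35,33,43,52,45],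
    [36,38,48,53,46], [40,37,47,54,50], [41,45,52,57,56,51], [42,46,53,58,55,49],
    [39,49,55,57,52,43], [47,44,51,56,59,54], [48,50,54,59,58,53], [56,57,55,58,59]]
  hx := [[0,2,7,13,10,4], [3,1,5,11,14,9], [15,18,28,38,36,26], [20,17,27,37,40,30],
    [21,25,35,45,41,31], [19,29,39,43,33,23], [42,46,53,58,55,49], [47,44,51,56,59,54]]
  mt := 661028155157608875875624373262837749956350881434262571238147532113498896074131183952088983915099103526780924683970424996757613527240374401106690
  c0 := 24484302355419546912796841017985618084302730530705656085173743903935661844273343687507921581619012759903073906611188635273420375338693060330500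

def gd15 : GD where
  nb := 6919137773774752933102339456827485356451616639017804028478209289443527519455783954142131226483694791589080597250757023967871708116593892709454917095953481419283970139181552744201904278306811596930877593630182627550042761549078836970673109110622770857410046417176120690451216454211583745916728434187118676513651487109730971210525070635836556645457747385128749651997225691675949840683246616307220660603207190432027498488817844085850625
  fs := [[0,1,3,6,2], [1,0,4,8,5], [0,2,7,13,10,4], [3,1,5,11,14,9],
    [2,6,12,18,15,7], [6,3,9,17,20,12], [5,8,16,25,21,11], [4,10,19,23,16,8],
    [9,14,24,31,27,17], [7,15,26,22,13], [10,13,22,33,29,19], [12,20,30,28,18],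
    [14,11,21,32,24], [15,18,28,38,36,26], [16,23,34,35,25], [20,17,27,37,40,30],
    [21,25,35,45,42,32], [22,26,36,46,43,33], [19,29,39,44,34,23], [27,31,41,47,37],
    [24,32,42,48,41,31], [28,30,40,51,49,38], [29,33,43,50,39], [35,34,44,52,53,45],
    [36,38,49,54,46], [40,37,47,55,51], [41,48,56,58,55,47], [42,45,53,56,48],
    [43,46,54,59,57,50], [39,50,57,52,44], [49,51,55,58,59,54], [53,52,57,59,58,56]]
  hx := [[0,2,7,13,10,4], [3,1,5,11,14,9], [15,18,28,38,36,26], [20,17,27,37,40,30],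
    [21,25,35,45,42,32], [19,29,39,44,34,23], [41,48,56,58,55,47], [43,46,54,59,57,50]]
  mt := 661170690406280729120813010376304065473991089732370176530655591047852864759895146111704178071177542315483435724516133084804985463772481606124290
  c0 := 373600804983818775196190143011780903650767914184494164139822672755035035927804903859374502286462474930877086418712109415948702714995803140

def gd16 : GD where
  nb := 6918669937796302657429704665690178586370082607051052631773500816381333519141258326374310723973217509678737033572889267165756207034018060041867793566765911498363462461137725554387571986094989560547323262420821862286299700519442078019079885286994154971856431747665480793792932953358362268144329078848484208170167541093244776538757005406275893756544559331824941094520205306232551589797100477918266979484009548508442494830603464467546625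
  fs := [[0,1,3,6,2], [1,0,4,8,5], [0,2,7,13,10,4], [3,1,5,11,14,9],
    [2,6,12,18,15,7], [6,3,9,17,20,12], [5,8,16,25,21,11], [4,10,19,23,16,8],
    [9,14,24,31,27,17], [7,15,26,22,13], [10,13,22,33,29,19], [12,20,30,28,18],
    [14,11,21,32,24], [15,18,28,38,36,26], [16,23,34,35,25], [20,17,27,37,40,30],
    [21,25,35,45,42,32], [22,26,36,46,43,33], [19,29,39,44,34,23], [27,31,41,47,37],
    [24,32,42,48,41,31], [28,30,40,49,38], [29,33,43,50,39], [35,34,44,51,45],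
    [36,38,49,55,52,46], [40,37,47,53,55,49], [41,48,54,58,53,47], [42,45,51,57,54,48],
    [43,46,52,59,56,50], [39,50,56,57,51,44], [52,55,53,58,59], [54,57,56,59,58]]
  hx := [[0,2,7,13,10,4], [3,1,5,11,14,9], [15,18,28,38,36,26], [20,17,27,37,40,30],
    [21,25,35,45,42,32], [19,29,39,44,34,23], [41,48,54,58,53,47], [43,46,52,59,56,50]]
  mt := 636686941913336912597926023574631454241613174065156893156532482180798766010748416391743188408608466998874106444604145167375797210226306800681730
  c0 := 48968231110034110006823650267087011531698835405440219513184388348388918434083421741183601753565929045486272844616618791239945523832850428855300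

def gd17 : GD where
  nb := 6919139587092067372075238447994576189208805019956906666000371069558548440162338042525862110288126975301573634725715353759023088274522337936255150932884472090057925529817139378400405176166596269228437304205078617968767216298382604314316132685722383523999569588609826560073353422621603342556845665078931751075550578849559550632365567602582829452862065620132116049495891428381516668017608566837448565219654281330242979537003075514663425
  fs := [[0,1,3,6,2], [1,0,4,8,10,5], [0,2,7,14,11,4], [3,1,5,12,15,9],
    [2,6,13,20,16,7], [6,3,9,18,22,13], [5,10,19,23,12], [4,11,21,17,8],
    [9,15,25,28,18], [10,8,17,27,29,19], [7,16,26,24,14], [11,14,24,34,31,21],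
    [13,22,32,30,20], [15,12,23,33,35,25], [16,20,30,40,36,26], [17,21,31,41,37,27],
    [22,18,28,38,42,32], [23,19,29,39,43,33], [24,26,36,46,44,34], [28,25,35,45,48,38],
    [29,27,37,47,39], [30,32,42,51,49,40], [31,34,44,50,41], [35,33,43,52,45],
    [36,40,49,53,46], [37,41,50,56,54,47], [42,38,48,55,51], [43,39,47,54,57,52],
    [44,46,53,58,56,50], [48,45,52,57,59,55], [49,51,55,59,58,53], [54,56,58,59,57]]
  hx := [[1,0,4,8,10,5], [2,6,13,20,16,7], [15,12,23,33,35,25], [17,21,31,41,37,27],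
    [22,18,28,38,42,32], [24,26,36,46,44,34], [43,39,47,54,57,52], [49,51,55,59,58,53]]
  mt := 673222484733701045751724417615580838218527055430935234701944364238162270100131381615487537791410196683866408645987098929135993316489296125231105
  c0 := 24484302355419546912796841017985618084302730530705656085169858506865660696625612706825930220105819381645701420560051944278023338661084590637570

def gdList : List GD := [gd0, gd1, gd2, gd3, gd4, gd5, gd6, gd7, gd8, gd9, gd10, gd11, gd12, gd13, gd14, gd15, gd16, gd17]

def tab (i : ℕ) : ℕ := (gdList.getD i default).nb

end FG

namespace FG
/-! ### Concrete graphs -/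
def adjB (T a b : ℕ) : Bool :=
  Nat.beq (gt T (3 * a)) b || Nat.beq (gt T (3 * a + 1)) b || Nat.beq (gt T (3 * a + 2)) b
def grT (T : ℕ) : SimpleGraph (Fin 60) := SimpleGraph.fromRel fun a b => adjB T a b = true
def pairs (l : List ℕ) : List (ℕ × ℕ) := l.zip (l.tail ++ l.take 1)
def inC (l : List ℕ) (a b : ℕ) : Bool :=
  (pairs l).any fun p => (Nat.beq p.1 a && Nat.beq p.2 b) || (Nat.beq p.1 b && Nat.beq p.2 a)
open Classical in
/-- the edges of a closed vertex sequence -/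
noncomputable def faceFin (l : List ℕ) : Finset (Sym2 (Fin 60)) :=
  Finset.univ.filter fun e => ∃ a b : Fin 60, e = s(a, b) ∧ inC l a b = true

noncomputable def chkNb (T : ℕ) : Bool :=
  allB (fun a => frc (gt T (3 * a)) fun x => frc (gt T (3 * a + 1)) fun y =>
    frc (gt T (3 * a + 2)) fun z =>
    Nat.ble (Nat.succ x) 60 && Nat.ble (Nat.succ y) 60 && Nat.ble (Nat.succ z) 60 &&
    !(Nat.beq x a) && !(Nat.beq y a) && !(Nat.beq z a) &&
    !(Nat.beq x y) && !(Nat.beq x z) && !(Nat.beq y z) &&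
    adjB T x a && adjB T y a && adjB T z a) 60
def chkFace (T : ℕ) (l : List ℕ) : Bool :=
  l.all (fun x => Nat.ble (Nat.succ x) 60) && decide l.Nodup &&
    (Nat.beq l.length 5 || Nat.beq l.length 6) && (pairs l).all fun p => adjB T p.1 p.2
noncomputable def chkPl (T : ℕ) (fs : List (List ℕ)) : Bool :=
  chkNb T && fs.all (chkFace T) && Nat.beq fs.length 32 &&
  Nat.beq (fs.countP fun l => Nat.beq l.length 5) 12 &&
  decide (fs.Pairwise fun l l' => ((pairs l).any fun p => !(inC l' p.1 p.2)) = true) &&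
  allB (fun a => allB (fun t => frc (gt T (3 * a + t)) fun b =>
    Nat.beq (fs.countP fun l => inC l a b) 2) 3) 60

theorem inC_comm (l : List ℕ) (a b : ℕ) : inC l a b = inC l b a := by
  unfold inC; congr 1; ext p; rw [Bool.or_comm]

theorem mem_faceFin (l : List ℕ) (a b : Fin 60) : s(a, b) ∈ faceFin l ↔ inC l a b = true := by
  unfold faceFin
  simp only [Finset.mem_filter, Finset.mem_univ, true_and]
  constructor
  · rintro ⟨x, y, h, h'⟩
    rw [Sym2.eq_iff] at h
    rcases h with ⟨rfl, rfl⟩ | ⟨rfl, rfl⟩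
    · exact h'
    · rw [inC_comm]; exact h'
  · intro h; exact ⟨a, b, rfl, h⟩

attribute [irreducible] faceFin

structure NbOK (T : ℕ) : Prop where
  lt : ∀ a t, a < 60 → t < 3 → gt T (3 * a + t) < 60
  ne : ∀ a t, a < 60 → t < 3 → gt T (3 * a + t) ≠ a
  inj : ∀ a t t', a < 60 → t < 3 → t' < 3 → gt T (3 * a + t) = gt T (3 * a + t') → t = t'
  symm : ∀ a t, a < 60 → t < 3 → adjB T (gt T (3 * a + t)) a = true

theorem chkNb_ok {T : ℕ} (h : chkNb T = true) : NbOK T := by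
  unfold chkNb at h
  rw [allB_iff] at h
  simp only [frc_eq, Bool.and_eq_true, Bool.not_eq_true', Nat.ble_eq, Nat.succ_le_iff] at h
  have key : ∀ a b, Nat.beq a b = false ↔ a ≠ b := by
    intro a b; exact Bool.eq_false_iff.trans (not_congr (by rw [Nat.beq_eq]))
  simp only [key] at h
  refine ⟨?_, ?_, ?_, ?_⟩
  · intro a t ha ht
    have := h a ha
    interval_cases t <;> (try simp only [add_zero]) <;> tauto
  · intro a t ha ht
    have := h a ha
    interval_cases t <;> (try simp only [add_zero]) <;> tauto
  · intro a t t' ha ht ht' e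
    have := h a ha
    interval_cases t <;> interval_cases t' <;> (try simp only [add_zero] at e) <;> first | rfl | (exfalso; have e' := e.symm; tauto)
  · intro a t ha ht
    have := h a ha
    interval_cases t <;> (try simp only [add_zero]) <;> tauto

theorem adjB_iff (T a b : ℕ) : adjB T a b = true ↔ ∃ t, t < 3 ∧ gt T (3 * a + t) = b := by
  unfold adjB
  simp only [Bool.or_eq_true, Nat.beq_eq]
  constructor
  · rintro ((h | h) | h)
    · exact ⟨0, by omega, h⟩
    · exact ⟨1, by omega, h⟩
    · exact ⟨2, by omega, h⟩
  · rintro ⟨t, ht, h⟩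
    interval_cases t
    · exact Or.inl (Or.inl h)
    · exact Or.inl (Or.inr h)
    · exact Or.inr h

theorem NbOK.adj {T : ℕ} (H : NbOK T) (a b : Fin 60) : (grT T).Adj a b ↔ adjB T a b = true := by
  have sy : ∀ a b : Fin 60, adjB T a b = true → adjB T b a = true := by
    intro a b h
    rw [adjB_iff] at h
    obtain ⟨t, ht, e⟩ := h
    rw [← e]; exact H.symm a t a.2 ht
  unfold grT
  rw [SimpleGraph.fromRel_adj]
  constructor
  · rintro ⟨_, h | h⟩
    · exact h
    · exact sy _ _ h
  · intro h
    refine ⟨?_, Or.inl h⟩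
    rintro rfl
    obtain ⟨t, ht, e⟩ := (adjB_iff _ _ _).1 h
    exact H.ne a t a.2 ht e

theorem NbOK.mk' {T : ℕ} (H : NbOK T) {a b : ℕ} (h : adjB T a b = true) (ha : a < 60)
    (hb : b < 60) : (grT T).Adj ⟨a, ha⟩ ⟨b, hb⟩ := (H.adj ⟨a, ha⟩ ⟨b, hb⟩).2 h

/-- the neighbours as a function -/
def NbOK.nf {T : ℕ} (H : NbOK T) (a : Fin 60) (t : Fin 3) : Fin 60 :=
  ⟨gt T (3 * a + t), H.lt a t a.2 t.2⟩

theorem NbOK.nf_adj {T : ℕ} (H : NbOK T) (a b : Fin 60) :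
    (grT T).Adj a b ↔ ∃ t, H.nf a t = b := by
  rw [H.adj, adjB_iff]
  constructor
  · rintro ⟨t, ht, h⟩; exact ⟨⟨t, ht⟩, Fin.ext h⟩
  · rintro ⟨t, rfl⟩; exact ⟨t, t.2, rfl⟩

theorem NbOK.nf_inj {T : ℕ} (H : NbOK T) (a : Fin 60) : Function.Injective (H.nf a) := by
  intro t t' h
  exact Fin.ext (H.inj a t t' a.2 t.2 t'.2 (congrArg Fin.val h))

theorem NbOK.cubic {T : ℕ} (H : NbOK T) (a : Fin 60) : ((grT T).neighborSet a).ncard = 3 := by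
  have : (grT T).neighborSet a = Set.range (H.nf a) := by
    ext b; rw [SimpleGraph.mem_neighborSet, H.nf_adj]; rfl
  rw [this, ← Set.image_univ, Set.ncard_image_of_injective _ (H.nf_inj a), Set.ncard_univ]
  simp

theorem len5 {l : List ℕ} (h : l.length = 5) : ∃ a b c d e, l = [a, b, c, d, e] := by
  match l, h with
  | [a, b, c, d, e], _ => exact ⟨a, b, c, d, e, rfl⟩
theorem len6 {l : List ℕ} (h : l.length = 6) : ∃ a b c d e f, l = [a, b, c, d, e, f] := by
  match l, h with
  | [a, b, c, d, e, f], _ => exact ⟨a, b, c, d, e, f, rfl⟩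

theorem face_ok {T : ℕ} (H : NbOK T) {l : List ℕ} (h : chkFace T l = true) :
    (l.length = 5 ∨ l.length = 6) ∧ (faceFin l).card = l.length ∧
    ∃ (v : Fin 60) (c : (grT T).Walk v v), c.IsCycle ∧ c.edges.toFinset = faceFin l := by
  unfold chkFace at h
  simp only [Bool.and_eq_true, List.all_eq_true, decide_eq_true_eq, Bool.or_eq_true, Nat.beq_eq,
    Nat.ble_eq, Nat.succ_le_iff] at h
  obtain ⟨⟨⟨h1, h2⟩, h3⟩, h4⟩ := h
  refine ⟨h3, ?_⟩
  suffices ∃ (v : Fin 60) (c : (grT T).Walk v v), c.IsCycle ∧ c.length = l.length ∧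
      c.edges.toFinset = faceFin l by
    obtain ⟨v, c, a1, a2, a3⟩ := this
    refine ⟨?_, v, c, a1, a3⟩
    rw [← a3, List.toFinset_card_of_nodup a1.edges_nodup, SimpleGraph.Walk.length_edges, a2]
  rcases h3 with h3 | h3
  · obtain ⟨a, b, c, d, e, rfl⟩ := len5 h3
    simp only [List.mem_cons, List.not_mem_nil, or_false, forall_eq_or_imp, forall_eq] at h1
    obtain ⟨ha, hb, hc, hd, he⟩ := h1
    simp only [pairs, List.tail, List.take, List.zip, List.zipWith, List.cons_append, List.nil_append, List.mem_cons, List.not_mem_nil, or_false, forall_eq_or_imp, forall_eq] at h4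
    obtain ⟨k1, k2, k3, k4, k5⟩ := h4
    have j1 := H.mk' k1 ha hb
    have j2 := H.mk' k2 hb hc
    have j3 := H.mk' k3 hc hd
    have j4 := H.mk' k4 hd he
    have j5 := H.mk' k5 he ha
    refine ⟨⟨a, ha⟩, .cons j1 (.cons j2
      (.cons j3 (.cons j4
      (.cons j5 .nil)))), ?_, rfl, ?_⟩
    · rw [SimpleGraph.Walk.cons_isCycle_iff]
      simp only [List.nodup_cons, List.mem_cons, List.not_mem_nil, or_false, not_or] at h2
      simp [SimpleGraph.Walk.isPath_def]
      grind
    · ext x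
      induction x using Sym2.ind with | _ x y
      rw [mem_faceFin]
      simp [inC, pairs, Fin.ext_iff]
      grind
  · obtain ⟨a, b, c, d, e, f, rfl⟩ := len6 h3
    simp only [List.mem_cons, List.not_mem_nil, or_false, forall_eq_or_imp, forall_eq] at h1
    obtain ⟨ha, hb, hc, hd, he, hf⟩ := h1
    simp only [pairs, List.tail, List.take, List.zip, List.zipWith, List.cons_append, List.nil_append, List.mem_cons, List.not_mem_nil, or_false, forall_eq_or_imp, forall_eq] at h4
    obtain ⟨k1, k2, k3, k4, k5, k6⟩ := h4
    have j1 := H.mk' k1 ha hb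
    have j2 := H.mk' k2 hb hc
    have j3 := H.mk' k3 hc hd
    have j4 := H.mk' k4 hd he
    have j5 := H.mk' k5 he hf
    have j6 := H.mk' k6 hf ha
    refine ⟨⟨a, ha⟩, .cons j1 (.cons j2
      (.cons j3 (.cons j4
      (.cons j5 (.cons j6 .nil))))), ?_, rfl, ?_⟩
    · rw [SimpleGraph.Walk.cons_isCycle_iff]
      simp only [List.nodup_cons, List.mem_cons, List.not_mem_nil, or_false, not_or] at h2
      simp [SimpleGraph.Walk.isPath_def]
      grind
    · ext x
      induction x using Sym2.ind with | _ x y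
      rw [mem_faceFin]
      simp [inC, pairs, Fin.ext_iff]
      grind

end FG

namespace FG

theorem chkPl_ok {T : ℕ} {fs : List (List ℕ)} (h : chkPl T fs = true) :
    NbOK T ∧ (∀ l ∈ fs, chkFace T l = true) ∧ fs.length = 32 ∧
    (fs.countP fun l => Nat.beq l.length 5) = 12 ∧
    (fs.map faceFin).Nodup ∧
    ∀ a b : Fin 60, (grT T).Adj a b → (fs.countP fun l => inC l a b) = 2 := by
  unfold chkPl at h
  simp only [Bool.and_eq_true, List.all_eq_true, decide_eq_true_eq, Nat.beq_eq, allB_iff,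
    frc_eq] at h
  obtain ⟨⟨⟨⟨⟨h1, h2⟩, h3⟩, h4⟩, h5⟩, h6⟩ := h
  have H := chkNb_ok h1
  refine ⟨H, h2, h3, h4, ?_, ?_⟩
  · unfold List.Nodup
    rw [List.pairwise_map]
    refine (List.Pairwise.and_mem.1 h5).imp ?_
    rintro l l' ⟨hl, hl', h⟩ e
    rw [List.any_eq_true] at h
    obtain ⟨p, hp, h⟩ := h
    have hf := h2 l hl
    unfold chkFace at hf
    simp only [Bool.and_eq_true, List.all_eq_true, Nat.ble_eq, Nat.succ_le_iff] at hf
    have hm := List.of_mem_zip (show (p.1, p.2) ∈ l.zip (l.tail ++ l.take 1) from hp)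
    have a1 := hf.1.1.1 p.1 hm.1
    have a2 := hf.1.1.1 p.2 (by
      rcases List.mem_append.1 hm.2 with h | h
      · exact List.mem_of_mem_tail h
      · exact List.mem_of_mem_take h)
    have b : inC l p.1 p.2 = true := by
      unfold inC
      rw [List.any_eq_true]
      refine ⟨p, hp, ?_⟩
      simp
    have c := (mem_faceFin l ⟨p.1, a1⟩ ⟨p.2, a2⟩).2 b
    rw [e, mem_faceFin] at c
    simp only [Bool.not_eq_true'] at h
    exact absurd (h.symm.trans c) (by decide)
  · intro a b hab
    rw [H.adj, adjB_iff] at hab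
    obtain ⟨t, ht, e⟩ := hab
    have := h6 a a.2 t ht
    rw [e] at this
    exact this

theorem count_faces {fs : List (List ℕ)} (hn : (fs.map faceFin).Nodup)
    (Q : Finset (Sym2 (Fin 60)) → Prop) [DecidablePred Q] (f : List ℕ → Bool)
    (hf : ∀ l ∈ fs, Q (faceFin l) ↔ f l = true) :
    ((fs.map faceFin).toFinset.filter Q).card = fs.countP f := by
  have : (fs.map faceFin).toFinset.filter Q =
      ((fs.map faceFin).filter (fun x => decide (Q x))).toFinset := by
    ext x; simp
  rw [this, List.toFinset_card_of_nodup (hn.filter _), ← List.countP_eq_length_filter,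
    List.countP_map]
  apply List.countP_congr
  intro l hl
  simp [hf l hl]

theorem sum_len : ∀ fs : List (List ℕ), (∀ l ∈ fs, l.length = 5 ∨ l.length = 6) →
    (fs.map List.length).sum + (fs.countP fun l => Nat.beq l.length 5) = 6 * fs.length
  | [], _ => rfl
  | l :: fs, h => by
    have ih := sum_len fs (fun l hl => h l (List.mem_cons_of_mem _ hl))
    have := h l List.mem_cons_self
    rw [List.map_cons, List.sum_cons, List.countP_cons, List.length_cons]
    rcases this with e | e
    · rw [e]; simp; omega
    · rw [e]; simp; omega

/-- the plane graph given by the data -/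
noncomputable def mkP {T : ℕ} {fs : List (List ℕ)} (h : chkPl T fs = true) :
    PlaneGraph (Fin 60) where
  graph := grT T
  faces := (fs.map faceFin).toFinset
  face_edges := by
    obtain ⟨H, h2, h3, h4, h5, h6⟩ := chkPl_ok h
    intro f hf e he
    simp only [List.mem_toFinset, List.mem_map] at hf
    obtain ⟨l, hl, rfl⟩ := hf
    obtain ⟨_, _, v, c, hc, e'⟩ := face_ok H (h2 l hl)
    rw [← e', List.mem_toFinset] at he
    exact c.edges_subset_edgeSet he
  face_cycle := by
    obtain ⟨H, h2, h3, h4, h5, h6⟩ := chkPl_ok h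
    intro f hf
    simp only [List.mem_toFinset, List.mem_map] at hf
    obtain ⟨l, hl, rfl⟩ := hf
    exact (face_ok H (h2 l hl)).2.2
  edge_faces := by
    obtain ⟨H, h2, h3, h4, h5, h6⟩ := chkPl_ok h
    intro e he
    induction e using Sym2.ind with | _ a b
    rw [count_faces h5 _ (fun l => inC l a.val b.val) (fun l _ => mem_faceFin l a b)]
    exact h6 a b he
  euler := by
    obtain ⟨H, h2, h3, h4, h5, h6⟩ := chkPl_ok h
    rw [List.toFinset_card_of_nodup h5, List.sum_toFinset _ h5, List.map_map, List.length_map, h3]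
    have e : fs.map (Finset.card ∘ faceFin) = fs.map List.length := by
      apply List.map_congr_left
      intro l hl
      have := (face_ok H (h2 l hl)).2.1
      rw [Function.comp_apply, this]
    have := sum_len fs (fun l hl => (face_ok H (h2 l hl)).1)
    rw [h3, h4] at this
    have e' : (fs.map fun f => (faceFin f).card) = fs.map List.length := e
    simp only [Fintype.card_fin]
    first
      | (rw [e]; omega)
      | (rw [e']; omega)

theorem mkP_graph {T : ℕ} {fs : List (List ℕ)} (h : chkPl T fs = true) :
    (mkP h).graph = grT T := rfl
theorem mkP_faces {T : ℕ} {fs : List (List ℕ)} (h : chkPl T fs = true) :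
    (mkP h).faces = (fs.map faceFin).toFinset := rfl

/-! ### Connectivity -/
def RS (G : SimpleGraph (Fin 60)) (S : Set (Fin 60)) : Fin 60 → Fin 60 → Prop :=
  Relation.ReflTransGen fun u v => G.Adj u v ∧ u ∉ S ∧ v ∉ S

theorem RS.symm {G : SimpleGraph (Fin 60)} {S : Set (Fin 60)} {a b : Fin 60} (h : RS G S a b) :
    RS G S b a := by
  unfold RS at h ⊢
  induction h with
  | refl => exact Relation.ReflTransGen.refl
  | tail _ h ih => exact Relation.ReflTransGen.head ⟨h.1.symm, h.2.2, h.2.1⟩ ih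

theorem RS_chain {G : SimpleGraph (Fin 60)} {S : Set (Fin 60)} : ∀ {a : Fin 60} {L : List (Fin 60)},
    (a :: L).IsChain G.Adj → (∀ x ∈ a :: L, x ∉ S) → ∀ b ∈ a :: L, RS G S a b
  | a, [], _, _, b, hb => by
    rw [List.mem_singleton] at hb; subst hb; exact Relation.ReflTransGen.refl
  | a, c :: L, hc, hS, b, hb => by
    rw [List.isChain_cons_cons] at hc
    rcases List.mem_cons.1 hb with rfl | hb
    · exact Relation.ReflTransGen.refl
    · refine Relation.ReflTransGen.head ⟨hc.1, hS _ (by simp), hS _ (by simp)⟩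
        (RS_chain hc.2 (fun x hx => hS x (List.mem_cons_of_mem _ hx)) b hb)

theorem RS_chain2 {G : SimpleGraph (Fin 60)} {S : Set (Fin 60)} {L : List (Fin 60)}
    (h : L.IsChain G.Adj) (hS : ∀ x ∈ L, x ∉ S) {a b : Fin 60} (ha : a ∈ L) (hb : b ∈ L) :
    RS G S a b := by
  cases L with
  | nil => simp at ha
  | cons c L => exact (RS_chain h hS a ha).symm.trans (RS_chain h hS b hb)

theorem RS_step {G : SimpleGraph (Fin 60)} {S : Set (Fin 60)} {x : Fin 60}
    (h : ∀ a b, a ∉ S → b ∉ S → RS G S a b)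
    (hx : ∀ a b, G.Adj x a → G.Adj x b → a ∉ insert x S → b ∉ insert x S → RS G (insert x S) a b) :
    ∀ a b, a ∉ insert x S → b ∉ insert x S → RS G (insert x S) a b := by
  intro a b ha hb
  have ha' : a ≠ x ∧ a ∉ S := by simpa [not_or] using ha
  have hb' : b ≠ x ∧ b ∉ S := by simpa [not_or] using hb
  have key : ∀ c, RS G S a c → (c ≠ x → RS G (insert x S) a c) ∧
      (c = x → ∀ d, G.Adj x d → d ∉ insert x S → RS G (insert x S) a d) := by
    intro c hc
    unfold RS at hc
    induction hc with
    | refl => exact ⟨fun _ => Relation.ReflTransGen.refl, fun e => absurd e ha'.1⟩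
    | @tail u v _ huv ih =>
      obtain ⟨h1, h2, h3⟩ := huv
      by_cases hu : u = x
      · subst hu
        have hv : v ≠ u := h1.ne'
        exact ⟨fun _ => ih.2 rfl v h1 (by simp [hv, h3]), fun e => absurd e hv⟩
      · have r := ih.1 hu
        have hu' : u ∉ insert x S := by simp [hu, h2]
        refine ⟨fun hv => r.tail ⟨h1, hu', by simp [hv, h3]⟩, ?_⟩
        rintro rfl d hd hd'
        exact r.trans (hx u d h1.symm hd hu' hd')
  exact (key b (h a b ha'.2 hb'.2)).1 hb'.1

theorem link_conn {G : SimpleGraph (Fin 60)} {x : Fin 60} {W : List (Fin 60)}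
    (hn : W.Nodup) (hx : x ∉ W) (hN : ∀ a, G.Adj x a → a ∈ W) (hc : (W ++ W).IsChain G.Adj)
    (S : Set (Fin 60)) (hS : S = ∅ ∨ ∃ y, S = {y}) (a b : Fin 60) (ha : G.Adj x a)
    (hb : G.Adj x b) (ha' : a ∉ insert x S) (hb' : b ∉ insert x S) : RS G (insert x S) a b := by
  have main : ∀ L : List (Fin 60), L <:+: W ++ W → (∀ z ∈ W, z ∉ S → z ∈ L) →
      (∀ z ∈ L, z ∈ W ∧ z ∉ S) → RS G (insert x S) a b := by
    intro L h1 h2 h3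
    have hcL : L.IsChain G.Adj := by
      obtain ⟨s, t, e⟩ := h1
      rw [← e] at hc
      exact (List.isChain_append.1 (List.isChain_append.1 hc).1).2.1
    refine RS_chain2 hcL ?_ (h2 a (hN a ha) (fun h => ha' (Or.inr h)))
      (h2 b (hN b hb) (fun h => hb' (Or.inr h)))
    intro z hz
    rw [Set.mem_insert_iff, not_or]
    exact ⟨fun e => hx (e ▸ (h3 z hz).1), (h3 z hz).2⟩
  by_cases hy : ∃ y ∈ W, S = {y}
  · obtain ⟨y, hy, rfl⟩ := hy
    obtain ⟨l1, l2, rfl⟩ := List.append_of_mem hy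
    rw [List.nodup_append] at hn
    simp only [List.nodup_cons, List.mem_cons] at hn
    refine main (l2 ++ l1) ⟨l1 ++ [y], y :: l2, by simp⟩ ?_ ?_
    · intro z hz hz'
      simp only [List.mem_append, List.mem_cons, Set.mem_singleton_iff] at hz hz' ⊢
      tauto
    · intro z hz
      simp only [List.mem_append, List.mem_cons, Set.mem_singleton_iff] at hz ⊢
      refine ⟨by tauto, ?_⟩
      rintro rfl
      rcases hz with hz | hz
      · exact hn.2.1.1 hz
      · exact hn.2.2 z hz z (Or.inl rfl) rfl
  · refine main W ⟨[], W, by simp⟩ (fun z hz _ => hz) (fun z hz => ⟨hz, ?_⟩)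
    intro hzS
    rcases hS with rfl | ⟨y, rfl⟩
    · exact hzS
    · rw [Set.mem_singleton_iff] at hzS; subst hzS; exact hy ⟨z, hz, rfl⟩

theorem conn_of_RS {G : SimpleGraph (Fin 60)} {S : Set (Fin 60)} (hS : S.ncard ≤ 2)
    (h : ∀ a b, a ∉ S → b ∉ S → RS G S a b) : (SimpleGraph.induce Sᶜ G).Connected := by
  have hne : (Sᶜ : Set (Fin 60)).Nonempty := by
    rw [Set.nonempty_compl]
    rintro rfl
    rw [Set.ncard_univ] at hS
    simp at hS
  have key : ∀ a b, RS G S a b → ∀ (ha : a ∈ Sᶜ) (hb : b ∈ Sᶜ),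
      (SimpleGraph.induce Sᶜ G).Reachable ⟨a, ha⟩ ⟨b, hb⟩ := by
    intro a b hab
    unfold RS at hab
    induction hab with
    | refl => intro _ _; exact SimpleGraph.Reachable.refl _
    | @tail u v _ huv ih =>
      intro ha hb
      refine (ih ha huv.2.1).trans (SimpleGraph.Adj.reachable ?_)
      exact huv.1
  have := hne.to_subtype
  exact ⟨fun a b => key a.1 b.1 (h a.1 b.1 a.2 b.2) a.2 b.2⟩

theorem three_conn {G : SimpleGraph (Fin 60)} (h0 : ∀ a : Fin 60, a ≠ 0 → ∃ b < a, G.Adj a b)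
    (hW : ∀ x, ∃ W : List (Fin 60), W.Nodup ∧ x ∉ W ∧ (∀ a, G.Adj x a → a ∈ W) ∧
      (W ++ W).IsChain G.Adj) (s : Set (Fin 60)) (hs : s.ncard ≤ 2) :
    (SimpleGraph.induce sᶜ G).Connected := by
  have c0 : ∀ a b, a ∉ (∅ : Set (Fin 60)) → b ∉ (∅ : Set (Fin 60)) → RS G ∅ a b := by
    have : ∀ n, ∀ a : Fin 60, a.val = n → RS G ∅ a 0 := by
      intro n
      induction n using Nat.strong_induction_on with
      | _ n ih =>
        intro a ha
        by_cases e : a = 0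
        · subst e; exact Relation.ReflTransGen.refl
        · obtain ⟨b, hb, hab⟩ := h0 a e
          exact Relation.ReflTransGen.head ⟨hab, id, id⟩ (ih b.val (by omega) b rfl)
    intro a b _ _
    exact (this _ a rfl).trans (this _ b rfl).symm
  have c1 : ∀ x, ∀ a b, a ∉ insert x (∅ : Set (Fin 60)) → b ∉ insert x (∅ : Set (Fin 60)) →
      RS G (insert x ∅) a b := by
    intro x
    obtain ⟨W, w1, w2, w3, w4⟩ := hW x
    exact RS_step c0 (link_conn w1 w2 w3 w4 ∅ (Or.inl rfl))
  have c2 : ∀ x y, ∀ a b, a ∉ insert x (insert y (∅ : Set (Fin 60))) →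
      b ∉ insert x (insert y (∅ : Set (Fin 60))) → RS G (insert x (insert y ∅)) a b := by
    intro x y
    obtain ⟨W, w1, w2, w3, w4⟩ := hW x
    exact RS_step (c1 y) (link_conn w1 w2 w3 w4 (insert y ∅) (Or.inr ⟨y, by simp⟩))
  refine conn_of_RS hs ?_
  rcases Nat.lt_or_ge s.ncard 1 with h | h
  · have : s.ncard = 0 := by omega
    rw [Set.ncard_eq_zero] at this
    subst this; exact c0
  · rcases Nat.lt_or_ge s.ncard 2 with h' | h'
    · obtain ⟨x, rfl⟩ := Set.ncard_eq_one.1 (show s.ncard = 1 by omega)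
      simpa using c1 x
    · obtain ⟨x, y, _, rfl⟩ := Set.ncard_eq_two.1 (show s.ncard = 2 by omega)
      have := c2 x y
      simpa using this

end FG

namespace FG

/-! ### Links of vertices -/
def rotAt (x : ℕ) (l : List ℕ) : List ℕ :=
  (l.dropWhile fun y => !(Nat.beq y x)).tail ++ l.takeWhile fun y => !(Nat.beq y x)
def nextP (ps : List (List ℕ)) (p : List ℕ) : List ℕ :=
  (ps.find? fun p' => Nat.beq (p'.headD 0) (p.getLastD 0)).getD []
def link (fs : List (List ℕ)) (x : ℕ) : List ℕ :=
  let ps := (fs.filter fun l => l.any (Nat.beq x)).map (rotAt x)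
  let p1 := ps.headD []
  let p2 := nextP ps p1
  p1.dropLast ++ p2.dropLast ++ (nextP ps p2).dropLast
def chB (T : ℕ) : List ℕ → Bool
  | a :: b :: l => adjB T a b && chB T (b :: l)
  | _ => true
def chkLink (T : ℕ) (W : List ℕ) (x : ℕ) : Bool :=
  W.all (fun y => Nat.ble (Nat.succ y) 60) && decide W.Nodup && !(W.any fun y => Nat.beq y x) &&
  W.any (fun y => Nat.beq y (gt T (3 * x))) && W.any (fun y => Nat.beq y (gt T (3 * x + 1))) &&
  W.any (fun y => Nat.beq y (gt T (3 * x + 2))) && chB T (W ++ W)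
noncomputable def chkConn (T : ℕ) (fs : List (List ℕ)) : Bool :=
  allB (fun x => chkLink T (link fs x) x &&
    (Nat.beq x 0 || Nat.ble (Nat.succ (gt T (3 * x))) x || Nat.ble (Nat.succ (gt T (3 * x + 1))) x ||
      Nat.ble (Nat.succ (gt T (3 * x + 2))) x)) 60

theorem lift_list : ∀ W : List ℕ, (∀ x ∈ W, x < 60) → ∃ W' : List (Fin 60), W'.map Fin.val = W
  | [], _ => ⟨[], rfl⟩
  | a :: W, h => by
    obtain ⟨W', e⟩ := lift_list W (fun x hx => h x (List.mem_cons_of_mem _ hx))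
    exact ⟨⟨a, h a List.mem_cons_self⟩ :: W', by rw [List.map_cons, e]⟩

theorem chB_ok {T : ℕ} (H : NbOK T) : ∀ W : List (Fin 60), chB T (W.map Fin.val) = true →
    W.IsChain (grT T).Adj
  | [], _ => List.isChain_nil
  | [a], _ => List.isChain_singleton a
  | a :: b :: l, h => by
    simp only [List.map_cons, chB, Bool.and_eq_true] at h
    rw [List.isChain_cons_cons]
    refine ⟨(H.adj a b).2 h.1, chB_ok H (b :: l) ?_⟩
    rw [List.map_cons]; exact h.2

theorem chkLink_ok {T : ℕ} (H : NbOK T) {W : List ℕ} {x : Fin 60} (h : chkLink T W x = true) :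
    ∃ W : List (Fin 60), W.Nodup ∧ x ∉ W ∧ (∀ a, (grT T).Adj x a → a ∈ W) ∧
      (W ++ W).IsChain (grT T).Adj := by
  unfold chkLink at h
  simp only [Bool.and_eq_true, List.all_eq_true, decide_eq_true_eq, Nat.ble_eq, Nat.succ_le_iff,
    Bool.not_eq_true', List.any_eq_true, Nat.beq_eq, exists_eq_right, List.any_eq_false] at h
  obtain ⟨⟨⟨⟨⟨⟨h1, h2⟩, h3⟩, h4⟩, h5⟩, h6⟩, h7⟩ := h
  obtain ⟨W', rfl⟩ := lift_list W h1
  rw [← List.map_append] at h7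
  refine ⟨W', List.Nodup.of_map _ h2, fun hx => h3 x.val (List.mem_map_of_mem hx) rfl, ?_,
    chB_ok H _ h7⟩
  have back : ∀ a : Fin 60, a.val ∈ W'.map Fin.val → a ∈ W' := by
    intro a ha
    obtain ⟨b, hb, e⟩ := List.mem_map.1 ha
    rwa [← Fin.ext e]
  intro a ha
  rw [H.adj, adjB_iff] at ha
  obtain ⟨t, ht, e⟩ := ha
  apply back
  rw [← e]
  interval_cases t
  · exact h4
  · exact h5
  · exact h6

theorem chkConn_ok {T : ℕ} (H : NbOK T) {fs : List (List ℕ)} (h : chkConn T fs = true)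
    (s : Set (Fin 60)) (hs : s.ncard ≤ 2) : (SimpleGraph.induce sᶜ (grT T)).Connected := by
  unfold chkConn at h
  rw [allB_iff] at h
  refine three_conn ?_ ?_ s hs
  · intro a ha
    have := (Bool.and_eq_true _ _ ▸ h a a.2).2
    simp only [Bool.or_eq_true, Nat.beq_eq, Nat.ble_eq, Nat.succ_le_iff] at this
    have key : ∀ t, t < 3 → gt T (3 * a.val + t) < a.val → ∃ b < a, (grT T).Adj a b := by
      intro t ht hl
      refine ⟨H.nf a ⟨t, ht⟩, hl, (H.nf_adj _ _).2 ⟨_, rfl⟩⟩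
    rcases this with ((this | this) | this) | this
    · exact absurd (Fin.ext this) ha
    · exact key 0 (by omega) this
    · exact key 1 (by omega) this
    · exact key 2 (by omega) this
  · intro x
    have := (Bool.and_eq_true _ _ ▸ h x x.2).1
    exact chkLink_ok H this

theorem mkP_fullerene {T : ℕ} {fs : List (List ℕ)} (h : chkPl T fs = true)
    (hc : chkConn T fs = true) : IsFullerene (mkP h) := by
  obtain ⟨H, h2, h3, h4, h5, h6⟩ := chkPl_ok h
  refine ⟨H.cubic, chkConn_ok H hc, ?_, ?_⟩
  · intro f hf
    rw [mkP_faces, List.mem_toFinset, List.mem_map] at hf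
    obtain ⟨l, hl, rfl⟩ := hf
    have := face_ok H (h2 l hl)
    rw [this.2.1]; exact this.1
  · rw [mkP_faces, count_faces h5 _ (fun l => Nat.beq l.length 5), h4]
    intro l hl
    rw [(face_ok H (h2 l hl)).2.1, Nat.beq_eq]

/-! ### Sextet patterns -/
def chkHex (mt : ℕ) : List ℕ → Bool
  | [a, b, c, d, e, f] => Nat.beq (gt mt a) b && Nat.beq (gt mt c) d && Nat.beq (gt mt e) f
  | _ => false
noncomputable def chkSx (T : ℕ) (fs hx : List (List ℕ)) (mt : ℕ) : Bool :=
  hx.all (fun l => decide (l ∈ fs) && chkHex mt l) && Nat.beq hx.length 8 && decide hx.Nodup &&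
  (hx.all fun l => hx.all fun l' => decide (l = l') || l.all fun x => !(l'.any (Nat.beq x))) &&
  allB (fun a => frc (gt mt a) fun b => Nat.ble (Nat.succ b) 60 && Nat.beq (gt mt b) a && adjB T a b) 60

theorem inC_mem {l : List ℕ} {a b : ℕ} (h : inC l a b = true) : a ∈ l := by
  unfold inC at h
  rw [List.any_eq_true] at h
  obtain ⟨p, hp, h⟩ := h
  have hm := List.of_mem_zip (show (p.1, p.2) ∈ l.zip (l.tail ++ l.take 1) from hp)
  have h2 : p.2 ∈ l := by
    rcases List.mem_append.1 hm.2 with h | h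
    · exact List.mem_of_mem_tail h
    · exact List.mem_of_mem_take h
  simp only [Bool.or_eq_true, Bool.and_eq_true, Nat.beq_eq] at h
  rcases h with h | h
  · exact h.1 ▸ hm.1
  · exact h.2 ▸ h2

theorem edgeVerts_face {l : List ℕ} {v : Fin 60} (h : v ∈ edgeVerts (faceFin l)) : v.val ∈ l := by
  unfold edgeVerts at h
  simp only [Finset.mem_filter, Finset.mem_univ, true_and] at h
  obtain ⟨e, he, hv⟩ := h
  obtain ⟨w, rfl⟩ := Sym2.mem_iff_exists.1 hv
  rw [mem_faceFin] at he
  exact inC_mem he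

theorem hex_ok {T : ℕ} (H : NbOK T) {l : List ℕ} (h : chkFace T l = true) {mt : ℕ}
    (hh : chkHex mt l = true) (mf : Fin 60 → Fin 60) (hm : ∀ a, (mf a).val = gt mt a)
    (hi : ∀ a, mf (mf a) = a) (M : Finset (Sym2 (Fin 60)))
    (hM : ∀ a b, s(a, b) ∈ M ↔ mf a = b) : (faceFin l).card = 6 ∧ (faceFin l ∩ M).card = 3 := by
  have hf := face_ok H h
  unfold chkHex at hh
  split at hh
  · rename_i a b c d e f
    refine ⟨hf.2.1, ?_⟩
    unfold chkFace at h
    simp only [Bool.and_eq_true, List.all_eq_true, decide_eq_true_eq, Bool.or_eq_true, Nat.beq_eq,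
      Nat.ble_eq, Nat.succ_le_iff] at h hh
    obtain ⟨⟨⟨h1, h2⟩, _⟩, _⟩ := h
    simp only [List.mem_cons, List.not_mem_nil, or_false, forall_eq_or_imp, forall_eq] at h1
    obtain ⟨ha, hb, hc, hd, he, hf'⟩ := h1
    simp only [List.nodup_cons, List.mem_cons, List.not_mem_nil, or_false, not_or] at h2
    have m1 : mf ⟨a, ha⟩ = ⟨b, hb⟩ := Fin.ext ((hm _).trans hh.1.1)
    have m2 : mf ⟨c, hc⟩ = ⟨d, hd⟩ := Fin.ext ((hm _).trans hh.1.2)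
    have m3 : mf ⟨e, he⟩ = ⟨f, hf'⟩ := Fin.ext ((hm _).trans hh.2)
    have n1 : mf ⟨b, hb⟩ = ⟨a, ha⟩ := by rw [← m1, hi]
    have n2 : mf ⟨d, hd⟩ = ⟨c, hc⟩ := by rw [← m2, hi]
    have n3 : mf ⟨f, hf'⟩ = ⟨e, he⟩ := by rw [← m3, hi]
    have eq : faceFin [a, b, c, d, e, f] ∩ M = {s(⟨a, ha⟩, ⟨b, hb⟩), s(⟨c, hc⟩, ⟨d, hd⟩), s(⟨e, he⟩, ⟨f, hf'⟩)} := by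
      ext x
      induction x using Sym2.ind with | _ x y
      rw [Finset.mem_inter, mem_faceFin, hM]
      simp only [inC, pairs, List.tail, List.take, List.zip, List.zipWith, List.cons_append,
        List.nil_append, List.any_cons, List.any_nil, Bool.or_false, Bool.or_eq_true, Bool.and_eq_true, Nat.beq_eq,
        Finset.mem_insert, Finset.mem_singleton, Sym2.eq_iff]
      constructor
      · rintro ⟨h, rfl⟩
        rcases h with (⟨p, r⟩ | ⟨r, p⟩) | (⟨p, r⟩ | ⟨r, p⟩) | (⟨p, r⟩ | ⟨r, p⟩) | (⟨p, r⟩ | ⟨r, p⟩) | (⟨p, r⟩ | ⟨r, p⟩) | (⟨p, r⟩ | ⟨r, p⟩) <;>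
          subst p <;> simp_all [Fin.ext_iff] 
      · rintro ((⟨rfl, rfl⟩ | ⟨rfl, rfl⟩) | (⟨rfl, rfl⟩ | ⟨rfl, rfl⟩) | (⟨rfl, rfl⟩ | ⟨rfl, rfl⟩)) <;> simp [m1, m2, m3, n1, n2, n3]
    rw [eq, Finset.card_eq_three]
    refine ⟨_, _, _, ?_, ?_, ?_, rfl⟩ <;> simp [Fin.ext_iff] <;> grind
  · simp at hh

theorem mkP_sextet {T : ℕ} {fs hx : List (List ℕ)} {mt : ℕ} (h : chkPl T fs = true)
    (hs : chkSx T fs hx mt = true) :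
    ∃ X, IsSextetPattern (mkP h) X ∧ X.card = 8 := by
  obtain ⟨H, h2, h3, h4, h5, h6⟩ := chkPl_ok h
  unfold chkSx at hs
  simp only [Bool.and_eq_true, List.all_eq_true, decide_eq_true_eq, Bool.or_eq_true, Nat.beq_eq,
      Nat.ble_eq, Nat.succ_le_iff, allB_iff, frc_eq, Bool.not_eq_true', List.any_eq_false] at hs
  obtain ⟨⟨⟨⟨s1, s2⟩, s3⟩, s4⟩, s5⟩ := hs
  let mf : Fin 60 → Fin 60 := fun a => ⟨gt mt a, (s5 a a.2).1.1⟩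
  have hi : ∀ a, mf (mf a) = a := fun a => Fin.ext (s5 a a.2).1.2
  have hadj : ∀ a, (grT T).Adj a (mf a) := fun a => (H.adj a (mf a)).2 (s5 a a.2).2
  let M : Finset (Sym2 (Fin 60)) := Finset.univ.image fun a => s(a, mf a)
  have hM : ∀ a b, s(a, b) ∈ M ↔ mf a = b := by
    intro a b
    simp only [M, Finset.mem_image, Finset.mem_univ, true_and]
    constructor
    · rintro ⟨c, hc⟩
      rw [Sym2.eq_iff] at hc
      rcases hc with ⟨rfl, rfl⟩ | ⟨rfl, rfl⟩
      · rfl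
      · exact hi c
    · rintro rfl; exact ⟨a, rfl⟩
  have fx : ∀ f ∈ (hx.map faceFin).toFinset, ∃ l ∈ hx, faceFin l = f := by
    intro f hf
    rw [List.mem_toFinset, List.mem_map] at hf
    exact hf
  refine ⟨(hx.map faceFin).toFinset, ⟨?_, ?_, M, ⟨?_, ⟨?_, ?_⟩, ?_⟩, ?_⟩, ?_⟩
  · intro f hf
    obtain ⟨l, hl, rfl⟩ := fx f hf
    refine ⟨?_, (hex_ok H (h2 l (s1 l hl).1) (s1 l hl).2 mf (fun _ => rfl) hi M hM).1⟩
    rw [mkP_faces, List.mem_toFinset]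
    exact List.mem_map_of_mem (s1 l hl).1
  · intro f hf g hg hfg
    obtain ⟨l, hl, rfl⟩ := fx f hf
    obtain ⟨l', hl', rfl⟩ := fx g hg
    rw [Finset.disjoint_left]
    intro v hv hv'
    rcases s4 l hl l' hl' with e | e
    · exact hfg (by rw [e])
    · exact e v.val (edgeVerts_face hv) v.val (edgeVerts_face hv') rfl
  · intro e he
    induction e using Sym2.ind with | _ a b
    rw [hM] at he
    rw [← he]
    exact hadj a
  · intro e he
    induction e using Sym2.ind with | _ a b
    rw [hM] at he
    rw [Sym2.mk_isDiag_iff, ← he]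
    exact (hadj a).ne
  · intro e he e' he' hne v hv hv'
    obtain ⟨w, rfl⟩ := Sym2.mem_iff_exists.1 hv
    obtain ⟨w', rfl⟩ := Sym2.mem_iff_exists.1 hv'
    rw [hM] at he he'
    exact hne (by rw [← he, ← he'])
  · intro v
    exact ⟨s(v, mf v), (hM _ _).2 rfl, by simp⟩
  · intro f hf
    obtain ⟨l, hl, rfl⟩ := fx f hf
    exact (hex_ok H (h2 l (s1 l hl).1) (s1 l hl).2 mf (fun _ => rfl) hi M hM).2
  · rw [List.toFinset_card_of_nodup, List.length_map, s2]
    refine List.Nodup.map_on ?_ s3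
    intro l hl l' hl' e
    exact List.inj_on_of_nodup_map h5 (s1 l hl).1 (s1 l' hl').1 e

theorem mkP_extremal {T : ℕ} {fs hx : List (List ℕ)} {mt : ℕ} (h : chkPl T fs = true)
    (hc : chkConn T fs = true) (hs : chkSx T fs hx mt = true) : IsExtremalFullerene (mkP h) := by
  obtain ⟨X, h1, h2⟩ := mkP_sextet h hs
  refine ⟨X, ⟨h1, fun X' hX' => ?_⟩, ?_⟩
  · rw [h2]
    exact (sext_facts (mkP_fullerene h hc) (by simp) hX').1
  · rw [h2]; simp

/-! ### Isolated pentagons -/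
def chkI (fs : List (List ℕ)) : Bool :=
  fs.all fun l => fs.all fun l' => !(Nat.beq l.length 5) || !(Nat.beq l'.length 5) ||
    decide (l = l') || (pairs l).all fun p => !(inC l' p.1 p.2)

theorem mkP_ipr {T : ℕ} {fs : List (List ℕ)} (h : chkPl T fs = true) (hI : chkI fs = true) :
    NoAdjacentPentagons (mkP h) := by
  obtain ⟨H, h2, h3, h4, h5, h6⟩ := chkPl_ok h
  intro f hf g hg hne cf cg
  rw [mkP_faces, List.mem_toFinset, List.mem_map] at hf hg
  obtain ⟨l, hl, rfl⟩ := hf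
  obtain ⟨l', hl', rfl⟩ := hg
  rw [(face_ok H (h2 l hl)).2.1] at cf
  rw [(face_ok H (h2 l' hl')).2.1] at cg
  unfold chkI at hI
  have := List.all_eq_true.1 (List.all_eq_true.1 hI l hl) l' hl'
  rw [cf, cg] at this
  have e : decide (l = l') = false := by
    rw [decide_eq_false_iff_not]; rintro rfl; exact hne rfl
  rw [e] at this
  have b5 : Nat.beq 5 5 = true := rfl
  simp only [b5, Bool.not_true, Bool.false_or, List.all_eq_true, Bool.not_eq_true'] at this
  rw [Finset.eq_empty_iff_forall_notMem]
  intro x hx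
  induction x using Sym2.ind with | _ x y
  rw [Finset.mem_inter, mem_faceFin, mem_faceFin] at hx
  obtain ⟨k1, k2⟩ := hx
  unfold inC at k1
  rw [List.any_eq_true] at k1
  obtain ⟨p, hp, k1⟩ := k1
  have c := this p hp
  simp only [Bool.or_eq_true, Bool.and_eq_true, Nat.beq_eq] at k1
  rcases k1 with k1 | k1
  · rw [k1.1, k1.2, k2] at c
    exact absurd c (by decide)
  · rw [k1.1, k1.2, inC_comm, k2] at c
    exact absurd c (by decide)

end FG

namespace FG
def kd0 : KD where
  q := 637317707846260925122187884905017108755574085284455660063708976036112423554987305195416742117331136831647342530188775098881217758594696459462024345855739586738022957418018616781671370300481674277645757890622716631077203011026044329585608112579245112792794262824234009125192070221889739483582010381362740773788380408775136647421054267047985133710872014685254847561728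
  r := 487292351472649985848316020316023891928383930760449679406946833849771519206577442705634254335398874589369242965579938177129371638846098644697287849915312782869074433636787278070068789341114501780479570577004475183268845552190030819711288790831685712861628310760592773970982528212811086693697098679133481460748195573127412400186594705557264339510282459058291131547648
  nus := [668190374513586037026959996080987566406368697859667767716003922270174514732867327201964519485277013511251530297282985733256567011334436150322813779217988512157084188732614901888586333393507407280942237907761256078789158274944811910645851089282634296246901675835444827827741685723229676887504722884909233804538588158901996155979967495859003023693639800827724670435328,
    632788640563666145187245282004596416201317895180423063728869064730604951996707451408264502028891665560869822254722773288016981066541423327898504456730736722313592022611344923503023132493378451578862445921996368017936038143157608793419899909056906098599609652070928041426260023024581089161628311759913412866850214504818806498098843869620956548766421829393960086274048,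
    637248564889709974691440097421849982647460027471593348062079178166602179937826580944788297203951489704543804235176996054538854166326824458668743106371297178062559712578286450819118628667126076342011193523295705311968477136033951329239605085233643461793597339117745419750960285325318043574521396662821602184459919489719992908917458728074808643602521252002244033773568,
    637248564889709974693117456282591948427831374919462518053878493282029763515833917963196356546518562149578375695029109541776212561953964984138013283348753958643975061048241088676302217543762850567629684150901139266668402350594194943747329444114174928751805768638899045967550638327030842027889924522354060882132545537907139381398246164999510061211413355344802818818048,
    632788640563666145187245282004596416201187852129540280004245465592877614873393668506453120742198037611238308701985118108722375406239295360577596589209339162614267555373955251424206789023818000600404481424991971461136252892658871160029658950946817486167770538903814861964095834063398008122062656348361946037259015819343695228818371811659726993307665713042842659586048,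
    601846830939790082845246461157449163094428107449295540459758912020108095502816355813413146059069408530624353910344002442526864380823283263333200362316730897180075729150645390328539841194514211015738372813655899525145774880407585177277635259716823191044722694034083989111260728259806212754331710731587034152430327291895890174252818450296182339338922696164789639446528]
  reps := [8, 16, 36, 116, 136, 144]
  certs := [(1141780735944495789361718795660584111924065024, 0,
      256679857139820425473364302321768368595139652181022112541792663622291553718282942170363109160902958434401692337218894693609168554782220695381367404248860488425274166435104447969874175431660508675656472200452442027644957171383071006951106256033775192813189761186341668482513512539771298027542266297054933618522662105976680690993750359177958149307038419707176421425152,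
      1799541503773902265450958299488218716474331681715009906759725321435064188588527578182888613286017060710925869607310278752365714637628252735671050),
    (4567122943777983157446875182642325933576172288, 1,
      261087787616895730339208059234898564017908759496342319480703131054804222894664308848216892727739034057535411801204947366513404014661500252799847311966487585638143489817864081155378675697621642414170647121432966071982720912466079046382343347265135543441692857288987578697803166409375894784807028442981837780831508196920522992493867236986697517753082826138489473466368,
      1762916075709926788067186816384910681957031928276782838234839897951633796020229972625996201702273199862013305370336488092736680872948475216005898),
    (1141780735944495789361718795660594625994017792, 1,
      256679857139820425473126284993594170659698876219637442908978776212844916930270108976810513024309281267105353495428817186492638292718707146109242805867499944596178273097276542635643065994456192441515191681012961367560954242452465346667689142210141713240822402045000438077521773596855922524577515265604647453777794455867095512676254993726013537928111666257082686898176,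
      1799544861711802682852493965703593042187792470848475385051738449035060987629872822365478431912114492364956813261053234661739194258330358169864456),
    (4567122943777983157446875182642336447646125056, 0,
      261087787616895730339208059206301271081128716937493310105791248329738290957674339650861788641576935978399702972298247266004952962146116725374119406201749919778394577175138492154571574085200219672883729288771099383818311640644024605533161844390479344290608642784923887552345635081817816814402081035938570920316857463173525729498583404437294812068272283091029681242112,
      1762914215031117668079309810184696922272960760299735883933890225276352463326980596250177114923963081772796611444412693617030988341447262459136009)]

def kd1 : KD where
  q := 637317707846260925122187884905017108755574085284455660063708976036111769558034676858410812854993311039150947836822674971310050909336131047864234076162587267160159144264730816418752232609338426496837279227521270097522716679865478060772609836231927945426792891950100741260682168276851362703280529644439378740168555939659603869421128948927708416083485509077318319996928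
  r := 433999746156857469384910531448633013474564010734891549816150359909847592555019862313090522227561186221544265047081643403051173122552656276713880429479460493468123676028622116757100842758538832263846654803520969601348920102149570480778962593911805193869921279308289856789220741400915993127954829399449224029351591140130618165456024291449632555278367910725834462199808
  nus := [668190374513586037026959996080987566406368697859667767716003922270174514732867327201964519485277013511251530297282985733256567011334436150322813779217988512157084188732614901888586333393507407280942237907761256078789158274944811910645851089282634296246901675835444827827741685723229676887504722884909233804538588158901996155979967495859003023693639800827724670435328,
    628397591214639213163800319085005342662759976756693153092870495099751667737704762675728675193466391392426222697931217821739584064928796235036390245964414212342255082865729517600669272233308697724212160506217326700637367099246889793902907867233655025528131880669843105067781919139417674350074192852635460748330326335598077210968304886997449938324649720670175434375168,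
    663799325164559105003515033161396492867693838162275011732124903868512168814767873096263441981770283847828770624398447307645115335201149180442698543415974173558248568762130330880569855358853412431884419011033749032436188799845722195411173452059694483602249412940525009693865891615086084079664346113003396874741137750001794586145253122624476603176073564254741324627968,
    628397591214639213164038358347190645648663599656524551598837191838727790516706206123853736569449635975457169566326888027187750132145120550986116807363198246097965916823925591945100755751058053407297169049400166409335424368970845748291153219466198152413546489005771066690900696063063767664636842214024756038989523871027253942059700945812083835245827376281757677518848,
    548744230014910245088430334456153479679708025089597557074581941699848621511136483851511941207028461117531379723432195918137389521691663075759227138122816193505695594764726267128382240371598504207583621390921573814138289624160228744502141795576897922287544211597610039846500957353856517551337191776615825213175875917818514098806300636611140458294313872293130391257088,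
    668190374513586037026959996080987566406277768053625055216248463276792513228246066688352272536017023911749907412082689187662107800992988162158208823031741724705696583043382863575431380871994531493143976464604284185241899942921638585328201892249754109136248846155533055026531835904865385670120572042529593114474499715682288413765925439831319590561040068142126122139648,
    553135279363937177114753995140113827075526365952038578723203806689440250602279933720668381519906084200640774253809078679398348420965282914146406849680603321289491021458906608249643554542611874879646793210791825380535952959656474511360991284543150119780925653746223021774884544770765537464618389624562413904793681374458832136554866957975438517445244565112734191976448,
    668190374513586037022403939455876326768581075066216234388206213313386192005752533380405426074508311432404844090124824087824067779486595052014460055206949444345641596306697136291566321874437900300715342653089300010390986775992028103776577876960604385715419931290791273278877541336921250626088467624660912554341307699003453097890434150779619061687325838965008685334528,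
    579686039638786307417233330232352039372628075116016402506273622465015479323538642828539383478492978951087825928802326193283688184450277350462969623391960896469920496226597813168537654336242622477058421785021637204731921641029861059085032263782257397754226639242751355161694868896685152394153625631872364367682830552338873391836949613638576268043532534001528962285568,
    592995857264719321320485380584973796967027189194719533503282812364357620680472593981620399298499313371607176005703786885893007601164062813826369235220461729407085123451644991471157738925732634552670583369222368137896365516653401219751999165312229136095163428206424273355701688773358175959392693397201918224030702822926073860173957085345629633072552557568312463065088,
    513342496056747744738774481736354613246845718599707961833430401732749785385268289411109552406276656456486315779386786452100851181350212446853053555673987765866928801847183279696188976142120894834943273364978257687544460590427188777746496177533576595640901805757617782424938966688357855774437970455325829165071459213203234364715724056077925227482565463072263244873728,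
    491181704763986577808945983982273175133263843891096767783865041445437267588696936515916346028225568439530805189495454452560322874631100280892905372323272115949040109034682532945662697966227305254072995551676433588861731290532907644499355847037624770604294416461758743221224027278612007614025489608733436506829466001732643432669460321857776250190112325145254174916608]
  reps := [8, 16, 72, 104, 136, 144]
  certs := [(4553794747083801296342291422377142574723642112, 2,
      243386921696989672432514563272776978012891325124054453308294877200710078444003325616496132963892455829961698482070721765136229947712649773674035574524352558368005876658220798534902764448571332368519479022488316101414079676035153925732044008435356495552623075088893668429302264884253336247097327773977009631428328182389049929246503280279897739289359701485822299602944,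
      1189782939527049483268822816495701961389319928842810355889565249898961404013845908604412401280785208500796525975840298712576129211075613688924688),
    (1155108911456175273424259983285830761614947072, 3,
      34572005802419223212437854043122792678207686531715570741656151040312686230255090113340869087066671495144625787460127468014337904696850191294166516290243006693875021423267603750533235981676131608083347673378320790374927827586669076977179953111795241109817943860559829672620935532319411766338928390565422650679218284163029436606009042371627833621018244658162040832,
      122710108220278657073238057255605692134537274561282275244219987284284403457939697265064902769057613414169436886400250202089926938900896349915538),
    (4553794747086904505011650127952006504170402560, 4,
      238961704953249685952579978921001247110572500876739854646260615035572462397685803693887885617239232194690986751265823912385318158229365528772985395300556182997775623614089918002918136969711411859345364089289752752658010833345124825307209349628514722838577981051669349774178377777744545012765448763460326132094840349395313683113363083002306053843728937727587378003968,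
      1579716796849209879908867718702577674938812982516456419533397967625222281070985663219155562911769816890875883443261715758961213881784468245254154),
    (1155108911459278482093618688860694691061707520, 5,
      4494360755344824924680219783105112214586319300715589159919939313738550850319180921872771245612612828692060561690709460149234096584530522386471483980552248447364473135602335631689007601652672114023673102992373390375014975157597660461592427959676315008978057922006840420333629792635086523178408481453135036826821674024438840440096326690281108080365735382847387074560,
      195594569333564610177087568893314937184802776800135997177421953402462697763752751141065402681918911214451264429492026792877468096278637113283209),
    (4553794747083801296343013944449021630441337600, 6,
      238961704953249685952579978921001247110572551675736751320005518498422814040672384360239235011637979658763128586104316784944984530040234876514309766810574369184550556305137463574791340971083947564763316595314232671409061020139145055024334315802080628067071018683087228174391582793393775442497658925896049056063699147298092258751151991768897271225668580186937976946688,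
      1579716796849210052521167992122195321387726185169529631101141087455204832364179494372300401261723558669691694216331381815439493346570963520262154),
    (1155108911456175273424982505357709817332642560, 7,
      4494360755344824924680219783105112214586319300715589159919939313738878489959194528395452520328690894895287192228354660578028824505979326606914648233316572451857802651307729102215383747405336963863182692978976690190728970479468201226304746903879762913057787807225083275276761491519975942588806593176516162044868588537831424217338788735729722127087033755222553919488,
      195588830084550004731513812675196917186606406685935417328357903362155277960436021867195753214169530734095040050004114169993169132322684223918729),
    (4553794747086904505012372650023885559888098048, 2,
      238961704953249685952579978921001247110572500877514973996749933102360360098228552026572795848862075763227553918729928740811000831144327676327244607394015653320714223116440480670918713819312635437637013282049919372722372539220595753777918645561865751466879788982522055733267216448916773843252723542212372598458862170604928716776746818548098799177837148398676978171904,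
      1579716796849210047803862269835468896645056445236485875329149495725749181267114752284178987470380335452573613194698106262261141243850684029931530),
    (1155108911459278482094341210932573746779403008, 3,
      4494360755344824924680219783105112214586319300715589159919939313738714349557338006119742135665795172781664342573291309442973084939999788381821651614741465647496962304483636692057199184696780625299984034677973208636581313635468196162561547355127940150472096709385059631103603509375500859261590155970248864276114586872329578035211993398763839876760228500049684856832,
      195594569333564610177087850576862445089803665621077078322170063711746100695537588999171800163552293664488980484798595239145301567991688582435465),
    (4553794747083801296342291422377142574713654272, 3,
      247812138440729658912689976181011769179769142840823583188195689978947440806393696919963266589204218726037857502477228338203234507350354273735657914092641794699967447345800313094028559829324259252939627466913312057751028289699823750713767989149873650564016043380247449188892359289860826015164873964315142985852704592638079289468745906200941522479403913427612149481472,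
      1774823138254022375255156340695551111905569572208751817184564166222107371063144152514145848234045589420921098235082379414861845564992186711872008),
    (1155108911456175273424259983285830761604959232, 8,
      256627999131116796641060757765848336124686427925574012975929692152327328772994400601226751827608952237976209638341644399743829828813402721518463064171439000972648872553962290456033401491146161862039977390495848479555819535882306451092075592941022903085292317528334743339292936950104149500890426416702412856741425456722294079955990604527852246116278053102016845053952,
      1677601936955589667806002415789125699057610140323266087820356939737538254565000021779239344283797338131446501131513125960149303762609931119301128),
    (4553794747086904505011650127952006504160414720, 5,
      247812138440729658912689976181011769179756138298390137985546016418019993393843226768493295215941957716441057259889243943455212476941215224137516218226170963233194463813121798812587646492081492050176163813395782120819486200692682781327431872412098868048783265576828851033511173635433458929718807301536041212630475480741939083299734143062339610448703148533916505210880,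
      1774823138254022375255155999629649833451093276455645970496047506850558004272730547735130280116782328545483182087306574903355672522171452525974024),
    (1155108911459278482093618688860694691051719680, 9,
      256627999131116796641060757765848336124673423383140567773280018591399881360443930449756780454346691228379409395753660004995807798404263671920321368304968169505875889021283776174592488153903394659276513736978318542624277446875165481705739476203248120570059539724916145183911751295676782415444359753923311083519196344826153873786978841389250334085577288208321200783360,
      1677601936955589667806002074723224420603133844570160241131840280365988887774586417000223776166534077256008584983737321448643130719789196933403144),
    (4553794747083801296343013944449021630431349760, 7,
      252237354920706173389782925971707643221844453110653842175417957349572783993769274361723220233326305841490095661802525584273998668737909824415587606056889655103245084895328956296693830043764148017036304091865277457405284587590626485351464130509107835008119954864165240020994566253655462897796883730108249308396004995794633239073034468160768236360343814533543601635328,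
      1774825919885241419408625993335934980453641885647489817475348251241874432442122355505409734146447211799910545127399811169389094273263391562338824),
    (1155108911456175273424982505357709817322654720, 10,
      261053215874856783121475125049754986399822680357006093569211906088843968694082595201583330277590953449990979940622877299926498868857066749392249640521083127085467323390291067409244807950632779970336898808439645006542073549996156670802197310632570299335179156379974943098611363686625585896416893494181801460393242279683277305011179236959144628969900553718250401169408,
      1786925540161104221768634789592934905543502894833774037610495241470547864593989992317617662586880903480905511621533965681976032120424257347457544),
    (4553794747086904505012372650023885559878110208, 3,
      238961705217013157956140350847078468325530142518418327407450328172590225613410464586372959812073533905775088912961281941183110673338537659900640468555395476149692814308128510323534479841418583565360021041473436711661166309254793844661160376003908263660731907362589784537626255329830012669882744031798146483558449007331919212367654634055520652531031319163404541755392,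
      1701937002495798394183071123194055062551208855527848390766941393030649373228147419236331930108590887271550512074618292698882516347817853380134930),
    (1155108911459278482094341210932573746769415168, 8,
      261001357866153154288695545751694679247809404408638426007619328880193766828065851795253798835049651034250076228354537699307570275645769013523871109725661201457407260811831069547588361499634266020996184871819079437723578172688829805159351879929052406683174078861866657562075518834187356825676815304292229851088249208538416328954991850164573582994413899506185909829632,
      1786916240143773635059595017245289292796915532366790178932325993447779260094102787469969528915731006451037427214953474443782685919372473743378450)]

def kd2 : KD where
  q := 637317707846260925121232067287941373268699755926878379406665270667767417875334740868841213022314785208778939898413106786246414216345633568760671765994568989853054798232503468674579266692785524527812033229198199895694378606588166939325150492058838091187336588309555654986868702945521629290725008405852407322829343225632154652694208111617335859990280635614842562019328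
  r := 346203993649971374472650360207447150625360809622514478716411379260021470449794735540700277790435505296447130733545313799243191921985901053245236018255996430543139877202496630031755146240882951237898400325846666749393305612430850921672638392937933826653256990895154279141129623713164938523382027679481820354687748772051379545571132439451040713472110198111161295044608
  nus := [668190374513586037026959996080987566406368697859667767716003922270174514732867327201964519485277013511251530297282985733256567011334436150322813779217988512157084188732614901888586333393507407280942237907761256078789158274944811910645851089282634296246901675835444827827741685723229676887504722884909233804538588158901996155979967495859003023693639800827724670435328]
  reps := [8, 64, 84, 104, 124, 144]
  certs := [(1137339089776140744585944566192734101129147136, 11,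
      212531405719827818337168394788043410088131857455322157227788568911958875757998146422872457997982323610421987932616831882500342268311635657889751872447888461851731422603305494386423896078801087907906769331176704465428655970471515156326114897446086238530980972202415982947361510745389857672396369119483502304105766770939266271503361936711395432399526679924000518307840,
      1457578518186275596207014426156209975647881054484385762931880354385487285283626311967378135394164599034067775735474903693019305345011194539482385),
    (4549353105151326085240909461907933411544150784, 12,
      212410404227046295066763923896509735762648862526185197538700656872263734343197687570163576457040978531396746927477701507100078723929372682688681978196803275723612823772395341211748157660088841521820821342458673527923483421402650002136850738120276822329276214608888613708775865115302421589842878873883084270424198137468262030910057689676521138395635210994053759893504,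
      1457578518101320520385948684489296142943880346362597642594954185579185593190009275042177537463301969795734846703381947186984551534024992276815121),
    (1137342343726274426060001434712417667412669184, 13,
      212514119716926608726161904533334602965331078872406221732818806309811160934801739121374665959973810763220506821187443013972860734220900893788234828332205632642995524038828038176356791747499818306016880783874327377764005818416659383585948868435228719119343215234078967908256786881381537772584389681108825135349800793455447201063639246529038291951843645147342782332928,
      1457579253707647446389837185480462512863996959223918000184931069056788647445416545252056569132108261019875016408215196620884714892681856425336081),
    (4549356359101459766714966330427616977827672832, 14,
      212410404227046295066763923896509517585947583170358364013352201287819394678525582825980573495937895564755262772422617844066783802673657065928780897360878736439691881870525664262180735968994985823091971016875363257821470554496476463148890174667305078894816854981519081733521872145474339217792956535294739944522644371974297694458949107533213296966569190566695830290432,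
      1457579253707315590277980378859699256507604891971825697787166037590752544094877274970632495149105881243440821407642325758035677262162404031274257),
    (1137339089779243953255303271767598030575907584, 12,
      150284509258147444216110915616205899150363372160737364143679899202040601794115460861634656163313668799228629446772068483750050488107079127357470486142231476593217888157690558672128718354216748235778801232636913482009365633119444053248417590855809360099016817547749716771554034284371243536224582398442719915679307919457062186055703221907751209422395170807962941784064,
      1123467638052279286673121147225919712702655657649176933028560090523118677213348181673455141816082550181749298164938584188112080193695722866443321),
    (4549353105154429293910268167482797340990911232, 15,
      234536487154455811457196015878332475256419734714836816353348395663111813138866344353955979219587446700860713023508219481821434127569984359602792833313742923036998856833187407563523881214301640894216509435410417858551336641934405699760212649721387561887066702060279319071579997624973494821731830820371987327681571429107806460384154071271358143436511341026848301645824,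
      1457577776771072491144307709671596566805792663725195566237283562831521587381436529839722525199999521354218548297351442877087180088164674216661277),
    (1137342343729377634729360140287281596859429632, 16,
      225789769948146568166206486188017013525518451588548772432493677774136644698542345670291109033115855190026820579494903061076952230614335973065071477576050529137389362086521550563331436382661810443823406954052805127501696296375097661069951665395128626923465058857531891629312024175379710354633757114315139725599172509045397010478931950101536327355292972962150275350528,
      1457583344333163855617703828284157807257418310296384392184839400347938821024187353294672105371258576628859501111140923431628496993886738694541597),
    (4549356359104562975384325036002480907274433280, 12,
      53102599342299005751049623170168152393147971287199477139775255035345717567031201630335818933978170705068293160347628227191149444148923877893779858479803739477049096821766325440781029083198929399744134334170830429485286863465903189965997581026271103260408745220774757673544296840145789105864399340191138097583127986386464557494967005189213884494528814378382287437824,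
      745054686795155034194039488027835295100968189088615569972877037203726638751404019518999488189356789105486526320257076406616537319659843782538083),
    (1137339089776140747545394972609346320809865984, 12,
      150284509258147444223073390874645356774595816535274798922441077287071928155188590710716294230208081484919692191010961906859040244379764479565563695289774000490098714942876121712307688454680762476236576831870657339235282297557081533507389913055253879772039657328050143798631706405296994355420568504030122420896093933550780784042670834587233606229791588523900764422144,
      879005693133966702329538105052780529201057479279841189956897899556042854452168033965792250938527522672362108785658566346318538118578464059519021),
    (4549353105151326088200359868324545631224869632, 15,
      230111270938242768983425420685540060853934773116407389124796904335837295323039893885862360120812609408910992611020993783591195733574216003948161058078303697427409675902594732332473886191936332768263355349302042375187009115492418323695681386525171123124112022911655580869852568405730758411673635367232736802523360125081340563571903936393943909093868448204640971915264,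
      1651928622367211489007030486236581531825738254751875922938215737337674570939797729734966570731975518198480744461110694271687441448880859524373777),
    (1137342343726274429019451841129029887093388032, 16,
      225789769948146568165969405935938424236398375109141610970010002169719535041729368599911782316293122507472073075319958399426115055857699584260766316620581803705542112786081414849245862410192495547573216114006831388270124926482591891988845967150841229197011195878705609615915554147908131913686108217569373186392888000927813824188294174064042927144800121499417667698688,
      1651930497622298534280055414701977865462067510692522797572308394212890092891015412360162680949934053086402710999362913093838537681972442914888977),
    (4549356359101459769674416736844229197508391680, 12,
      26551302045020750903602921437357697162360003100864171381318591801586432676507357408549001271109416348467890046922399233698576087587914990132062324821953316686630226286367283259044418323336575247609035814342986889166976697692004964248329149413382575839825366281504236455969671692642412487961896142306801794432280893767612626160448470508801692748189945607602898468864,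
      501737466361552707152665520745768222059047384594001424621183063097429029686000551379672377925278662096209081844417689670054371793129718963604303),
    (1137339089779243956214753678184210250256626432, 14,
      230197700688985345035136454437274500057807747784609704783674387198669044480022103799336749872137655840391743158347887094277081865782279240571419948871726592527572311872360404133960564030862567939713058030446644560926899676184456469391014537987387565346043392445092479042399085815819001199414693568700160920810561377359048643248227475942383227689074349321420099551232,
      1457583344367056974168930689929210134681969215356658719295946206673840710496363166772559444627649439159626920333141555815508784004432298561772817),
    (4549353105154429296869718573899409560671630080, 12,
      230111270938242768983424483609444888564267666556428855466706624478979039475794012198185755208323303308202484819169151748886922379395909351144636420298886241808866375229650076755109966765435942502967839939200405529970291194172461393869301053220445458798137544686368512572059473306786660102279330842399502768828849265921250455554017732225262250854172258541672232648704,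
      1457577776737135057234098442194947626744353540199913840316073546174825892561676946521153514268032860765301769525463736413205679086343460012170513),
    (1137342343729377637688810546703893816540148480, 13,
      225789769948146568165968468859843251946731268549163077311919722312861279194483487061515456360410912877721879432712004233292820880509437675916288171831621993269756543864516791930106370844262395625480039145611492686701594278536984485135621446923550255955306536795796777386075936838838728954671565066792640880083665591207118889526774245682444348635922090312228036149248,
      1457583344367100814828939041345862613028121554535944036211901878861240074453207080195506400040115901001642057287350046390723343294598247693163793),
    (4549356359104562978343775442419093126955152128, 11,
      225686054194502782503250007777305051507091688093893126025330652575467899031731092903049672619691130464972624137158963682408474781288048639147888679979023352626235650559198685290756090938628356285573782832646186838182348511376307175861702496598722373430222291696105327851885593435626150329774145240705649885247541267779465967843950393926274072782402985183180362874880,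
      1457577776748358304468704399332090752526731426244840736185290085171367957665170997730094296401063740158556549053621058675088339051757502393752849),
    (1137339089776140744585947388544577378690544384, 13,
      106378061878771771642639153513041567300890798504413555404330080114635722850679039505067628075958200225072541280810832943407529178757847096713484180308891287018346758373731983898541919905493216257671642072963602576243014251152162690360771194133022864637094526562897981432688707533016820639965310434166117811605429031044863963668952673112287253044254955008687675015168,
      1367932058373852432810625892373196802430359847250580321013452637757164802106040716149263420918303805597596862322663694422121319382689142596126741),
    (4549353105151326085240912284259776689105548032, 16,
      106205203696103979555817614085947701441719095913609122172297239006600794237764006779841488363130505480951867839161937791013525027829072638254074881295702058984401236255266894577880728858564958111924003661539017152072350234144935184844207693257674197713274170596447938196161833850972001642330802064992094908124043811945922818401299697526996661048447165952537602818048,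
      554103361231855610481282752817714481240175350582845582334219142620699994923260015114919057589671476759181794943464421828641923010475734756182037),
    (1137342343726274426060004257064260944974066432, 11,
      106378061878771771642639153513041567300890798504395459232895356560319497127793297424375103742821906153131446104699246560272581137020524367231947501288101072059028455909420419198443179470705887294636459078812704465361412274841828985903439977101125327152223719175482693234677788838421875969404433590285001071954098939171913448161441949261356534285651003112196763811840,
      1367931074404636087905763637415163750997627322970225840141032905033632887316793961443887950406063763611403589594908062572703066673793184595920917),
    (4549356359101459766714969152779460255389070080, 12,
      221260836659472380006170356785694269490674974463919714775661536240184908121215704264866401597933394436650651804629690717478409386727717607577687243530337605691889950695155884762915695443600742389781892544617001468584306361027855381137386189705083003454451401236428109241062040824895906820565995352494748981410486686321437080657992363043146846772219464580562224676864,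
      919113661328533889283588701503462241810619944346785247761450703167694077893330208873911292538119494880413756529940826307358792446965338212349233),
    (1137339089779243953255306094119441308137304832, 14,
      106378061878771771642639153513041567300890798504413567231893224538151580166257921404782466996585022059156854665081247816510372272327833078587152118422146886149872440947859938747207245274120837198369458924138171346856387418773651386375615860136430819082811245806581172716272333356906158177766345645367246103293724836135157051503365405812973794515828673156441714982912,
      1367932058373915958485829800826660674437592694941142311685069686564519802976634150470334076070780575549884716624219796433958163797137585698195477),
    (4549353105154429293910270989834640618552308480, 12,
      70803465789732007666067068604852867406846540726836307057850734296245615939389589159937096381081303581588502634938699246812669170565655465201775103415501236664062286449473548845903234570048265158571927604407972748244648275978258215641103383690688728431491389884733505964216347935296726776835653523189201362890587672605401409988135901195876377228865922408137667641344,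
      745055994358071216281156910019472347202576653298255362802638007192093588324768901366044109987533139447118209330958075798439415647540541133255523),
    (1137342343729377634729362962639124874420826880, 12,
      106378061878771771642639153513041567300890798504398487089061033958078751779318986596605391727258161695549331650207383167721738862008686999418401204118534581030852715737140048375481628176954822198762852551527000511898857077872842140783925069603297167642120564457980601554863002716451457507751671629281159575303100548040594524280707691662008543733866441891344069689344,
      1367931074420898575302561928614418293177121762443652771324298052950483030851076905142902697629522752915912464827165458131638541252772723967608853),
    (4549356359104562975384327858354324184835830528, 15,
      234536487154455811450974767725378492631295185954227792105206300172952934216278281888565232328030568077208041116052214551831198067880214846254766070675906829830937823976041147734791559791278826466951234806988182576634378512978667261905539942414255225071419974079154606888956946782093906505012380566428133810775645616043461049460003837321741531768236366750869822111744,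
      1162052038825566789563634638833036004410242675446753404110726557619541283563884986360248015529689083673224904427967914737093713655903051059836209),
    (1137339089776140747545397794961189598371263232, 14,
      106378061878771771648401234379357200698623441524712240419078070909694940883480715297439711216773366566522704933933996702009196291593245972018031754308924731756551353844510410710926909132598979006489187959452466052503342304477600821502206486340002072257193958443517398453310868225394451804636086122962779517484228507037503458221318449973568710971758131886541873610752,
      1612390467914781147652009976297670085109472138291695485803276717695940395491799864047667229729696163799838917437984940997221644578853844468849697),
    (4549353105151326088200362690676388908786266880, 12,
      35401736060027667870113051060933118391190528629547568868770979190983997573765353312747480505027009262978345358751740320840950463449979853329355445868825748631947262497051263789681077474643513542654055322157136137796393595499467865222037527320189443927495050784605104561985932868454380507799453873032567426664974411306572531866200700792717583115358569788449629405184,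
      501738029652972935443991757320682994092284391064576268522121824805636953974238616122485147993332135134935334760817540005945589270350972132100943),
    (1137342343726274429019454663480873164654785280, 12,
      106378061878771771648402171441153726516545507055603898353269454947334194111602224132709910952340309401741474315794090753412672102621789089869039534921934400941147318987258597727756109862208546729902920570985625843704491921680205936844107180591749874587529444776665857598726982361403579248950416564144026983859803453588370356122565823251792037222216035539423879757824,
      1612391527888906977907401615801470390256307577547789007591772034780939157632013674091201718417715649872179714202499845310938378840911384877685793),
    (4549356359101459769674419559196072475069788928, 15,
      230111270938242768976960532747841937455440536678957355124987053399123165356736392922799293177285771038309438596070623590729842423818295363840975717269164928880299310999059230469552894118493620556930929249783159529646589342083519689222114351550925921725670894152361092681431734811370161067192374432899993241795702535072543938575860432136148603319374954838397544300544,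
      919114408563907231669794030843749070677365849032877985154419444042409729554328357638836340708031710684992467830007668636388682682120970848973109),
    (1137339089779243956214756500536053527818023680, 17,
      243456064917304094862981647953795132260512116810116252232775098225671350961519626377712786405106534535019502061752995166891707870458674877090373708261571532195554348404124652306771503949276868442917489140205989105351267700401152330170493885095986217864460054278441159169253632587516245099019623210408215228119162325900541309749981015746822213442015433026756440752128,
      1798165318982681424630656236731878023654983319176348356273039671142801842452772198268430591811731871394518972277696533073837965706564735982112778),
    (4549353105154429296869721396251252838233027328, 14,
      35401736060027667870113051060933118391190528629547568868770979190983997573765353312747480505027019613601277603923235891170861535267802599188330155788386191421758424704098653108118943782199723206529622827345969671656992563129286489575550314104525923928981540075774964369676668880299876243909054313913670399972868322007901501104037591757585756886051933599043883630592,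
      501749385767134926634084918596929786096456541338030222785103005276803311651996327815024358116625592289467487504486321198454003137710304563137359),
    (1137342343729377637688813369055737094101545728, 14,
      252150924378673181319959763150013057080120770287479984963337113135653390213592510749443704325378240910944608678924128973550758965489808735874973482797417164427101147860110987341467395640721670194707719837058188627447470756756873737926844045213114924445369326909549401636556112003041642174262568916450689718705621776626214277213743783386384028758152821050821849382912,
      919127232917713306147670653160819422697096422952022622979775571255975761353019983503513430424022762155170428752000805536632743958010082554819889),
    (4549356359104562978343778264770936404516549376, 12,
      234536487154455811450973830649283538521658420214252971528516721383912998073079010116403109820232370960069463429608147348370629747103331340338195014285451286981132198677115039328820120513505996435702950799510116046265548748368408024029058184649529200531357300420354864038904735408285618606043813046901243160528085818871297635594682512781207052987023955257012565049344,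
      919114408507344726765212166595054156775745660211523096860165204243646705048860366250406550342063706376000660044087959989133277089635738069775665),
    (1137339089776140744585944566192734101129186304, 12,
      35540021973129568738794125525050233202393192335868541841616962054750460630752576733448165928495710430327519680401112557503565392796817743008003614041618517886183272975491414128189939923042800703954963545319756920204424653961937336440455811537436987773497861607908101706522275700830669414687609319838559494293653554839335986250150450442445548651941224316324255105024,
      600055576312409850559908058072916111292869820456670728140602848749210696527438651910510704929625396376031109383693177547348547465394905491791691),
    (4549353105151326085240909461907933411544189952, 14,
      150457366649524820301132946352121979935245780949133070678793149572525788666023871499127363595682157002297892149989602397849326863823663911298847190868299819784755273757244457264485994027217023367726701594745099734827524569686304147653559411364734633646079538876963049435517170428918598683105006180825190926491844876196926779218401222534475219018173283297990732152832,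
      879008156953120123956661915060363216594495990032974995008471696543211583952441877498639148768435210192775815373469526578522389191493035433357357),
    (1137342343726274426060001434712417667412708352, 14,
      35540021973129568738794125525050233202393192335880665092940444613582548294228287832005718859680878868097982996698151945658173711361057786597416586331813166760471087057507246176452585700365255011883612630047921267932627860182896417901110378362863314012945870154606746348967763497020851540786706995803978638710486094332636517070593586941530972076717184689079364616192,
      600069897985085283316662875866302744317032569119749564781305537665478710041587450931928748370458699446689570211724760687805186643338761316425547),
    (4549356359101459766714966330427616977827712000, 17,
      243386921960753144430076711256645455939869562881262036649426821389949266343113168176851958742691913679178442179472091603119828709952353767557918987798339375648321068498335131115982024710596577705584441349316043878442674235941314083953455250109857873255003563492350880343091742507382403545128472951688993717765115145923460695512316715202376054612007379759174357352448,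
      1773769212691368525028631288902957432643399007428121954349488765201398228207449498475102546534219955151201673427505648681727151489614191541882888),
    (1137339089779243953255303271767598030575946752, 15,
      230128556677380506591361629754749986540363324360319835761089533031692930893386602383728678813439659231886208068686540755821498597900458827681224895252866624862321584326449365324683418012863051672955527725675456434425593942036601823645166538283091426507731821894788589900348872749964218217357589495936388127207925415271282996301175251738731303322450263084112338223104,
      969987659388473878643844771875641706921208438063823620173619279966704798777437555820056435707200084230808217357868075510099585723619469476768037),
    (4549353105154429293910268167482797340990950400, 12,
      106205204487394395557633990146834660429545237944260904925666266342377484805629966055718775647045380801057845360429927211060456915330804134750647687114088304299422443037343398149966053226601849251726988413245534810134596660587795514765540192717644421662009496473167395133261231820601526769841371488290800892261368898813096322286368178289506883711421090254053110185984,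
      1123469129502585121115046432273520894955006834940103992312410659638122006630499957879373603770475841429719576772478322826396043063389685487993913),
    (1137342343729377634729360140287281596859468800, 12,
      230128556677380506591361629769048633018766793107087941093674377933995295371727606989670103987601753574003165376963822181879335101065996403836904436669076102399150200445313361570717334358204393534734741860784042623150428256634874239861290317778716182870459664447494073833325451835331584423184976819164404215206963843151650310516748512975795161657574426603767877074944,
      1698800550343140067100351158771972073704310002449146940742607241429232108485918841520183939632488833589038902939142783102224789354027729859389733),
    (4549356359104562975384325036002480907274472448, 14,
      252237353074361869364624179384676910062643011154062244340379210291103001346745841440877394830197500957756326369606227381663522433823350559218639509802385098673715910273315120183929864561208918811024770165614773624557077095398207756667666670238972908013185335279673231640095437260997782927313994599322518505943737464318220026196561085025849353166256762188193125629952,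
      1698801896267410362732147338948004568149583115481902783360109983507050219640130514200190251948377122153331690813378515540580860408125821088966949),
    (1137339089776140747545394972609346320809905152, 15,
      230128556677380506585120703060995680836321674313038587523798243688209175014546471329789879595782144697121863588778451147173233286211952835382634014211666144464573445320481070887240984391847349975965066742188528652999365640318343809750793408379865781730912036093864590731382320788388870500292240248220268883870871422340906841946848259868048492889571646140839786184704,
      1212734753216878021998347512375957202804276741534260396954306182888522723439541327432786949238624972108557863392442870036573485150654250877992217),
    (4549353105151326088200359868324545631224908800, 12,
      150457366649524820301132946352121979935245780949133070678793149572525788666023871499127363595682157002297892149989602397849326863823663911298847183808265007499987434735459484779795422343987751666608207574110897318579049408270344856628656254074774108526734705420901419046082761802868053823334816114396072648381933834276422428871933377033271037595970394849834889641984,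
      879007184584271666927629062925267147453336445382738713465386856972091979341587468586859781971816056677799528599171585065768766940539984261378093),
    (1137342343726274429019451841129029887093427200, 12,
      230128556677380506585120703060995680832992511252397052951648298458418803476882737364134149242594639354009989960504438132905376221923135027888952242046901535310893932609986834043463819391179029994929334747465025481181642025862665121550425096493527706804278572462123164309364519361955085121835323439313417730581388496638213491584619043201711984140405699922426188529664,
      1407085598846954453771938040184014850387668598453073767466973706481035010359240395920468396721591884957495080455926066605191974746164927898074393),
    (4549356359101459769674416736844229197508430848, 14,
      230111271993296656990716615034852667188173689782512166153810765942700912965067651109942356900021933131276373828031389166461955821882793236402626825509784795291691418919430282983724342946907114983027191456655494563554298923341093621384265242417503676979935418200223792621002594986457193354388777728871312532744874077241022386304791394068787465833420637346742614884352,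
      1407090823318408365276306371821185370603524626493646134514560546214726378309584151400867814798475424547785843973676406282313893177854101011053849),
    (1137339089779243956214753678184210250256665600, 12,
      26655016479847176555712518895962198079689952618510495003889744153770541744959930437237868641954043799944557581354449597528281456012497813644443121767737100173405704215501092946705421014738821658452069195877075376770474041442612282110352643104290324487876785704756846749508344184382445514374508481596074304640425000564951602413762311698302231845246651565088108969984,
      600054271656802419421791319285336770315932349517231922961286002474396291945659444177204174576300644663661438218152149026348108796672542056996683),
    (4549353105154429296869718573899409560671669248, 16,
      225686055513320142513862619648425945194583060730286623697994448796779181029493533568141853297213848610387237628906124192930613081780332454534996002610252425843642880038878002175225118579857108096754611077412091950701176923472703195093110779355504461275729302865280394228399461549982305897948572479677759448166816791466916449886953132287596135221899436061742614970368,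
      1212743670051809940658186076826633037003837042824546116193317543005077306649884248965568494407381245483542936988776537302302566499336840180415769),
    (1137342343729377637688810546703893816540187648, 11,
      225703339933640520104946227228855843775816583588089132889289186324080771543966978910560818260505581145537457217342010056529404693354765992946997889487124435003282059319851285806714999547294962041660644184587741743680309472299392906881680856349128572067755068063974013463151284455933528206528341562540599201351618341916041207083564182634554761270730807451462423019520,
      1407085598824371839113785300719301307300491416709655739199608384062929278071295036869673136236986642832448261457429409839265138107904537670991129),
    (4549356359104562978343775442419093126955191296, 13,
      225686055513320142513862619648425945191253897669645089125844503566988809491820016370124422741352022543199279153196756510971292211679141778970349607813253119479255308886563475935343683244640856007266763418733446651282305447646686938153376624709251487642228524333460018407261222895514038031450245503873702372613511405562142016704473933344546387573899621183725668139008,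
      1407090823318320152461315435094897700523692659124912188366936248912582608165851204838096344147907712715279692295366038687528301412344164504321305),
    (1137339089776140744585947388544577378690583552, 16,
      97544914394193008293055863547011203688179051945976277629893395176826665081209814036393477790136889466930561024037650317891391810040739672013529607450203050581211463744547976227273299841168237635433370191570962474767559788754818449656844974422015479357439739607695684840801759578588865323111102975781291374700419761137455474369435807956133527393276372060152579227648,
      1367932058543536797329465350556212709758709171729286925261012835124201830009852505368762683083901906114465374920474258792530699143344472132752712),
    (4549353105151326085240912284259776689105587200, 13,
      106205204487394395564579598035564944140240834090552279446938619278454321678292567142540972883083598547444189781473345873770164023572468406582040373441435631150542121988657817702315230858446474337652298897765533348210269849645225469532159246391603777475385558504324356904194320710423482047728586365601734174953792436298370046244183178019049852102901276644350443388928,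
      1367928517204441879690229953263817822384538162549031170023183040044744761204782660585057224345136353719726104353688406886739561968502990641252373),
    (1137342343726274426060004257064260944974105600, 12,
      70665179876630106796903399937424249678750862443697019228193142285286234031411156472938588685657182280597440707808379659971475413530885277727523219017302004807404767724812270882353693124295257337171459545821821689068390057444878130598662907638282002883778613684380911208705845964194739716662730133476496571629177524226172516886615040131486027479067633725725080551424,
      208688561567145198970891174026589134794458234408978070722456207461967357671483616117571564128860583856612423996183340462808673014911694280427383),
    (4549356359101459766714969152779460255389109248, 14,
      106205204487394395564579598035564944140240834090534183275684370015282253607038227178222156906588116919298596771037599315645129199091204316673527243518884461584406252709924992374705611102470825159864715726698866496370541539387295649070836278718449109223755910099499627598671314369863739012324264957058079679816415773928593889710451353537816569307362518448331504484352,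
      1367928517204383230387578388482046793016464057288581977646299549707197452218784492074829210795905286814736165645446386469238259217664341462960149),
    (1137339089779243953255306094119441308137344000, 12,
      212444975705321770282627908435866224465788211132437702803959406578529767731075429369016945753782382336013121287840216161565032085326176054879249531818611949606749019814111082098239530408050722160227001092596644541041039602521965137084136301309574990701244758400259202761966911009626757482888253402894306160695710030089325964176518677115670426396178553628428645433344,
      1698801297521944815668523673082268300176986394883269607640931504549649710717516673402542886720679001313561523068297586124476916676779359928002853),
    (4549353105154429293910270989834640618552347648, 11,
      106205204487394395564579598035564944140240834090555295475541152252697719655403073853085161476260320070876227140547047029522352434052711005755413449912468404125878707362655056779670352803006700406536791798127026993843297026744678381259582588714857531980456540683709842628033574541966332027839561286078968105500099961437662467174889348946340537350573470777037312491520,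
      1367929582985607790213468464288466508752925881049653627712420818734566691578845565581213667421821005482946124938262551389520256436297420462573589),
    (1137342343729377634729362962639124874420866048, 15,
      234519201415318073849283233625705832497367417985183488689194648418269340168597760269305212380145928513251378817180089014477691196634697187421666662807317271085338249921768276429174639948637787897842281281479029346051541781863482248308808717311693139747823417119887307856187067452067561640706569550710755997222457804848984720596954538912580829161009105229405082353664,
      1698800550173452638634155972862112724776331504735746428715280664442542849966649911973358665658477444450035576915415308110742481155873074565358889),
    (4549356359104562975384327858354324184835869696, 12,
      106205204487394395564579598035564944140240834090534183275684370015282254248201926616250896435955404734397061968873578737051002978153270265534114555272739324719444260830330557123687609709409737265320632005520632866079497081077224101932619194542938977684646766240070396285908980147266344991889037049740283398702017495289498322356304514765141786578392991949625107677184,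
      1367929582970593523720087538024420254222955190468302128843638263813654798116349720326189705306244107446574944921339489177737993626427787151099925),
    (1137339089776140747545397794961189598371302400, 12,
      212444975705321770274468786989593324644881169936967638934588900989114907993800554485913725465364499991245430449835262661748896443411327098777126308440018640991652310200373555997124895632726416262483041606505628723868132735984942611559522590659478384906738089902714656049037219382241841769323167774819498345307678179650800233756836789922501902358316313168761212370944,
      1407084857482766424912626528109388051416739752262631251181756069072267981771857487950420801626357285253666065870848726848530648958173575732739353),
    (4549353105151326088200362690676388908786306048, 11,
      212410405545863655075699169600167952174475120342875336235735286681801178091927853901299536317076010214168905011295292010417262892856295472407367226044946823163096060809882674612846057048634921946813721250441995105485616460155710180249747163218338662139667936875646219396164283472823040629188500668423736593882142503448420552128572654997282032673828775305632305643520,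
      1407084857562485790893522103947689902456557333959621602370880923198391543743536841163094743244814832853462177048231325106743926849715679874465049),
    (1137342343726274429019454663480873164654824448, 15,
      234519201415318073842802415437288774156800852233557566729572929423811486896091310275780894036494154705311020584733496288315366418511211080063248923239110952699390097483934774282551994335031830792508916326846260622363508845810998603510821761836881028529199573277124909555415059292828333734032130405750145833733093603090313100155943993129673229701854225809906224594944,
      1407085598813016933553603003686084901512661452289475053143255585992658146434050139978190906364342083201894331587676655000482559637606100578343229),
    (4549356359101459769674419559196072475069828096, 12,
      150457366649524820306879096939121821814134918761892805470889707892766191884625376441672313107842309941270605895285778731060047272771416286813361885757531435315406725469218049478268570596356902498080246634564805638382268742112517121964597084230554571471579670847759102991477958814411901810242593585051212023383153698104118229011885359069410311469138914433530597474304,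
      1612393019339209419958373024866124511748162710467076502666320955513268670948718539842151013028595308450065057710179538330673155753153657875684385),
    (1137339089779243956214756500536053527818062848, 14,
      212444975705321770274468786989593324644881169936967638934588900989114907993800554336631168602954505901963869906123939730418674401678557093943125615238814494335391808587695819891287659545094606344532421157254960910059901458090511765510156599728933284933699667855931386874317429909478699498750752545557028535211935070216084488699558246927449832044999586656058114834432,
      1407083377593917718795951241817619634790642061478385787389821797367591096246751449054710879601339280255426862960111566627734239170505007475146009),
    (4549353105154429296869721396251252838233066496, 13,
      212410405282100183072378689154454837114218984791434493201342436923175249632259730038261582631246868504491906399256173658201732932758807890063689397980497252011659795939936197318640660819385303051354838276236091466448046104392413802762525549851646616767812904297477573588972631184981496766247635787386058414687991910970412892170556712159313817750358172484982389342208,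
      1407083377594229123070981063189551503126824161512261934921832747118075234658401430803037865228504501910765396534795779818581072271491702044704025),
    (1137342343729377637688813369055737094101584896, 12,
      52998884907472580098696385898222654135664545784760868368981609512168847778463281482366246929545538593842901447650156018429883225077877783062514626642863197498844193060231061183634532946512361259647221345342863205779532328337054714965712927294772495260836398349520961924473926257185766292798868061897757640268954073372360246667703368331502344427879596230701024804864,
      208688001183037244834555301656749479606939506798678032144312997875922499550907142049907774259268297369104298733383550213781674964378940763113335),
    (4549356359104562978343778264770936404516588544, 16,
      225686055513320142513382836701996379350085309440675886781013585015738526598443806938858789843090451896194206164648336292952849001552748269718371350183130604863056451862847874640106976973839477576767112364873191149430146444185680474187235899056206494432429293196954542422194620343522919785819101019168936598274973421604234055682959363533130141792074997156183936073728,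
      1407090823340944619320537663244452908058987979707805781065319173284567007756606631707639085392607147126863733917700650235330062300707868997065021)]

def kd5 : KD where
  q := 83206655958820035199884587218522677485507632741741728319424489585388544644819622336983769423820770265894353499643405541532750298357645555913936045932568287258402700668805255067008854943954150926773579424057141448652451299098477849360411249551697380119964426686206314682756408724062355648230348530654589747200
  r := 52187638547521825316617374242062104965025492501461176631483484312209661143797790121976470286805853679064136328715781075081579892793844584161793425535044098818460830074517489311850820528555381110933528898289082266603535539812988784927148589224685991291339916686925144429014501415611251167170661309602007613440
  nus := [89529403274711631458524904726661710070718287560273211920688346762199384441143301654588717102788860384589831109354174586611645488247382820496860764226508728086884051682750386392737732865309550357006822580858451777286500141437575055035005031476419058028418960984385123909303369665078464172483741182424042700800]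
  reps := []
  certs := [(0, 17,
      38074303519405696956921364675584672867259704532808217625470112210034559138112031474011640422325852339213447258448201079215455702443489472326200205126410778071996252511777637940589318273984273614669835229892132028869856499356761741783471271400111781187592562320958899689376542428955829965445842174569149890560,
      1481395191417263534151790859362323196129726636528529302687071828817361713884219414170369272597232891275805861267500608105414933746811326862133512)]

def KL3 : List KD := [kd0, kd1, kd2]

set_option maxRecDepth 100000 in
theorem idx3 : (KL3.all fun K => K.certs.all fun c => Nat.ble c.2.1 17) = true := by decide +kernel
set_option maxRecDepth 100000 in
theorem idx5 : (kd5.certs.all fun c => Nat.beq c.2.1 17) = true := by decide +kernel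
set_option maxRecDepth 100000 in
theorem dec5 : dtree 128 kd5.q (dleaf tab 128 (fun _ => true) kd5) kd5.reps 0 = true := by
  decide +kernel
set_option maxRecDepth 100000 in
theorem dec0 : dtree 152 kd0.q (dleaf tab 152 (step6 kd0.q) kd0) kd0.reps 0 = true := by
  decide +kernel
set_option maxRecDepth 100000 in
theorem dec1 : dtree 152 kd1.q (dleaf tab 152 (step6 kd1.q) kd1) kd1.reps 0 = true := by
  decide +kernel
set_option maxRecDepth 100000 in
theorem dec2 : dtree 152 kd2.q (dleaf tab 152 (step6 kd2.q) kd2) kd2.reps 0 = true := by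
  decide +kernel
set_option maxRecDepth 100000 in
theorem srch5 : search [(5, 120)] (leafF 128 [kd5]) 500 18 (addF 8 5 0) 0 [5] 8 = true := by
  decide +kernel
set_option maxRecDepth 100000 in
theorem srch3 : search [(4, 48), (6, 96)] (leafF 152 KL3) 500 16 (addF 8 4 0) 0 [4] 8 = true := by
  decide +kernel

end FG

namespace FG

/-! ### Telling the graphs apart -/
section inv
open Classical in
noncomputable def sm (G : SimpleGraph (Fin 60)) (f : Fin 60 → ℕ) (v : Fin 60) : ℕ :=
  ∑ w ∈ Finset.univ.filter (fun w => G.Adj v w), f w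
open Classical in
noncomputable def q0 (G : SimpleGraph (Fin 60)) (v : Fin 60) : ℕ :=
  sm G (fun a => sm G (fun b => sm G (fun c => sm G (fun d => if G.Adj c d then 1 else 0) b) a) v) v
noncomputable def qk (G : SimpleGraph (Fin 60)) : ℕ → Fin 60 → ℕ
  | 0 => q0 G
  | k + 1 => fun v => qk G k v + sm G (fun w => qk G k w * qk G k w) v
noncomputable def invG (G : SimpleGraph (Fin 60)) : ℕ := ∑ v, qk G 3 v * qk G 3 v

variable {G G' : SimpleGraph (Fin 60)}

theorem sm_iso (φ : G ≃g G') (f : Fin 60 → ℕ) (v : Fin 60) :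
    sm G' f (φ v) = sm G (fun w => f (φ w)) v := by
  unfold sm
  symm
  apply Finset.sum_bij (fun w _ => φ w)
  · intro w hw
    simp only [Finset.mem_filter, Finset.mem_univ, true_and] at hw ⊢
    exact φ.map_adj_iff.2 hw
  · intro a _ b _ h; exact φ.injective h
  · intro w hw
    simp only [Finset.mem_filter, Finset.mem_univ, true_and] at hw
    refine ⟨φ.symm w, ?_, by simp⟩
    simp only [Finset.mem_filter, Finset.mem_univ, true_and]
    rw [← φ.map_adj_iff]; simpa using hw
  · intro _ _; rfl

theorem q0_iso (φ : G ≃g G') (v : Fin 60) : q0 G' (φ v) = q0 G v := by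
  unfold q0
  simp only [sm_iso φ]
  congr! 9 with a b c d
  exact φ.map_adj_iff

theorem qk_iso (φ : G ≃g G') : ∀ (k : ℕ) (v : Fin 60), qk G' k (φ v) = qk G k v
  | 0, v => q0_iso φ v
  | k + 1, v => by
    simp only [qk, sm_iso φ, qk_iso φ k]

theorem invG_iso (φ : G ≃g G') : invG G' = invG G := by
  unfold invG
  rw [← Equiv.sum_comp φ.toEquiv]
  apply Finset.sum_congr rfl
  intro v _
  have := qk_iso φ 3 v
  change qk G' 3 (φ v) * qk G' 3 (φ v) = _
  rw [this]

noncomputable def sB (T : ℕ) (f : ℕ → ℕ) (a : ℕ) : ℕ :=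
  Nat.add (Nat.add (frc (gt T (3 * a)) f) (frc (gt T (3 * a + 1)) f)) (frc (gt T (3 * a + 2)) f)
noncomputable def qB (T v : ℕ) : ℕ :=
  sB T (fun a => sB T (fun b => sB T (fun c => sB T (fun d => bif adjB T c d then 1 else 0) b) a) v) v
noncomputable def chkC0 (T c0 : ℕ) : Bool := allB (fun v => Nat.beq (gt c0 v) (qB T v)) 60
noncomputable def cc (T c0 : ℕ) : ℕ → ℕ → ℕ
  | 0, v => gt c0 v
  | k + 1, v => Nat.add (cc T c0 k v) (sB T (fun w => frc (cc T c0 k w) fun x => Nat.mul x x) v)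
noncomputable def sumB (f : ℕ → ℕ) : ℕ → ℕ
  | 0 => 0
  | n + 1 => Nat.add (sumB f n) (f n)
noncomputable def invB (T c0 : ℕ) : ℕ := sumB (fun v => frc (cc T c0 3 v) fun x => Nat.mul x x) 60

theorem sm_eq {T : ℕ} (H : NbOK T) {f : Fin 60 → ℕ} {g : ℕ → ℕ} (h : ∀ w : Fin 60, f w = g w)
    (a : Fin 60) : sm (grT T) f a = sB T g a := by
  classical
  have e : Finset.univ.filter (fun w => (grT T).Adj a w) = Finset.univ.image (H.nf a) := by
    ext w
    simp only [Finset.mem_filter, Finset.mem_univ, true_and, Finset.mem_image]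
    exact H.nf_adj a w
  unfold sm sB
  rw [e, Finset.sum_image (fun x _ y _ h => H.nf_inj a h), Fin.sum_univ_three]
  simp only [frc_eq, h]
  rfl

theorem q0_eq {T : ℕ} (H : NbOK T) (v : Fin 60) : q0 (grT T) v = qB T v := by
  unfold q0 qB
  refine sm_eq H (fun a => ?_) v
  refine sm_eq H (fun b => ?_) v
  refine sm_eq H (fun c => ?_) a
  refine sm_eq H (fun d => ?_) b
  by_cases h : (grT T).Adj c d
  · rw [if_pos h, (H.adj c d).1 h]; rfl
  · rw [if_neg h]
    have : adjB T c d = false := by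
      rw [Bool.eq_false_iff]; intro h'; exact h ((H.adj c d).2 h')
    rw [this]; rfl

theorem qk_eq {T c0 : ℕ} (H : NbOK T) (h : chkC0 T c0 = true) :
    ∀ (k : ℕ) (v : Fin 60), qk (grT T) k v = cc T c0 k v
  | 0, v => by
    have := (allB_iff _ _).1 h v v.2
    rw [Nat.beq_eq] at this
    simp only [qk, cc]
    rw [this]; exact q0_eq H v
  | k + 1, v => by
    simp only [qk, cc]
    rw [sm_eq H (g := fun w => frc (cc T c0 k w) fun x => Nat.mul x x), qk_eq H h k v]
    · rfl
    · intro w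
      rw [frc_eq, qk_eq H h k w]; rfl

theorem sumB_eq (f : ℕ → ℕ) : ∀ n, sumB f n = ∑ i ∈ Finset.range n, f i
  | 0 => rfl
  | n + 1 => by rw [Finset.sum_range_succ, ← sumB_eq f n]; rfl

theorem invG_eq {T c0 : ℕ} (H : NbOK T) (h : chkC0 T c0 = true) : invG (grT T) = invB T c0 := by
  unfold invG invB
  rw [sumB_eq, ← Fin.sum_univ_eq_sum_range]
  apply Finset.sum_congr rfl
  intro v _
  rw [frc_eq, qk_eq H h 3 v]; rfl
end inv

/-! ### Conclusion -/
noncomputable def chkD (d : GD) : Bool :=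
  chkPl d.nb d.fs && chkConn d.nb d.fs && chkSx d.nb d.fs d.hx d.mt && chkC0 d.nb d.c0

set_option maxRecDepth 100000 in
theorem gd_ok : gdList.all chkD = true := by decide +kernel
set_option maxRecDepth 100000 in
theorem gd_inv : (gdList.map fun d => invB d.nb d.c0).Nodup := by decide +kernel
set_option maxRecDepth 100000 in
theorem gd_ipr : chkI gd17.fs = true := by decide +kernel

theorem gd_len : gdList.length = 18 := rfl

def gdAt (i : Fin 18) : GD := gdList.get (Fin.cast gd_len.symm i)

theorem gdAt_ok (i : Fin 18) : chkD (gdAt i) = true :=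
  List.all_eq_true.1 gd_ok _ (List.get_mem _ _)

theorem gdAt_pl (i : Fin 18) : chkPl (gdAt i).nb (gdAt i).fs = true := by
  have := gdAt_ok i
  unfold chkD at this
  simp only [Bool.and_eq_true] at this
  exact this.1.1.1

noncomputable def GG (i : Fin 18) : PlaneGraph (Fin 60) := mkP (gdAt_pl i)

theorem GG_graph (i : Fin 18) : (GG i).graph = grT (gdAt i).nb := rfl

theorem gdAt_tab (i : Fin 18) : tab i.val = (gdAt i).nb := by
  unfold tab gdAt
  rw [List.getD_eq_getElem _ _ (by rw [gd_len]; exact i.2)]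
  rfl

theorem iso_of_ident {Q : PlaneGraph (Fin 60)} (hQ : IsFullerene Q) (i : Fin 18) (g : ℕ → Fin 60)
    (g1 : ∀ x, ∃ a, a < 60 ∧ g a = x)
    (g2 : ∀ a t, a < 60 → t < 3 → Q.graph.Adj (g a) (g (gt (tab i.val) (3 * a + t)))) :
    Nonempty (Q.graph ≃g (GG i).graph) := by
  have H := (chkPl_ok (gdAt_pl i)).1
  rw [gdAt_tab] at g2
  let γ : Fin 60 → Fin 60 := fun a => g a
  have hs : Function.Surjective γ := by
    intro x
    obtain ⟨a, ha, e⟩ := g1 x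
    exact ⟨⟨a, ha⟩, e⟩
  have hinj : Function.Injective γ := Finite.injective_iff_surjective.2 hs
  have hom : ∀ a b, (grT (gdAt i).nb).Adj a b → Q.graph.Adj (γ a) (γ b) := by
    intro a b h
    rw [H.nf_adj] at h
    obtain ⟨t, rfl⟩ := h
    exact g2 a t a.2 t.2
  have himg : ∀ a, γ '' ((grT (gdAt i).nb).neighborSet a) = Q.graph.neighborSet (γ a) := by
    intro a
    apply Set.eq_of_subset_of_ncard_le
    · rintro _ ⟨b, hb, rfl⟩; exact hom a b hb
    · rw [hQ.cubic, Set.ncard_image_of_injective _ hinj, H.cubic]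
    · exact Set.toFinite _
  rw [GG_graph]
  refine ⟨RelIso.symm ⟨Equiv.ofBijective γ ⟨hinj, hs⟩, ?_⟩⟩
  intro a b
  change Q.graph.Adj (γ a) (γ b) ↔ _
  refine ⟨fun h => ?_, hom a b⟩
  have : γ b ∈ Q.graph.neighborSet (γ a) := h
  rw [← himg] at this
  obtain ⟨c, hc, e⟩ := this
  rw [← hinj e]; exact hc

theorem main_thm :
    ∃ G : Fin 18 → PlaneGraph (Fin 60),
      (∀ i, IsFullerene (G i) ∧ IsExtremalFullerene (G i)) ∧
      (∀ i j, i ≠ j → ¬Nonempty ((G i).graph ≃g (G j).graph)) ∧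
      (∀ Q : PlaneGraph (Fin 60), IsFullerene Q → IsExtremalFullerene Q →
        ∃ i, Nonempty (Q.graph ≃g (G i).graph)) ∧
      ∃ i, NoAdjacentPentagons (G i) ∧
        ∀ Q : PlaneGraph (Fin 60), IsFullerene Q → NoAdjacentPentagons Q →
          Nonempty (Q.graph ≃g (G i).graph) := by
  refine ⟨GG, ?_, ?_, ?_, 17, ?_, ?_⟩
  · intro i
    have := gdAt_ok i
    unfold chkD at this
    simp only [Bool.and_eq_true] at this
    exact ⟨mkP_fullerene (gdAt_pl i) this.1.1.2, mkP_extremal (gdAt_pl i) this.1.1.2 this.1.2⟩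
  · rintro i j hij ⟨φ⟩
    have c : ∀ i : Fin 18, invG (GG i).graph = invB (gdAt i).nb (gdAt i).c0 := by
      intro i
      have := gdAt_ok i
      unfold chkD at this
      simp only [Bool.and_eq_true] at this
      exact invG_eq (chkPl_ok (gdAt_pl i)).1 this.2
    have e := invG_iso φ
    rw [c, c] at e
    have key := List.nodup_iff_injective_get.1 gd_inv
    have := @key (Fin.cast (by rw [List.length_map, gd_len]) i)
      (Fin.cast (by rw [List.length_map, gd_len]) j) (by
        simp only [List.get_eq_getElem, List.getElem_map, Fin.val_cast]
        exact e.symm)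
    exact hij (Fin.ext (congrArg Fin.val this))
  · rintro Q hQ ⟨X, ⟨hX, _⟩, hc⟩
    rw [Fintype.card_fin] at hc
    obtain ⟨K, hK, c, hcK, g, g1, g2⟩ := sext_ident hQ (Fintype.card_fin 60) hX (by omega) KL3 tab srch3 (by
      intro K hK
      simp only [KL3, List.mem_cons, List.not_mem_nil, or_false] at hK
      rcases hK with rfl | rfl | rfl
      · exact dec0
      · exact dec1
      · exact dec2)
    have hi := List.all_eq_true.1 (List.all_eq_true.1 idx3 K hK) c hcK
    rw [Nat.ble_eq] at hi
    exact ⟨⟨c.2.1, by omega⟩, iso_of_ident hQ ⟨c.2.1, by omega⟩ g g1 g2⟩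
  · exact mkP_ipr (gdAt_pl 17) gd_ipr
  · intro Q hQ hN
    obtain ⟨K, hK, c, hcK, g, g1, g2⟩ := ipr_ident hQ (Fintype.card_fin 60) hN [kd5] tab srch5 (by
      intro K hK
      rw [List.mem_singleton] at hK
      subst hK; exact dec5)
    rw [List.mem_singleton] at hK
    subst hK
    have hi := List.all_eq_true.1 idx5 c hcK
    rw [Nat.beq_eq] at hi
    rw [hi] at g2
    exact iso_of_ident hQ 17 g g1 g2

end FG

namespace FG

/-- Theorem, Section 4. There are, up to isomorphism, exactly 18
distinct extremal fullerene graphs with 60 vertices (fullerene graphs on 60 vertices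
whose Clar number equals 8, i.e. (60 − 12)/6); one of them is the buckminsterfullerene
`C_60`, the unique fullerene graph on 60 vertices with no two adjacent pentagons. -/
theorem statement_19 :
    ∃ G : Fin 18 → PlaneGraph (Fin 60),
      (∀ i, IsFullerene (G i) ∧ IsExtremalFullerene (G i)) ∧
      (∀ i j, i ≠ j → ¬Nonempty ((G i).graph ≃g (G j).graph)) ∧
      (∀ Q : PlaneGraph (Fin 60), IsFullerene Q → IsExtremalFullerene Q →
        ∃ i, Nonempty (Q.graph ≃g (G i).graph)) ∧
      ∃ i, NoAdjacentPentagons (G i) ∧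
        ∀ Q : PlaneGraph (Fin 60), IsFullerene Q → NoAdjacentPentagons Q →
          Nonempty (Q.graph ≃g (G i).graph) := by
  exact main_thm

end FG
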